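/- Let U be a nonnegative solution of the extension problem on the punctured half-ball 𝔅_2^+. Then there exists a constant C > 0 (depending on U, n and σ but independent of r) such that for every 0 < r < 1/4, the spherical Harnack inequality holds on the closed annulus: sup of U over {X = (x,t) : r/2 ≤ |X| ≤ 2r, t ≥ 0} ≤ C · inf of U over {X = (x,t) : r/2 ≤ |X| ≤ 2r, t ≥ 0}. -/

import Mathlib

open scoped Topology MeasureTheory RealInnerProductSpace
open Filter MeasureTheory

noncomputable section

/-- Points of `ℝ^{n+1}`, written `X = (x, t)` with `x ∈ ℝⁿ` and `t ∈ ℝ`. -/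
abbrev Pt (n : ℕ) := EuclideanSpace ℝ (Fin n) × ℝ

/-- The Euclidean norm on `ℝ^{n+1} = ℝⁿ × ℝ`. -/
def enorm' {n : ℕ} (X : Pt n) : ℝ := Real.sqrt (‖X.1‖ ^ 2 + X.2 ^ 2)

/-- Partial derivative in the last (`t`) direction. -/
def dt {n : ℕ} (U : Pt n → ℝ) (X : Pt n) : ℝ := fderiv ℝ U X (0, 1)

/-- Second derivative in the direction `v`. -/
def d2 {n : ℕ} (U : Pt n → ℝ) (X v : Pt n) : ℝ :=
  fderiv ℝ (fun Y => fderiv ℝ U Y v) X v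

/-- The Laplacian on `ℝ^{n+1}`. -/
def lapl {n : ℕ} (U : Pt n → ℝ) (X : Pt n) : ℝ :=
  (∑ i : Fin n, d2 U X (EuclideanSpace.single i (1 : ℝ), (0 : ℝ))) + d2 U X (0, 1)

/-- `U` is a nonnegative solution of the extension problem on the punctured half-ball
`𝔅_R^+`: it is nonnegative and continuous on `{|X| ≤ R, t ≥ 0} \ {0}`, `C²` on `𝔅_R^+`,
satisfies `ΔU + ((1-2σ)/t) ∂_t U = 0` there, and satisfies the nonlinear Neumann condition
`lim_{t→0⁺} t^{1-2σ} ∂_t U(x,t) = -u(x)^{(n+2σ)/(n-2σ)}` for `x ∈ B_R \ {0}`. -/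
def ExtSol (n : ℕ) (σ R : ℝ) (U : Pt n → ℝ) : Prop :=
  (∀ X : Pt n, enorm' X ≤ R → 0 ≤ X.2 → X ≠ 0 → 0 ≤ U X) ∧
  ContinuousOn U ({X : Pt n | enorm' X ≤ R ∧ 0 ≤ X.2} \ {0}) ∧
  ContDiffOn ℝ 2 U {X : Pt n | enorm' X < R ∧ 0 < X.2} ∧
  (∀ X : Pt n, enorm' X < R → 0 < X.2 →
    lapl U X + ((1 - 2 * σ) / X.2) * dt U X = 0) ∧
  (∀ x : EuclideanSpace ℝ (Fin n), ‖x‖ < R → x ≠ 0 →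
    Tendsto (fun t : ℝ => t ^ (1 - 2 * σ) * dt U (x, t)) (𝓝[>] 0)
      (𝓝 (-(U (x, 0) ^ (((n : ℝ) + 2 * σ) / ((n : ℝ) - 2 * σ))))))

/-! ### Second-order jets along lines -/

/-- `f` is differentiable near `0`, with first and second derivatives `p`, `r` at `0`. -/
def LineJet {F : Type*} [NormedAddCommGroup F] [NormedSpace ℝ F] (f : ℝ → F) (p r : F) : Prop :=
  ∃ g : ℝ → F, (∀ᶠ s in 𝓝 (0 : ℝ), HasDerivAt f (g s) s) ∧ g 0 = p ∧ HasDerivAt g r 0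

section LineJet

variable {F : Type*} [NormedAddCommGroup F] [NormedSpace ℝ F]

theorem LineJet.const (c : F) : LineJet (fun _ => c) 0 0 :=
  ⟨fun _ => 0, Eventually.of_forall fun s => hasDerivAt_const s c, rfl, hasDerivAt_const _ _⟩

theorem LineJet.add {f g : ℝ → F} {p r p' r' : F} (hf : LineJet f p r) (hg : LineJet g p' r') :
    LineJet (fun s => f s + g s) (p + p') (r + r') := by
  obtain ⟨u, hu, hu0, hu1⟩ := hf
  obtain ⟨v, hv, hv0, hv1⟩ := hg
  refine ⟨fun s => u s + v s, ?_, by simp [hu0, hv0], hu1.add hv1⟩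
  filter_upwards [hu, hv] with s h1 h2 using h1.add h2

theorem LineJet.smul {f : ℝ → ℝ} {g : ℝ → F} {p r : ℝ} {p' r' : F}
    (hf : LineJet f p r) (hg : LineJet g p' r') :
    LineJet (fun s => f s • g s) (f 0 • p' + p • g 0)
      (f 0 • r' + p • p' + (p • p' + r • g 0)) := by
  obtain ⟨u, hu, hu0, hu1⟩ := hf
  obtain ⟨v, hv, hv0, hv1⟩ := hg
  subst hu0 hv0
  refine ⟨fun s => f s • v s + u s • g s, ?_, rfl, ?_⟩
  · filter_upwards [hu, hv] with s h1 h2 using h1.smul h2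
  · exact (hu.self_of_nhds.smul hv1).add (hu1.smul hv.self_of_nhds)

theorem LineJet.mul {f g : ℝ → ℝ} {p r p' r' : ℝ}
    (hf : LineJet f p r) (hg : LineJet g p' r') :
    LineJet (fun s => f s * g s) (f 0 * p' + p * g 0) (f 0 * r' + 2 * (p * p') + r * g 0) := by
  have h := hf.smul hg
  simp only [smul_eq_mul] at h
  convert h using 1
  ring

theorem LineJet.congr {f g : ℝ → F} {p r : F} (hf : LineJet f p r) (h : f =ᶠ[𝓝 0] g) :
    LineJet g p r := by
  obtain ⟨u, hu, hu0, hu1⟩ := hf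
  refine ⟨u, ?_, hu0, hu1⟩
  filter_upwards [hu, h.eventuallyEq_nhds] with s h1 h2
  exact h1.congr_of_eventuallyEq h2.symm

theorem LineJet.line (w v : F) : LineJet (fun s : ℝ => w + s • v) v 0 := by
  refine ⟨fun _ => v, Eventually.of_forall fun s => ?_, rfl, hasDerivAt_const _ _⟩
  simpa using ((hasDerivAt_id s).smul_const v).const_add w

theorem LineJet.continuousAt {f : ℝ → F} {p r : F} (hf : LineJet f p r) : ContinuousAt f 0 := by
  obtain ⟨u, hu, -, -⟩ := hf
  exact hu.self_of_nhds.continuousAt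

theorem LineJet.scalar_comp {f : ℝ → ℝ} {p r : ℝ} (hf : LineJet f p r) {h h₁ : ℝ → ℝ} {h₂ : ℝ}
    (hh : ∀ᶠ y in 𝓝 (f 0), HasDerivAt h (h₁ y) y) (hh₂ : HasDerivAt h₁ h₂ (f 0)) :
    LineJet (fun s => h (f s)) (h₁ (f 0) * p) (h₂ * p ^ 2 + h₁ (f 0) * r) := by
  have hc := hf.continuousAt
  obtain ⟨u, hu, hu0, hu1⟩ := hf
  subst hu0
  refine ⟨fun s => h₁ (f s) * u s, ?_, rfl, ?_⟩
  · filter_upwards [hu, hc.eventually hh] with s h1 h2 using h2.comp s h1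
  · have h3 := (HasDerivAt.comp (0 : ℝ) hh₂ hu.self_of_nhds).mul hu1
    exact h3.congr_deriv (by simp only [Function.comp]; ring)

theorem LineJet.inv {f : ℝ → ℝ} {p r : ℝ} (hf : LineJet f p r) (h0 : f 0 ≠ 0) :
    LineJet (fun s => (f s)⁻¹) (-p / f 0 ^ 2) (2 * p ^ 2 / f 0 ^ 3 - r / f 0 ^ 2) := by
  have key := hf.scalar_comp (h := fun y => y⁻¹) (h₁ := fun y => -(y ^ 2)⁻¹)
    (h₂ := 2 / f 0 ^ 3) ?_ ?_
  · convert key using 1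
    · ring
    · ring
  · filter_upwards [isOpen_ne.mem_nhds h0] with y hy using hasDerivAt_inv hy
  · have := ((hasDerivAt_pow 2 (f 0)).inv (pow_ne_zero 2 h0)).neg
    exact this.congr_deriv (by simp; field_simp)

theorem LineJet.rpow {f : ℝ → ℝ} {p r : ℝ} (hf : LineJet f p r) (h0 : 0 < f 0) (k : ℝ) :
    LineJet (fun s => f s ^ k) (k * (f 0 ^ k / f 0) * p)
      (k * (k - 1) * (f 0 ^ k / f 0 ^ 2) * p ^ 2 + k * (f 0 ^ k / f 0) * r) := by
  have key := hf.scalar_comp (h := fun y => y ^ k) (h₁ := fun y => k * y ^ (k - 1))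
    (h₂ := k * ((k - 1) * f 0 ^ (k - 1 - 1))) ?_ ?_
  · have e1 : f 0 ^ (k - 1) = f 0 ^ k / f 0 := Real.rpow_sub_one h0.ne' k
    have e2 : f 0 ^ (k - 1 - 1) = f 0 ^ k / f 0 ^ 2 := by
      rw [Real.rpow_sub_one h0.ne', e1]; field_simp
    rw [e1, e2] at key
    convert key using 1
    ring
  · filter_upwards [isOpen_ne.mem_nhds h0.ne'] with y hy
      using Real.hasDerivAt_rpow_const (Or.inl hy)
  · exact (Real.hasDerivAt_rpow_const (Or.inl h0.ne')).const_mul k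

theorem LineJet.contDiffAt_comp {γ : ℝ → F} {p r : F} (hγ : LineJet γ p r) {U : F → ℝ}
    (hU : ContDiffAt ℝ 2 U (γ 0)) :
    LineJet (fun s => U (γ s)) (fderiv ℝ U (γ 0) p)
      (fderiv ℝ (fderiv ℝ U) (γ 0) p p + fderiv ℝ U (γ 0) r) := by
  have hc := hγ.continuousAt
  obtain ⟨u, hu, hu0, hu1⟩ := hγ
  subst hu0
  refine ⟨fun s => fderiv ℝ U (γ s) (u s), ?_, rfl, ?_⟩
  · have h1 : ∀ᶠ y in 𝓝 (γ 0), ContDiffAt ℝ 2 U y := hU.eventually (by simp)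
    filter_upwards [hu, hc.eventually h1] with s h2 h3
    exact (h3.differentiableAt (by norm_num)).hasFDerivAt.comp_hasDerivAt s h2
  · have h1 : HasFDerivAt (fderiv ℝ U) (fderiv ℝ (fderiv ℝ U) (γ 0)) (γ 0) :=
      ((hU.fderiv_right (m := 1) (by norm_num)).differentiableAt (by norm_num)).hasFDerivAt
    exact (h1.comp_hasDerivAt (0 : ℝ) hu.self_of_nhds).clm_apply hu1

theorem LineJet.isLocalMin {f : ℝ → ℝ} {p r : ℝ} (hf : LineJet f p r) (hm : IsLocalMin f 0) :
    p = 0 ∧ 0 ≤ r := by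
  obtain ⟨u, hu, hu0, hu1⟩ := hf
  have hp : u 0 = 0 := hm.hasDerivAt_eq_zero hu.self_of_nhds
  refine ⟨hu0 ▸ hp, ?_⟩
  by_contra! hr
  have h1 : ∀ᶠ s in 𝓝[>] (0 : ℝ), u s < 0 := by
    have h2 := hu1.tendsto_slope_zero_right
    have h3 := h2.eventually (gt_mem_nhds hr)
    filter_upwards [h3, self_mem_nhdsWithin] with s h4 (h5 : 0 < s)
    simp only [zero_add, hp, sub_zero, smul_eq_mul] at h4
    by_contra! h6
    exact absurd h4 (not_lt.2 (mul_nonneg (inv_nonneg.2 h5.le) h6))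
  have h2 : ∀ᶠ s in 𝓝[>] (0 : ℝ), f 0 ≤ f s := hm.filter_mono nhdsWithin_le_nhds
  have h3 : ∀ᶠ s in 𝓝[>] (0 : ℝ), HasDerivAt f (u s) s := hu.filter_mono nhdsWithin_le_nhds
  obtain ⟨δ, hδ, h4⟩ := mem_nhdsGT_iff_exists_Ioo_subset.1 (h1.and (h2.and h3))
  have hδ' : (0 : ℝ) < δ := hδ
  have h5 : δ / 2 ∈ Set.Ioo 0 δ := ⟨by linarith, by linarith⟩
  obtain ⟨c, hc, hc'⟩ := exists_hasDerivAt_eq_slope f u (show (0 : ℝ) < δ / 2 by linarith)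
    (by
      intro s hs
      rcases eq_or_lt_of_le hs.1 with rfl | h
      · exact hu.self_of_nhds.continuousAt.continuousWithinAt
      · exact (h4 ⟨h, by linarith [hs.2]⟩).2.2.continuousAt.continuousWithinAt)
    (fun s hs => (h4 ⟨hs.1, by linarith [hs.2]⟩).2.2)
  have h6 := (h4 ⟨hc.1, by linarith [hc.2]⟩).1
  have h7 := (h4 h5).2.1
  rw [hc'] at h6
  have : 0 ≤ (f (δ / 2) - f 0) / (δ / 2 - 0) := div_nonneg (by linarith) (by linarith)
  linarith

end LineJet

/-! ### The degenerate operator -/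

/-- The standard basis of `ℝ^{n+1}`; `none` is the `t` direction. -/
def stdVec {n : ℕ} : Option (Fin n) → Pt n
  | none => (0, 1)
  | some i => (EuclideanSpace.single i 1, 0)

/-- Square of the Euclidean norm on `ℝ^{n+1}`. -/
def nsq {n : ℕ} (X : Pt n) : ℝ := ‖X.1‖ ^ 2 + X.2 ^ 2

/-- `F` has directional second derivatives at `X` and `ΔF + (a/t) ∂_t F = ℓ` there. -/
def HasOp {n : ℕ} (a : ℝ) (F : Pt n → ℝ) (X : Pt n) (ℓ : ℝ) : Prop :=
  ∃ p r : Option (Fin n) → ℝ, (∀ i, LineJet (fun s : ℝ => F (X + s • stdVec i)) (p i) (r i)) ∧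
    ℓ = ∑ i, r i + a / X.2 * p none

section HasOp

variable {n : ℕ} {a : ℝ} {F G : Pt n → ℝ} {X : Pt n} {ℓ ℓ' : ℝ}

theorem HasOp.add (hF : HasOp a F X ℓ) (hG : HasOp a G X ℓ') :
    HasOp a (fun Y => F Y + G Y) X (ℓ + ℓ') := by
  obtain ⟨p, r, h, rfl⟩ := hF
  obtain ⟨p', r', h', rfl⟩ := hG
  refine ⟨fun i => p i + p' i, fun i => r i + r' i, fun i => (h i).add (h' i), ?_⟩
  rw [Finset.sum_add_distrib]
  ring

theorem HasOp.const_mul (hF : HasOp a F X ℓ) (c : ℝ) :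
    HasOp a (fun Y => c * F Y) X (c * ℓ) := by
  obtain ⟨p, r, h, rfl⟩ := hF
  refine ⟨fun i => c * p i, fun i => c * r i, fun i => ?_, ?_⟩
  · simpa using (LineJet.const c).mul (h i)
  · rw [← Finset.mul_sum]
    ring

theorem HasOp.sub (hF : HasOp a F X ℓ) (hG : HasOp a G X ℓ') :
    HasOp a (fun Y => F Y - G Y) X (ℓ - ℓ') := by
  simpa [sub_eq_add_neg] using hF.add (hG.const_mul (-1))

theorem HasOp.const (a : ℝ) (X : Pt n) (c : ℝ) : HasOp a (fun _ => c) X 0 :=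
  ⟨fun _ => 0, fun _ => 0, fun _ => LineJet.const c, by simp⟩

theorem HasOp.nonneg_of_isLocalMin (hF : HasOp a F X ℓ) (hm : IsLocalMin F X) : 0 ≤ ℓ := by
  obtain ⟨p, r, h, rfl⟩ := hF
  have key : ∀ i, p i = 0 ∧ 0 ≤ r i := fun i => by
    refine (h i).isLocalMin ?_
    have hc : Tendsto (fun s : ℝ => X + s • stdVec i) (𝓝 0) (𝓝 X) := by
      have : Continuous (fun s : ℝ => X + s • stdVec i) := by fun_prop
      simpa using this.tendsto 0
    have := hc.eventually hm
    simpa [IsLocalMin, IsMinFilter] using this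
  rw [(key none).1, mul_zero, add_zero]
  exact Finset.sum_nonneg fun i _ => (key i).2

theorem hasOp_of_contDiffAt (hF : ContDiffAt ℝ 2 F X) :
    HasOp a F X (lapl F X + a / X.2 * dt F X) := by
  refine ⟨fun i => fderiv ℝ F X (stdVec i),
    fun i => fderiv ℝ (fderiv ℝ F) X (stdVec i) (stdVec i), fun i => ?_, ?_⟩
  · have h0 : X + (0 : ℝ) • (stdVec i : Pt n) = X := by simp
    have := (LineJet.line X (stdVec i)).contDiffAt_comp (U := F) (by rwa [h0])
    simpa using this
  · have h1 : ∀ v : Pt n, d2 F X v = fderiv ℝ (fderiv ℝ F) X v v := fun v => by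
      have h2 : DifferentiableAt ℝ (fderiv ℝ F) X :=
        (hF.fderiv_right (m := 1) (by norm_num)).differentiableAt (by norm_num)
      unfold d2
      rw [fderiv_clm_apply h2 (differentiableAt_const v)]
      simp
    simp only [lapl, h1, dt, Fintype.sum_option]
    simp only [stdVec]
    ring

theorem sum_stdVec (X : Pt n) :
    ∑ i : Fin n, X.1 i • (stdVec (some i) : Pt n) + X.2 • stdVec none = X := by
  have h : ∑ i : Fin n, X.1 i • EuclideanSpace.single i (1 : ℝ) = X.1 := by
    ext j
    simp [Finset.sum_apply, Pi.single_apply]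
  refine Prod.ext ?_ ?_
  · simp [stdVec, Prod.fst_sum, h]
  · simp [stdVec, Prod.snd_sum]

end HasOp

theorem LineJet.quadratic (c₀ c₁ c₂ : ℝ) :
    LineJet (fun s : ℝ => c₀ + c₁ * s + c₂ * s ^ 2) c₁ (2 * c₂) := by
  refine ⟨fun s => c₁ + 2 * c₂ * s, Eventually.of_forall fun s => ?_, by simp, ?_⟩
  · have := (((hasDerivAt_id s).const_mul c₁).const_add c₀).add
      (((hasDerivAt_id s).pow 2).const_mul c₂)
    exact this.congr_deriv (by simp; ring)
  · exact (((hasDerivAt_id (0 : ℝ)).const_mul (2 * c₂)).const_add c₁).congr_deriv (by simp)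

section BaseFunctions

variable {n : ℕ} {a : ℝ} {X : Pt n}

theorem hasOp_of_fst {g : EuclideanSpace ℝ (Fin n) → ℝ} {p r : Fin n → ℝ}
    (h : ∀ i, LineJet (fun s : ℝ => g (X.1 + s • EuclideanSpace.single i 1)) (p i) (r i)) :
    HasOp a (fun Y => g Y.1) X (∑ i, r i) := by
  refine ⟨fun o => o.elim 0 p, fun o => o.elim 0 r, ?_, by simp [Fintype.sum_option]⟩
  rintro (_ | i)
  · simpa [stdVec] using LineJet.const (g X.1)
  · simpa [stdVec] using h i

theorem hasOp_of_snd {g : ℝ → ℝ} {p r : ℝ} (h : LineJet (fun s : ℝ => g (X.2 + s)) p r) :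
    HasOp a (fun Y => g Y.2) X (r + a / X.2 * p) := by
  refine ⟨fun o => o.elim p 0, fun o => o.elim r 0, ?_, by simp [Fintype.sum_option]⟩
  rintro (_ | i)
  · simpa [stdVec] using h
  · simpa [stdVec] using LineJet.const (g X.2)

theorem hasOp_inner (m e : EuclideanSpace ℝ (Fin n)) :
    HasOp a (fun Y : Pt n => inner ℝ (Y.1 - m) e) X 0 := by
  have := hasOp_of_fst (a := a) (X := X) (g := fun y => inner ℝ (y - m) e) (p := fun i => e i)
    (r := fun _ => 0) fun i => by
      have := LineJet.quadratic (inner ℝ (X.1 - m) e) (e i) 0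
      rw [mul_zero] at this
      refine this.congr (Eventually.of_forall fun s => ?_)
      dsimp only
      rw [add_sub_right_comm, inner_add_left, real_inner_smul_left,
        EuclideanSpace.inner_single_left]
      simp
      ring
  simpa using this

theorem hasOp_inner_sq (m : EuclideanSpace ℝ (Fin n)) {e : EuclideanSpace ℝ (Fin n)}
    (he : ‖e‖ = 1) :
    HasOp a (fun Y : Pt n => inner ℝ (Y.1 - m) e ^ 2) X 2 := by
  have := hasOp_of_fst (a := a) (X := X) (g := fun y => inner ℝ (y - m) e ^ 2)
    (p := fun i => 2 * inner ℝ (X.1 - m) e * e i)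
    (r := fun i => 2 * e i ^ 2) fun i => by
      refine (LineJet.quadratic (inner ℝ (X.1 - m) e ^ 2) (2 * inner ℝ (X.1 - m) e * e i)
        (e i ^ 2)).congr (Eventually.of_forall fun s => ?_)
      dsimp only
      rw [add_sub_right_comm, inner_add_left, real_inner_smul_left,
        EuclideanSpace.inner_single_left]
      simp
      ring
  rw [← Finset.mul_sum, ← EuclideanSpace.real_norm_sq_eq, he] at this
  simpa using this

theorem hasOp_norm_sq (m : EuclideanSpace ℝ (Fin n)) :
    HasOp a (fun Y : Pt n => ‖Y.1 - m‖ ^ 2) X (2 * n) := by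
  have := hasOp_of_fst (a := a) (X := X) (g := fun y => ‖y - m‖ ^ 2)
    (p := fun i => 2 * (X.1 - m) i)
    (r := fun i => 2 * 1) fun i => by
      refine (LineJet.quadratic (‖X.1 - m‖ ^ 2) (2 * (X.1 - m) i) 1).congr
        (Eventually.of_forall fun s => ?_)
      dsimp only
      rw [add_sub_right_comm, norm_add_sq_real, real_inner_smul_right,
        EuclideanSpace.inner_single_right, norm_smul]
      simp
      ring
  simpa [mul_comm] using this

theorem hasOp_snd_sq (ht : 0 < X.2) : HasOp a (fun Y : Pt n => Y.2 ^ 2) X (2 * (1 + a)) := by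
  have := hasOp_of_snd (a := a) (X := X) (g := fun t => t ^ 2)
    ((LineJet.quadratic (X.2 ^ 2) (2 * X.2) 1).congr (Eventually.of_forall fun s => by ring))
  convert this using 1
  field_simp

theorem hasOp_snd_rpow (ht : 0 < X.2) {σ : ℝ} (ha : a = 1 - 2 * σ) :
    HasOp a (fun Y : Pt n => Y.2 ^ (2 * σ)) X 0 := by
  have h1 : LineJet (fun s : ℝ => X.2 + s) 1 0 := by simpa using LineJet.quadratic X.2 1 0
  have := hasOp_of_snd (a := a) (X := X) (g := fun t => t ^ (2 * σ))
    (h1.rpow (by simpa using ht) (2 * σ))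
  convert this using 1
  simp only [add_zero, ha]
  field_simp
  ring

end BaseFunctions

/-! ### Kelvin transform -/

section Kelvin

variable {n : ℕ}

/-- Inversion with centre `(c, 0)` and squared radius `l`. -/
def kelPt (c : EuclideanSpace ℝ (Fin n)) (l : ℝ) (X : Pt n) : Pt n :=
  (c, 0) + (l / nsq (X - (c, 0))) • (X - (c, 0))

/-- Kelvin transform of `U` with respect to the inversion `kelPt c l`. -/
def kel (q : ℝ) (c : EuclideanSpace ℝ (Fin n)) (l : ℝ) (U : Pt n → ℝ) (X : Pt n) : ℝ :=
  (l / nsq (X - (c, 0))) ^ (q / 2) * U (kelPt c l X)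

/-- Coordinates of a point, indexed like `stdVec`. -/
def coord (X : Pt n) : Option (Fin n) → ℝ
  | none => X.2
  | some i => X.1 i

theorem sum_coord_smul (X : Pt n) : ∑ i, coord X i • (stdVec i : Pt n) = X := by
  rw [Fintype.sum_option, add_comm]
  exact sum_stdVec X

theorem sum_coord_sq (X : Pt n) : ∑ i, coord X i ^ 2 = nsq X := by
  simp [Fintype.sum_option, coord, nsq, EuclideanSpace.real_norm_sq_eq, add_comm]

theorem nsq_add_smul (X : Pt n) (s : ℝ) (i : Option (Fin n)) :
    nsq (X + s • stdVec i) = nsq X + 2 * coord X i * s + 1 * s ^ 2 := by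
  rcases i with _ | i
  · simp [nsq, stdVec, coord]
    ring
  · simp only [nsq, stdVec, coord, Prod.fst_add, Prod.smul_fst, Prod.snd_add, Prod.smul_snd]
    rw [norm_add_sq_real, real_inner_smul_right, EuclideanSpace.inner_single_right, norm_smul]
    simp
    ring

theorem sum_coord_mul (M : Pt n →L[ℝ] ℝ) (Y : Pt n) : ∑ i, coord Y i * M (stdVec i) = M Y := by
  conv_rhs => rw [← sum_coord_smul Y]
  simp [map_sum]

theorem sum_coord_mul_left (B : Pt n →L[ℝ] Pt n →L[ℝ] ℝ) (Y Z : Pt n) :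
    ∑ i, coord Y i * B (stdVec i) Z = B Y Z := by
  have : B Y = ∑ i, coord Y i • B (stdVec i) := by
    conv_lhs => rw [← sum_coord_smul Y]
    simp [map_sum]
  rw [this]
  simp

theorem lapl_eq_sum {U : Pt n → ℝ} {P : Pt n} (hU : ContDiffAt ℝ 2 U P) :
    lapl U P = ∑ i, fderiv ℝ (fderiv ℝ U) P (stdVec i) (stdVec i) := by
  have h1 : ∀ v : Pt n, d2 U P v = fderiv ℝ (fderiv ℝ U) P v v := fun v => by
    have h2 : DifferentiableAt ℝ (fderiv ℝ U) P :=
      (hU.fderiv_right (m := 1) (by norm_num)).differentiableAt (by norm_num)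
    unfold d2
    rw [fderiv_clm_apply h2 (differentiableAt_const v)]
    simp
  simp only [lapl, h1, Fintype.sum_option]
  simp only [stdVec]
  ring

theorem hasOp_kelvin {a q : ℝ} (hq : q = n - 1 + a) {U : Pt n → ℝ}
    {c : EuclideanSpace ℝ (Fin n)} {l : ℝ} {X : Pt n} (hl : 0 < l) (ht : 0 < X.2)
    (hN : 0 < nsq (X - (c, 0)))
    (hU : ContDiffAt ℝ 2 U (kelPt c l X))
    (hpde : lapl U (kelPt c l X) + a / (kelPt c l X).2 * dt U (kelPt c l X) = 0) :
    HasOp a (kel q c l U) X 0 := by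
  set Y : Pt n := X - (c, 0) with hY
  set N := nsq Y with hNdef
  set P := kelPt c l X with hP
  have hY2 : Y.2 = X.2 := by simp [hY]
  have hP2 : P.2 = l / N * X.2 := by simp [hP, kelPt, ← hY, ← hNdef, hY2]
  set L := fderiv ℝ U P with hL
  set B := fderiv ℝ (fderiv ℝ U) P with hB
  have hlapl : lapl U P = ∑ i, B (stdVec i) (stdVec i) := lapl_eq_sum hU
  have hdt : dt U P = L (stdVec none) := rfl
  set j := l / N with hj
  have hj0 : 0 < j := div_pos hl hN
  set k := j ^ (q / 2) with hk
  -- jets along the coordinate line `i`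
  have hjet : ∀ i, LineJet (fun s : ℝ => l / nsq (Y + s • stdVec i))
      (-2 * j / N * coord Y i) (j * (-2 / N + 8 * coord Y i ^ 2 / N ^ 2)) := fun i => by
    have h1 := LineJet.quadratic N (2 * coord Y i) 1
    have h2 := (LineJet.const l).mul (h1.inv (by simpa using hN.ne'))
    simp only [mul_zero, ne_eq, OfNat.ofNat_ne_zero, not_false_eq_true, zero_pow, add_zero,
      zero_mul, mul_one] at h2
    have e1 : l * (-(2 * coord Y i) / N ^ 2) = -2 * j / N * coord Y i := by
      simp only [hj]; field_simp
    have e2 : l * (2 * (2 * coord Y i) ^ 2 / N ^ 3 - 2 / N ^ 2) =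
        j * (-2 / N + 8 * coord Y i ^ 2 / N ^ 2) := by
      simp only [hj]; field_simp; ring
    rw [e1, e2] at h2
    refine h2.congr (Eventually.of_forall fun s => ?_)
    simp only [nsq_add_smul, div_eq_mul_inv, one_mul]; rfl
  have hj_at : ∀ i : Option (Fin n), l / nsq (Y + (0 : ℝ) • stdVec i) = j := fun i => by
    simp [hj, hNdef]
  have hk_jet : ∀ i, LineJet (fun s : ℝ => (l / nsq (Y + s • stdVec i)) ^ (q / 2))
      (-q * k / N * coord Y i) (k * (-q / N + q * (q + 2) * coord Y i ^ 2 / N ^ 2)) := fun i => by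
    have := (hjet i).rpow (by rw [hj_at]; exact hj0) (q / 2)
    rw [hj_at, ← hk] at this
    convert this using 1
    · field_simp
    · field_simp; ring
  have hγ : ∀ i, LineJet (fun s : ℝ => ((c, 0) : Pt n) +
      (l / nsq (Y + s • stdVec i)) • (Y + s • stdVec i))
      (j • stdVec i + (-2 * j / N * coord Y i) • Y)
      ((2 * (-2 * j / N * coord Y i)) • stdVec i +
        (j * (-2 / N + 8 * coord Y i ^ 2 / N ^ 2)) • Y) := fun i => by
    have := (LineJet.const ((c, 0) : Pt n)).add ((hjet i).smul (LineJet.line Y (stdVec i)))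
    rw [hj_at] at this
    convert this using 1
    · module
    · module
  have hγ0 : ∀ i : Option (Fin n), ((c, 0) : Pt n) +
      (l / nsq (Y + (0 : ℝ) • stdVec i)) • (Y + (0 : ℝ) • stdVec i) = P := fun i => by
    rw [hj_at]; simp [hP, kelPt, ← hY, ← hNdef, hj]
  have hf : ∀ i, LineJet (fun s : ℝ => kel q c l U (X + s • stdVec i))
      (k * (j * L (stdVec i) + (-2 * j / N * coord Y i) * L Y) + (-q * k / N * coord Y i) * U P)
      (k * (j ^ 2 * B (stdVec i) (stdVec i)) + (k * j * (-2 * j / N)) * (coord Y i * B (stdVec i) Y)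
        + (k * j * (-2 * j / N)) * (coord Y i * B Y (stdVec i))
        + (k * (-2 * j / N) ^ 2 * B Y Y) * coord Y i ^ 2
        + k * (2 * (-2 * j / N)) * (coord Y i * L (stdVec i)) + k * j * (-2 / N) * L Y
        + k * j * (8 / N ^ 2) * L Y * coord Y i ^ 2
        + 2 * (-q * k / N) * j * (coord Y i * L (stdVec i))
        + 2 * (-q * k / N) * (-2 * j / N) * L Y * coord Y i ^ 2
        + k * (-q / N) * U P + k * (q * (q + 2) / N ^ 2) * U P * coord Y i ^ 2) := fun i => by
    have h1 := (hγ i).contDiffAt_comp (U := U) (by rw [hγ0]; exact hU)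
    have h2 := (hk_jet i).mul h1
    rw [hγ0, hj_at, ← hL, ← hB, ← hk] at h2
    simp only [map_add, map_smul, add_apply, smul_apply, smul_eq_mul] at h2
    refine LineJet.congr (by convert h2 using 1; ring) (Eventually.of_forall fun s => ?_)
    simp only [kel, kelPt]
    rw [show X + s • stdVec i - (c, 0) = Y + s • stdVec i by rw [hY]; abel]
  refine ⟨_, _, hf, ?_⟩
  have hlap' : ∑ i, B (stdVec i) (stdVec i) = -(a / (j * X.2) * L (stdVec none)) := by
    rw [← hlapl, ← hP2, ← hdt]; linarith
  simp only [Finset.sum_add_distrib, ← Finset.mul_sum, sum_coord_mul, sum_coord_mul_left, hlap', sum_coord_sq, ← hNdef,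
    Finset.sum_const, Finset.card_univ, Fintype.card_option, Fintype.card_fin, nsmul_eq_mul]
  rw [show coord Y none = X.2 from hY2, hq]
  push_cast
  field_simp
  ring

/-- Reflection of the `x` variable across the hyperplane through `m` normal to `e`. -/
def reflPt (m e : EuclideanSpace ℝ (Fin n)) (X : Pt n) : Pt n :=
  X - (2 * inner ℝ (X.1 - m) e) • ((e, 0) : Pt n)

theorem hasOp_reflPt {a : ℝ} {U : Pt n → ℝ} {m e : EuclideanSpace ℝ (Fin n)} (he : ‖e‖ = 1)
    {X : Pt n} (hU : ContDiffAt ℝ 2 U (reflPt m e X))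
    (hpde : lapl U (reflPt m e X) + a / (reflPt m e X).2 * dt U (reflPt m e X) = 0) :
    HasOp a (fun Y => U (reflPt m e Y)) X 0 := by
  set P := reflPt m e X with hP
  set E : Pt n := (e, 0) with hE
  have hP2 : P.2 = X.2 := by simp [hP, reflPt]
  set L := fderiv ℝ U P with hL
  set B := fderiv ℝ (fderiv ℝ U) P with hB
  have hlapl : lapl U P = ∑ i, B (stdVec i) (stdVec i) := lapl_eq_sum hU
  have hdt : dt U P = L (stdVec none) := rfl
  have hline : ∀ (i : Option (Fin n)) (s : ℝ),
      reflPt m e (X + s • stdVec i) = P + s • (stdVec i - (2 * coord E i) • E) := fun i s => by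
    have : inner ℝ ((X + s • stdVec i).1 - m) e = inner ℝ (X.1 - m) e + s * coord E i := by
      rcases i with _ | i
      · simp [stdVec, coord, hE]
      · simp only [stdVec, coord, hE, Prod.fst_add, Prod.smul_fst]
        rw [add_sub_right_comm, inner_add_left, real_inner_smul_left,
          EuclideanSpace.inner_single_left]
        simp
    rw [hP, reflPt, this, reflPt]
    module
  have hjet : ∀ i, LineJet (fun s : ℝ => U (reflPt m e (X + s • stdVec i)))
      (L (stdVec i) - 2 * coord E i * L E)
      (B (stdVec i) (stdVec i) - 2 * (coord E i * B (stdVec i) E)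
        - 2 * (coord E i * B E (stdVec i)) + 4 * B E E * coord E i ^ 2) := fun i => by
    have h := (LineJet.line P (stdVec i - (2 * coord E i) • E)).contDiffAt_comp (U := U)
      (by simpa using hU)
    rw [zero_smul, add_zero, ← hL, ← hB] at h
    simp only [map_sub, map_smul, sub_apply, smul_apply, smul_eq_mul, map_zero] at h
    refine LineJet.congr (by convert h using 1; ring) (Eventually.of_forall fun s => ?_)
    simp only [hline]
  refine ⟨_, _, hjet, ?_⟩
  have hlap' : ∑ i, B (stdVec i) (stdVec i) = -(a / X.2 * L (stdVec none)) := by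
    rw [← hlapl, ← hP2, ← hdt]; linarith
  simp only [Finset.sum_add_distrib, Finset.sum_sub_distrib, ← Finset.mul_sum, sum_coord_mul,
    sum_coord_mul_left, hlap', sum_coord_sq]
  rw [show nsq E = 1 by simp [nsq, hE, he], show coord E none = 0 from rfl]
  ring

end Kelvin

/-! ### Weighted normal derivative at the flat boundary -/

/-- `F` has weighted normal derivative `2 σ κ` at the flat point `(x, 0)`, read off from the values
of `F` on the vertical line. -/
def VFlux {n : ℕ} (σ : ℝ) (F : Pt n → ℝ) (x : EuclideanSpace ℝ (Fin n)) (κ : ℝ) : Prop :=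
  Tendsto (fun t : ℝ => (F (x, t) - F (x, 0)) / t ^ (2 * σ)) (𝓝[>] 0) (𝓝 κ)

section VFlux

variable {n : ℕ} {σ : ℝ} {F G : Pt n → ℝ} {x : EuclideanSpace ℝ (Fin n)} {κ κ' : ℝ}

theorem VFlux.add (hF : VFlux σ F x κ) (hG : VFlux σ G x κ') :
    VFlux σ (fun Y => F Y + G Y) x (κ + κ') :=
  (Tendsto.add hF hG).congr fun t => by ring

theorem VFlux.sub (hF : VFlux σ F x κ) (hG : VFlux σ G x κ') :
    VFlux σ (fun Y => F Y - G Y) x (κ - κ') :=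
  (Tendsto.sub hF hG).congr fun t => by ring

theorem VFlux.const_mul (hF : VFlux σ F x κ) (c : ℝ) :
    VFlux σ (fun Y => c * F Y) x (c * κ) :=
  (Tendsto.const_mul c hF).congr fun t => by ring

theorem vflux_fst (g : EuclideanSpace ℝ (Fin n) → ℝ) : VFlux σ (fun Y : Pt n => g Y.1) x 0 := by
  simp [VFlux]

theorem VFlux.const (c : ℝ) : VFlux σ (fun _ : Pt n => c) x 0 := vflux_fst fun _ => c

theorem vflux_snd_rpow (hσ : 0 < σ) : VFlux σ (fun Y : Pt n => Y.2 ^ (2 * σ)) x 1 := by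
  refine tendsto_const_nhds.congr' ?_
  filter_upwards [self_mem_nhdsWithin] with t (ht : 0 < t)
  have : (0 : ℝ) ^ (2 * σ) = 0 := Real.zero_rpow (by positivity)
  simp only [this, sub_zero]
  exact (div_self (Real.rpow_pos_of_pos ht _).ne').symm

theorem tendsto_rpow_nhdsGT_zero {r : ℝ} (hr : 0 < r) :
    Tendsto (fun t : ℝ => t ^ r) (𝓝[>] 0) (𝓝 0) := by
  have := (Real.continuousAt_rpow_const 0 r (Or.inr hr.le)).tendsto
  rw [Real.zero_rpow hr.ne'] at this
  exact this.mono_left nhdsWithin_le_nhds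

theorem vflux_of_sq (hσ : σ < 1) {h : ℝ → ℝ} {h' : ℝ} (hh : HasDerivAt h h' 0)
    (hF : ∀ t, F (x, t) = h (t ^ 2)) : VFlux σ F x 0 := by
  have h1 : Tendsto (fun t : ℝ => t ^ 2) (𝓝[>] 0) (𝓝[≠] 0) := by
    refine tendsto_nhdsWithin_iff.2 ⟨?_, ?_⟩
    · have : Continuous fun t : ℝ => t ^ 2 := by fun_prop
      simpa using (this.tendsto 0).mono_left (nhdsWithin_le_nhds (s := Set.Ioi 0))
    · filter_upwards [self_mem_nhdsWithin] with t (ht : 0 < t)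
      exact (pow_pos ht 2).ne'
  have h2 := (hh.tendsto_slope_zero.comp h1).mul
    (tendsto_rpow_nhdsGT_zero (r := 2 - 2 * σ) (by linarith))
  rw [mul_zero] at h2
  refine h2.congr' ?_
  filter_upwards [self_mem_nhdsWithin] with t (ht : 0 < t)
  simp only [Function.comp, hF, zero_add, smul_eq_mul]
  rw [Real.rpow_sub ht, show t ^ (2 : ℝ) = t ^ 2 by norm_cast]
  have := (Real.rpow_pos_of_pos ht (2 * σ)).ne'
  simp only [ne_eq, OfNat.ofNat_ne_zero, not_false_eq_true, zero_pow]
  field_simp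

theorem vflux_snd_sq (hσ : σ < 1) : VFlux σ (fun Y : Pt n => Y.2 ^ 2) x 0 :=
  vflux_of_sq hσ (hasDerivAt_id 0) fun _ => rfl

end VFlux

/-! ### Maximum principle -/

section MaxPrinciple

variable {n : ℕ} {a σ : ℝ} {K : Set (Pt n)} {W φ : Pt n → ℝ}

theorem max_principle (hK : IsCompact K) (hW : ContinuousOn W K) (hφ : ContinuousOn φ K)
    (hpos : ∀ X ∈ K, 0 < φ X)
    (h : ∀ X ∈ K, W X < 0 →
      (K ∈ 𝓝 X ∧ ∃ ℓ ℓ', HasOp a W X ℓ ∧ HasOp a φ X ℓ' ∧ ℓ ≤ 0 ∧ ℓ' < 0) ∨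
      (X.2 = 0 ∧ (∀ᶠ t in 𝓝[>] (0 : ℝ), (X.1, t) ∈ K) ∧ ∃ κ κ', VFlux σ W X.1 κ ∧
        VFlux σ φ X.1 κ' ∧ ∀ m, 0 < m → W X + m * φ X = 0 → κ + m * κ' < 0)) :
    ∀ X ∈ K, 0 ≤ W X := by
  intro X₁ hX₁
  by_contra! hneg
  obtain ⟨X, hX, hmin⟩ := hK.exists_isMinOn ⟨X₁, hX₁⟩
    (hW.div hφ fun X hX => (hpos X hX).ne')
  set m := -(W X / φ X) with hm
  have hm0 : 0 < m := by
    have h1 : W X / φ X ≤ W X₁ / φ X₁ := hmin hX₁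
    have h2 : W X₁ / φ X₁ < 0 := div_neg_of_neg_of_pos hneg (hpos X₁ hX₁)
    simp only [hm]; linarith
  have hzero : W X + m * φ X = 0 := by
    have := (hpos X hX).ne'
    simp only [hm]; field_simp; ring
  have hge : ∀ Y ∈ K, 0 ≤ W Y + m * φ Y := fun Y hY => by
    have h1 : W X / φ X ≤ W Y / φ Y := hmin hY
    have h2 := (le_div_iff₀ (hpos Y hY)).1 h1
    simp only [hm]; linarith
  have hWX : W X < 0 := by nlinarith [hpos X hX]
  rcases h X hX hWX with ⟨hn, ℓ, ℓ', h1, h2, h3, h4⟩ | ⟨hX2, hev, κ, κ', h1, h2, h3⟩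
  · have h5 := (h1.add (h2.const_mul m)).nonneg_of_isLocalMin (by
      filter_upwards [hn] with Y hY
      rw [hzero]; exact hge Y hY)
    nlinarith
  · have h5 := h3 m hm0 hzero
    have h6 : 0 ≤ κ + m * κ' := by
      refine ge_of_tendsto (h1.add (h2.const_mul m)) ?_
      filter_upwards [hev, self_mem_nhdsWithin] with t ht (ht0 : 0 < t)
      have hX' : X = (X.1, 0) := Prod.ext rfl hX2
      refine div_nonneg ?_ (Real.rpow_nonneg ht0.le _)
      rw [hX'] at hzero
      rw [hzero, sub_zero]
      exact hge _ ht
    linarith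

theorem max_principle_simple (hσ : 0 < σ) (hσ' : σ < 1) (ha : a = 1 - 2 * σ) (hK : IsCompact K)
    (hK' : ∀ X ∈ K, 0 ≤ X.2 ∧ X.2 ≤ 1) (hW : ContinuousOn W K)
    (h : ∀ X ∈ K, W X < 0 →
      (K ∈ 𝓝 X ∧ 0 < X.2 ∧ ∃ ℓ, HasOp a W X ℓ ∧ ℓ ≤ 0) ∨
      (X.2 = 0 ∧ (∀ᶠ t in 𝓝[>] (0 : ℝ), (X.1, t) ∈ K) ∧ ∃ κ, VFlux σ W X.1 κ ∧ κ ≤ 0)) :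
    ∀ X ∈ K, 0 ≤ W X := by
  have hc : Continuous fun X : Pt n => 3 - X.2 ^ (2 * σ) - X.2 ^ 2 := by
    have : Continuous fun X : Pt n => X.2 ^ (2 * σ) :=
      continuous_snd.rpow_const fun _ => Or.inr (by positivity)
    fun_prop
  refine max_principle (a := a) (σ := σ) hK hW (φ := fun X => 3 - X.2 ^ (2 * σ) - X.2 ^ 2)
    hc.continuousOn (fun X hX => ?_) fun X hX hWX => ?_
  · obtain ⟨h0, h1⟩ := hK' X hX
    have := Real.rpow_le_one h0 h1 (show 0 ≤ 2 * σ by positivity)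
    nlinarith
  · rcases h X hX hWX with ⟨hn, ht, ℓ, h1, h2⟩ | ⟨hX2, hev, κ, h1, h2⟩
    · exact Or.inl ⟨hn, ℓ, _, h1, ((HasOp.const a X 3).sub (hasOp_snd_rpow ht ha)).sub
        (hasOp_snd_sq ht), h2, by rw [ha]; linarith⟩
    · refine Or.inr ⟨hX2, hev, κ, _, h1, ((VFlux.const 3).sub (vflux_snd_rpow hσ)).sub
        (vflux_snd_sq hσ'), fun m hm _ => ?_⟩
      linarith

end MaxPrinciple

/-! ### Solutions -/

/-- The Neumann datum `u ^ p / (2 σ)` at the flat point `(x, 0)`. -/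
def bdry {n : ℕ} (σ : ℝ) (U : Pt n → ℝ) (x : EuclideanSpace ℝ (Fin n)) : ℝ :=
  U (x, 0) ^ (((n : ℝ) + 2 * σ) / ((n : ℝ) - 2 * σ)) / (2 * σ)

/-- The properties of a solution on the punctured half-ball of radius `2` in the form used below. -/
structure Sol (n : ℕ) (σ : ℝ) (U : Pt n → ℝ) : Prop where
  two_le : 2 ≤ n
  pos : 0 < σ
  lt_one : σ < 1
  nonneg : ∀ X : Pt n, nsq X ≤ 4 → 0 ≤ X.2 → X ≠ 0 → 0 ≤ U X
  cont : ContinuousOn U {X : Pt n | nsq X ≤ 4 ∧ 0 ≤ X.2 ∧ X ≠ 0}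
  contDiffAt : ∀ X : Pt n, nsq X < 4 → 0 < X.2 → ContDiffAt ℝ 2 U X
  pde : ∀ X : Pt n, nsq X < 4 → 0 < X.2 → lapl U X + (1 - 2 * σ) / X.2 * dt U X = 0
  vflux : ∀ x : EuclideanSpace ℝ (Fin n), ‖x‖ < 2 → x ≠ 0 →
    VFlux σ U x (-bdry σ U x)

section Sol

variable {n : ℕ} {σ : ℝ} {U : Pt n → ℝ}

theorem nsq_nonneg (X : Pt n) : 0 ≤ nsq X := by unfold nsq; positivity

@[fun_prop]
theorem continuous_nsq : Continuous (nsq : Pt n → ℝ) := by unfold nsq; fun_prop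

theorem nsq_eq_zero {X : Pt n} : nsq X = 0 ↔ X = 0 := by
  constructor
  · intro h
    have h1 : ‖X.1‖ ^ 2 = 0 := by unfold nsq at h; nlinarith [sq_nonneg ‖X.1‖, sq_nonneg X.2]
    have h2 : X.2 ^ 2 = 0 := by unfold nsq at h; nlinarith [sq_nonneg ‖X.1‖, sq_nonneg X.2]
    refine Prod.ext ?_ ?_
    · simpa using h1
    · simpa using h2
  · rintro rfl
    simp [nsq]

theorem nsq_pos {X : Pt n} : 0 < nsq X ↔ X ≠ 0 := by
  rw [lt_iff_le_and_ne, and_iff_right (nsq_nonneg X), ne_comm, Ne, nsq_eq_zero]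

theorem norm_fst_lt_two {X : Pt n} (h : nsq X < 4) : ‖X.1‖ < 2 := by
  unfold nsq at h
  nlinarith [norm_nonneg X.1, sq_nonneg X.2]

theorem enorm'_lt_two {X : Pt n} : enorm' X < 2 ↔ nsq X < 4 := by
  unfold enorm' nsq
  rw [Real.sqrt_lt' (by norm_num)]
  norm_num

theorem enorm'_le_two {X : Pt n} : enorm' X ≤ 2 ↔ nsq X ≤ 4 := by
  unfold enorm' nsq
  rw [Real.sqrt_le_left (by norm_num)]
  norm_num

theorem ExtSol.sol (hn : 2 ≤ n) (hσ : σ ∈ Set.Ioo (0 : ℝ) 1) (hU : ExtSol n σ 2 U) :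
    Sol n σ U := by
  obtain ⟨h1, h2, h3, h4, h5⟩ := hU
  have hopen : IsOpen {X : Pt n | enorm' X < 2 ∧ 0 < X.2} := by
    simp only [enorm'_lt_two]
    exact (isOpen_lt continuous_nsq continuous_const).inter
      (isOpen_lt continuous_const continuous_snd)
  have hC : ∀ X : Pt n, nsq X < 4 → 0 < X.2 → ContDiffAt ℝ 2 U X := fun X hX ht =>
    h3.contDiffAt (hopen.mem_nhds ⟨enorm'_lt_two.2 hX, ht⟩)
  have hcont : ContinuousOn U {X : Pt n | nsq X ≤ 4 ∧ 0 ≤ X.2 ∧ X ≠ 0} :=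
    h2.mono fun X hX => ⟨⟨enorm'_le_two.2 hX.1, hX.2.1⟩, by simpa using hX.2.2⟩
  refine ⟨hn, hσ.1, hσ.2, fun X hX => h1 X (enorm'_le_two.2 hX), hcont, hC,
    fun X hX => h4 X (enorm'_lt_two.2 hX), fun x hx hx0 => ?_⟩
  have hσ0 := hσ.1
  have hev : ∀ᶠ t in 𝓝[>] (0 : ℝ), nsq (x, t) < 4 := by
    have : Continuous fun t : ℝ => nsq (x, t) := by fun_prop
    refine (this.tendsto 0).mono_left nhdsWithin_le_nhds |>.eventually (gt_mem_nhds ?_)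
    simp only [nsq]; nlinarith [norm_nonneg x]
  have hcx : Tendsto (fun t : ℝ => U (x, t)) (𝓝[>] 0) (𝓝 (U (x, 0))) := by
    have hx' : ((x, 0) : Pt n) ∈ {X : Pt n | nsq X ≤ 4 ∧ 0 ≤ X.2 ∧ X ≠ 0} := by
      refine ⟨?_, le_rfl, fun h => hx0 (congrArg Prod.fst h)⟩
      simp only [nsq]; nlinarith [norm_nonneg x]
    refine (hcont _ hx').tendsto.comp (tendsto_nhdsWithin_iff.2 ⟨?_, ?_⟩)
    · have : Continuous fun t : ℝ => ((x, t) : Pt n) := by fun_prop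
      exact (this.tendsto 0).mono_left nhdsWithin_le_nhds
    · filter_upwards [hev, self_mem_nhdsWithin] with t ht (ht0 : 0 < t)
      exact ⟨ht.le, ht0.le, fun h => hx0 (congrArg Prod.fst h)⟩
  refine HasDerivAt.lhopital_zero_nhdsGT (f' := fun t => dt U (x, t))
    (g' := fun t => 2 * σ * t ^ (2 * σ - 1)) ?_ ?_ ?_ ?_ ?_ ?_
  · filter_upwards [hev, self_mem_nhdsWithin] with t ht (ht0 : 0 < t)
    have hd := ((hC (x, t) ht ht0).differentiableAt (by norm_num)).hasFDerivAt
    have hl : HasDerivAt (fun s : ℝ => ((x, s) : Pt n)) (0, 1) t :=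
      (hasDerivAt_const t x).prodMk (hasDerivAt_id t)
    exact (hd.comp_hasDerivAt t hl).sub_const _
  · filter_upwards [self_mem_nhdsWithin] with t (ht0 : 0 < t)
    exact Real.hasDerivAt_rpow_const (Or.inl ht0.ne')
  · filter_upwards [self_mem_nhdsWithin] with t (ht0 : 0 < t)
    positivity
  · simpa using hcx.sub_const (U (x, 0))
  · exact tendsto_rpow_nhdsGT_zero (by positivity)
  · have := (h5 x hx hx0).div_const (2 * σ)
    rw [neg_div] at this
    refine this.congr' ?_
    filter_upwards [self_mem_nhdsWithin] with t (ht0 : 0 < t)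
    have e : t ^ (1 - 2 * σ) = (t ^ (2 * σ - 1))⁻¹ := by rw [← Real.rpow_neg ht0.le]; ring_nf
    rw [e]
    have := (Real.rpow_pos_of_pos ht0 (2 * σ - 1)).ne'
    field_simp

theorem Sol.hasOp (hU : Sol n σ U) {X : Pt n} (hX : nsq X < 4) (ht : 0 < X.2) :
    HasOp (1 - 2 * σ) U X 0 := by
  simpa [hU.pde X hX ht] using hasOp_of_contDiffAt (a := 1 - 2 * σ) (hU.contDiffAt X hX ht)

end Sol

/-! ### Horizontal increments near the flat boundary -/

section Reflection

variable {n : ℕ} {σ : ℝ} {U : Pt n → ℝ}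

theorem reflPt_mk (m e x : EuclideanSpace ℝ (Fin n)) (t : ℝ) :
    reflPt m e (x, t) = (x - (2 * inner ℝ (x - m) e) • e, t) := by
  simp [reflPt]

theorem reflPt_eq (m e : EuclideanSpace ℝ (Fin n)) (X : Pt n) :
    reflPt m e X = (X.1 - (2 * inner ℝ (X.1 - m) e) • e, X.2) := reflPt_mk m e X.1 X.2

theorem norm_refl_sub {m e : EuclideanSpace ℝ (Fin n)} (he : ‖e‖ = 1)
    (x : EuclideanSpace ℝ (Fin n)) : ‖x - (2 * inner ℝ (x - m) e) • e - m‖ = ‖x - m‖ := by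
  have h : ‖x - (2 * inner ℝ (x - m) e) • e - m‖ ^ 2 = ‖x - m‖ ^ 2 := by
    rw [sub_right_comm, norm_sub_sq_real, real_inner_smul_right, norm_smul, he]
    simp only [Real.norm_eq_abs, mul_one, sq_abs]
    ring
  exact (sq_eq_sq₀ (norm_nonneg _) (norm_nonneg _)).1 h

theorem rpow_barrier_nonneg (hσ : 0 < σ) (hσ' : σ < 1) {t T : ℝ} (ht : 0 ≤ t) (hT : 0 < T) :
    0 ≤ T ^ (2 * σ) - t ^ (2 * σ) + T ^ (2 * σ - 2) * t ^ 2 := by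
  have hT2 := Real.rpow_pos_of_pos hT (2 * σ - 2)
  rcases le_or_gt t T with h | h
  · have := Real.rpow_le_rpow ht h (show 0 ≤ 2 * σ by positivity)
    nlinarith [mul_nonneg hT2.le (sq_nonneg t)]
  · have ht0 := hT.trans h
    have h1 : t ^ (2 * σ) = t ^ (2 * σ - 2) * t ^ 2 := by
      rw [Real.rpow_sub ht0, show t ^ (2 : ℝ) = t ^ 2 by norm_cast]
      field_simp
    have h2 : t ^ (2 * σ - 2) ≤ T ^ (2 * σ - 2) :=
      Real.rpow_le_rpow_of_nonpos hT h.le (by linarith)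
    have h3 := Real.rpow_pos_of_pos hT (2 * σ)
    nlinarith [mul_nonneg (sub_nonneg.2 h2) (sq_nonneg t)]

theorem Sol.reflect_bound (hU : Sol n σ U) {m e : EuclideanSpace ℝ (Fin n)} (he : ‖e‖ = 1)
    {ρ T M k s : ℝ} (hρ : 0 < ρ) (hρ1 : ρ ≤ 1) (hT : 0 < T) (hk : 0 ≤ k) (hs : |s| = 1)
    (hin : ∀ Y : Pt n, ‖Y.1 - m‖ ≤ ρ → 0 ≤ Y.2 → Y.2 ≤ ρ → nsq Y < 4 ∧ Y.1 ≠ 0 ∧ U Y ≤ M)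
    (hosc : ∀ y y' : EuclideanSpace ℝ (Fin n), ‖y - m‖ ≤ ρ → ‖y' - m‖ ≤ ρ →
      |bdry σ U y - bdry σ U y'| ≤ k)
    (Y : Pt n) (hY0 : 0 ≤ inner ℝ (Y.1 - m) e) (hYm : ‖Y.1 - m‖ ≤ ρ) (hY : 0 ≤ Y.2)
    (hYρ : Y.2 ≤ ρ) :
    s * (U Y - U (reflPt m e Y)) ≤
      k * (T ^ (2 * σ) - Y.2 ^ (2 * σ) + T ^ (2 * σ - 2) * Y.2 ^ 2) +
      (k * T ^ (2 * σ - 2) * (2 - 2 * σ) + M / ρ ^ 2 * (n + (2 - 2 * σ))) *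
        (2 * ρ * inner ℝ (Y.1 - m) e - inner ℝ (Y.1 - m) e ^ 2) +
      M / ρ ^ 2 * (‖Y.1 - m‖ ^ 2 + Y.2 ^ 2) := by
  have hσ := hU.pos
  have hσ' := hU.lt_one
  have hci : Continuous fun Y : Pt n => inner ℝ (Y.1 - m) e := by fun_prop
  have hcn : Continuous fun Y : Pt n => ‖Y.1 - m‖ := by fun_prop
  set A := k * T ^ (2 * σ - 2) * (2 - 2 * σ) + M / ρ ^ 2 * (n + (2 - 2 * σ)) with hA
  have hM : 0 ≤ M := by
    obtain ⟨h1, h2, h3⟩ := hin Y hYm hY hYρ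
    exact (hU.nonneg Y h1.le hY fun h => h2 (by rw [h]; rfl)).trans h3
  have hT2 := Real.rpow_pos_of_pos hT (2 * σ - 2)
  have hMρ : 0 ≤ M / ρ ^ 2 := by positivity
  have hA0 : 0 ≤ A := by
    have h1 : 0 ≤ 2 - 2 * σ := by linarith
    positivity
  set K : Set (Pt n) := {Y | 0 ≤ inner ℝ (Y.1 - m) e ∧ ‖Y.1 - m‖ ≤ ρ ∧ 0 ≤ Y.2 ∧ Y.2 ≤ ρ} with hKdef
  have hcomp : IsCompact K := by
    refine IsCompact.of_isClosed_subset ((isCompact_closedBall m ρ).prod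
      (isCompact_Icc (a := 0) (b := ρ))) ?_ ?_
    · exact (isClosed_le continuous_const hci).inter
        ((isClosed_le hcn continuous_const).inter
        ((isClosed_le continuous_const continuous_snd).inter
        (isClosed_le continuous_snd continuous_const)))
    · rintro Y ⟨-, h1, h2, h3⟩
      exact ⟨by simpa [dist_eq_norm] using h1, h2, h3⟩
  have hrefl : ∀ Y ∈ K, ‖(reflPt m e Y).1 - m‖ ≤ ρ ∧ (reflPt m e Y).2 = Y.2 := fun Y hY => by
    rw [reflPt_eq]
    exact ⟨by rw [norm_refl_sub he]; exact hY.2.1, rfl⟩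
  have hinK : ∀ Y ∈ K, nsq Y < 4 ∧ Y.1 ≠ 0 ∧ U Y ≤ M := fun Y hY => hin Y hY.2.1 hY.2.2.1 hY.2.2.2
  have hinR : ∀ Y ∈ K, nsq (reflPt m e Y) < 4 ∧ (reflPt m e Y).1 ≠ 0 ∧ U (reflPt m e Y) ≤ M :=
    fun Y hY => hin _ (hrefl Y hY).1 ((hrefl Y hY).2 ▸ hY.2.2.1) ((hrefl Y hY).2 ▸ hY.2.2.2)
  have hne : ∀ Y : Pt n, Y.1 ≠ 0 → Y ≠ 0 := fun Y h h' => h (by rw [h']; rfl)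
  have hUK : ContinuousOn U K := hU.cont.mono fun Y hY =>
    ⟨(hinK Y hY).1.le, hY.2.2.1, hne _ (hinK Y hY).2.1⟩
  have hURK : ContinuousOn (fun Y => U (reflPt m e Y)) K := by
    refine hU.cont.comp ?_ fun Y hY =>
      ⟨(hinR Y hY).1.le, by rw [(hrefl Y hY).2]; exact hY.2.2.1, hne _ (hinR Y hY).2.1⟩
    unfold reflPt
    fun_prop
  have hrp : Continuous fun X : Pt n => X.2 ^ (2 * σ) :=
    continuous_snd.rpow_const fun _ => Or.inr (by positivity)
  have key := max_principle_simple (a := 1 - 2 * σ) hσ hσ' rfl hcomp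
    (fun X hX => ⟨hX.2.2.1, hX.2.2.2.trans hρ1⟩)
    (W := fun Y => k * (T ^ (2 * σ) - Y.2 ^ (2 * σ) + T ^ (2 * σ - 2) * Y.2 ^ 2) +
      A * (2 * ρ * inner ℝ (Y.1 - m) e - inner ℝ (Y.1 - m) e ^ 2) +
      M / ρ ^ 2 * (‖Y.1 - m‖ ^ 2 + Y.2 ^ 2) - s * (U Y - U (reflPt m e Y)))
    (ContinuousOn.sub (Continuous.continuousOn (by fun_prop))
      (continuousOn_const.mul (hUK.sub hURK))) ?_ Y ⟨hY0, hYm, hY, hYρ⟩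
  · linarith
  intro X hX hWX
  obtain ⟨hX0, hXm, hXt, hXρ⟩ := id hX
  have hD : s * (U X - U (reflPt m e X)) ≤ M := by
    have h1 := hU.nonneg X (hinK X hX).1.le hXt (hne _ (hinK X hX).2.1)
    have h2 := hU.nonneg _ (hinR X hX).1.le (by rw [(hrefl X hX).2]; exact hXt)
      (hne _ (hinR X hX).2.1)
    have h3 := (hinK X hX).2.2
    have h4 := (hinR X hX).2.2
    calc _ ≤ |s * (U X - U (reflPt m e X))| := le_abs_self _
      _ = |U X - U (reflPt m e X)| := by rw [abs_mul, hs, one_mul]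
      _ ≤ M := abs_sub_le_iff.2 ⟨by linarith, by linarith⟩
  set w := inner ℝ (X.1 - m) e with hw
  have hwρ : w ≤ ρ := by
    have := real_inner_le_norm (X.1 - m) e
    rw [he, mul_one] at this
    exact this.trans hXm
  have p1 : 0 ≤ k * (T ^ (2 * σ) - X.2 ^ (2 * σ) + T ^ (2 * σ - 2) * X.2 ^ 2) :=
    mul_nonneg hk (rpow_barrier_nonneg hσ hσ' hXt hT)
  have p2 : 0 ≤ A * (2 * ρ * w - w ^ 2) := mul_nonneg hA0 (by nlinarith)
  have hbig : ¬ ρ ^ 2 ≤ ‖X.1 - m‖ ^ 2 + X.2 ^ 2 := fun h => by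
    have : M ≤ M / ρ ^ 2 * (‖X.1 - m‖ ^ 2 + X.2 ^ 2) := by
      calc M = M / ρ ^ 2 * ρ ^ 2 := by field_simp
        _ ≤ _ := mul_le_mul_of_nonneg_left h hMρ
    linarith
  have hw0 : 0 < w := by
    refine lt_of_le_of_ne hX0 fun h => ?_
    have h1 : reflPt m e X = X := by rw [reflPt, ← hw, ← h]; simp
    have h2 : 0 ≤ M / ρ ^ 2 * (‖X.1 - m‖ ^ 2 + X.2 ^ 2) := by positivity
    simp only [h1, sub_self, mul_zero, sub_zero] at hWX
    linarith
  have hm' : ‖X.1 - m‖ < ρ := by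
    by_contra! h
    exact hbig (by nlinarith [sq_nonneg X.2])
  have ht' : X.2 < ρ := by
    by_contra! h
    exact hbig (by nlinarith [sq_nonneg ‖X.1 - m‖])
  have hopen : IsOpen {Y : Pt n | 0 < inner ℝ (Y.1 - m) e ∧ ‖Y.1 - m‖ < ρ ∧ Y.2 < ρ} :=
    (isOpen_lt continuous_const hci).inter
        ((isOpen_lt hcn continuous_const).inter
        (isOpen_lt continuous_snd continuous_const))
  rcases hXt.eq_or_lt with h0 | hpos
  · refine Or.inr ⟨h0.symm, ?_, ?_⟩
    · have hc : Continuous fun t : ℝ => ((X.1, t) : Pt n) := by fun_prop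
      have h1 := (hc.tendsto 0).mono_left (nhdsWithin_le_nhds (s := Set.Ioi 0)) |>.eventually
        (hopen.mem_nhds ⟨hw0, hm', by simpa using hρ⟩)
      filter_upwards [h1, self_mem_nhdsWithin] with t ht (ht0 : 0 < t)
      exact ⟨ht.1.le, ht.2.1.le, ht0.le, ht.2.2.le⟩
    · have f1 := hU.vflux X.1 (norm_fst_lt_two (hinK X hX).1) (hinK X hX).2.1
      have f2 := hU.vflux (reflPt m e X).1 (norm_fst_lt_two (hinR X hX).1) (hinR X hX).2.1
      have f2' : VFlux σ (fun Y => U (reflPt m e Y)) X.1 (-bdry σ U (reflPt m e X).1) := by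
        refine Tendsto.congr (fun t => ?_) f2
        simp only [reflPt_eq]
      have hb := hosc X.1 (reflPt m e X).1 hXm (hrefl X hX).1
      refine ⟨_, ((((((VFlux.const (T ^ (2 * σ))).sub (vflux_snd_rpow hσ)).add
        ((vflux_snd_sq hσ').const_mul (T ^ (2 * σ - 2)))).const_mul k).add
        (vflux_fst fun y => A * (2 * ρ * inner ℝ (y - m) e - inner ℝ (y - m) e ^ 2))).add
        (((vflux_fst fun y => ‖y - m‖ ^ 2).add (vflux_snd_sq hσ')).const_mul (M / ρ ^ 2))).sub
        ((f1.sub f2').const_mul s), ?_⟩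
      have h1 := neg_abs_le (s * (bdry σ U X.1 - bdry σ U (reflPt m e X).1))
      have h2 := le_abs_self (s * (bdry σ U X.1 - bdry σ U (reflPt m e X).1))
      rw [abs_mul, hs, one_mul] at h1 h2
      linarith
  · refine Or.inl ⟨?_, hpos, ?_⟩
    · filter_upwards [hopen.mem_nhds ⟨hw0, hm', ht'⟩,
        (isOpen_lt continuous_const continuous_snd).mem_nhds hpos] with Y h1 h2
      exact ⟨h1.1.le, h1.2.1.le, le_of_lt h2, h1.2.2.le⟩
    · have h2' : 0 < (reflPt m e X).2 := by rw [(hrefl X hX).2]; exact hpos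
      have o1 := hU.hasOp (hinK X hX).1 hpos
      have o2 := hasOp_reflPt he (hU.contDiffAt _ (hinR X hX).1 h2') (hU.pde _ (hinR X hX).1 h2')
      refine ⟨_, (((((HasOp.const _ _ (T ^ (2 * σ))).sub (hasOp_snd_rpow hpos rfl)).add
        ((hasOp_snd_sq hpos).const_mul (T ^ (2 * σ - 2)))).const_mul k).add
        ((((hasOp_inner m e).const_mul (2 * ρ)).sub (hasOp_inner_sq m he)).const_mul A)).add
        (((hasOp_norm_sq m).add (hasOp_snd_sq hpos)).const_mul (M / ρ ^ 2)) |>.sub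
        ((o1.sub o2).const_mul s), le_of_eq ?_⟩
      rw [hA]
      ring

end Reflection

section KelvinFlux

variable {n : ℕ} {σ : ℝ} {U : Pt n → ℝ}

theorem Sol.q_pos (hU : Sol n σ U) : 0 < (n : ℝ) - 2 * σ := by
  have : (2 : ℝ) ≤ n := by exact_mod_cast hU.two_le
  linarith [hU.lt_one]

theorem Sol.p_pos (hU : Sol n σ U) : 0 < ((n : ℝ) + 2 * σ) / ((n : ℝ) - 2 * σ) :=
  div_pos (by have := hU.pos; positivity) hU.q_pos

theorem isOpen_nsq_lt : IsOpen {X : Pt n | nsq X < 4} := isOpen_lt continuous_nsq continuous_const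

theorem Sol.continuousWithinAt (hU : Sol n σ U) {X : Pt n} (hX : nsq X < 4) (ht : 0 ≤ X.2)
    (h0 : X ≠ 0) : ContinuousWithinAt U {Y : Pt n | 0 ≤ Y.2} X := by
  have h := hU.cont X ⟨hX.le, ht, h0⟩
  refine h.mono_of_mem_nhdsWithin ?_
  filter_upwards [self_mem_nhdsWithin, mem_nhdsWithin_of_mem_nhds (isOpen_nsq_lt.mem_nhds hX),
    mem_nhdsWithin_of_mem_nhds (isOpen_ne.mem_nhds h0)] with Y h1 h2 h3
  exact ⟨le_of_lt h2, h1, h3⟩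

theorem Sol.continuousAt_flat (hU : Sol n σ U) {x : EuclideanSpace ℝ (Fin n)} (hx : ‖x‖ < 2)
    (h0 : x ≠ 0) : ContinuousAt (fun y => U (y, 0)) x := by
  have h := hU.continuousWithinAt (X := (x, 0)) (by simp [nsq]; nlinarith [norm_nonneg x]) le_rfl
    fun h => h0 (congrArg Prod.fst h)
  have hc : Continuous fun y : EuclideanSpace ℝ (Fin n) => ((y, 0) : Pt n) := by fun_prop
  exact h.tendsto.comp (tendsto_nhdsWithin_iff.2
    ⟨hc.tendsto x, Eventually.of_forall fun y => le_refl (0 : ℝ)⟩)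

theorem Sol.continuousAt_bdry (hU : Sol n σ U) {x : EuclideanSpace ℝ (Fin n)} (hx : ‖x‖ < 2)
    (h0 : x ≠ 0) : ContinuousAt (bdry σ U) x :=
  ((hU.continuousAt_flat hx h0).rpow_const (Or.inr hU.p_pos.le)).div_const _

theorem horizontal_arith {k P Q T M ρ A ε w N : ℝ} (hk : 0 < k) (hP : Q * T ^ 2 = P)
    (hQ : 0 < Q) (hρ : 0 < ρ) (hρ1 : ρ ≤ 1) (hw0 : 0 < w) (hw1 : w ≤ 1) (hwρ : w ≤ ρ)
    (hwA : 2 * w ≤ A * T ^ 2) (hσ : 0 < σ) (hσ' : σ < 1) (hM : 0 < M) (hN : 0 ≤ N)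
    (b4 : M / ρ ^ 2 * ((N + 2) * A + A + 1) * T ^ 2 ≤ ε / 2 * P) (b5 : k * (1 + 2 * A) = ε / 2) :
    k * (P - P + Q * T ^ 2) + (k * Q * (2 - 2 * σ) + M / ρ ^ 2 * (N + (2 - 2 * σ))) *
      (2 * ρ * w - w ^ 2) + M / ρ ^ 2 * (w ^ 2 + T ^ 2) ≤ ε * P := by
  have b0 : 2 * ρ * w - w ^ 2 ≤ A * T ^ 2 := by nlinarith
  have b0' : 0 ≤ 2 * ρ * w - w ^ 2 := by nlinarith
  have b1 : k * Q * (2 - 2 * σ) * (2 * ρ * w - w ^ 2) ≤ k * Q * 2 * (A * T ^ 2) := by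
    refine mul_le_mul ?_ b0 b0' (by positivity)
    exact mul_le_mul_of_nonneg_left (by linarith) (by positivity)
  have b2 : M / ρ ^ 2 * (N + (2 - 2 * σ)) * (2 * ρ * w - w ^ 2) ≤
      M / ρ ^ 2 * (N + 2) * (A * T ^ 2) := by
    refine mul_le_mul ?_ b0 b0' (by positivity)
    exact mul_le_mul_of_nonneg_left (by linarith) (by positivity)
  have b3 : M / ρ ^ 2 * (w ^ 2 + T ^ 2) ≤ M / ρ ^ 2 * ((A + 1) * T ^ 2) :=
    mul_le_mul_of_nonneg_left (by nlinarith) (by positivity)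
  calc _ = k * (P - P + Q * T ^ 2) + k * Q * (2 - 2 * σ) * (2 * ρ * w - w ^ 2) +
        M / ρ ^ 2 * (N + (2 - 2 * σ)) * (2 * ρ * w - w ^ 2) + M / ρ ^ 2 * (w ^ 2 + T ^ 2) := by
        ring
    _ ≤ k * (P - P + Q * T ^ 2) + k * Q * 2 * (A * T ^ 2) +
        M / ρ ^ 2 * (N + 2) * (A * T ^ 2) + M / ρ ^ 2 * ((A + 1) * T ^ 2) := by linarith
    _ = k * (1 + 2 * A) * (Q * T ^ 2) + M / ρ ^ 2 * ((N + 2) * A + A + 1) * T ^ 2 := by ring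
    _ ≤ ε * P := by rw [hP, b5]; linarith

theorem Sol.horizontal (hU : Sol n σ U) {x : EuclideanSpace ℝ (Fin n)} (hx : ‖x‖ < 2)
    (hx0 : x ≠ 0) {A : ℝ} (hA : 0 ≤ A) {ε : ℝ} (hε : 0 < ε) :
    ∀ᶠ T in 𝓝[>] (0 : ℝ), ∀ v : EuclideanSpace ℝ (Fin n), ‖v‖ ≤ A * T ^ 2 →
      |U (x + v, T) - U (x, T)| ≤ ε * T ^ (2 * σ) := by
  have hσ := hU.pos
  have hσ' := hU.lt_one
  set k := ε / (2 * (1 + 2 * A)) with hk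
  have hk0 : 0 < k := by positivity
  have hxX : nsq ((x, 0) : Pt n) < 4 := by simp [nsq]; nlinarith [norm_nonneg x]
  set M := |U (x, 0)| + 1 with hM
  have hM0 : 0 < M := by positivity
  obtain ⟨ρ₀, hρ₀, hρ⟩ : ∃ ρ₀ > 0, ∀ Y : Pt n, dist Y (x, 0) < ρ₀ → 0 ≤ Y.2 →
      nsq Y < 4 ∧ Y.1 ≠ 0 ∧ U Y ≤ M ∧ |bdry σ U Y.1 - bdry σ U x| ≤ k / 2 := by
    have e1 : ∀ᶠ Y in 𝓝[{Y : Pt n | 0 ≤ Y.2}] ((x, 0) : Pt n), nsq Y < 4 :=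
      mem_nhdsWithin_of_mem_nhds (isOpen_nsq_lt.mem_nhds hxX)
    have e2 : ∀ᶠ Y in 𝓝[{Y : Pt n | 0 ≤ Y.2}] ((x, 0) : Pt n), Y.1 ≠ 0 :=
      mem_nhdsWithin_of_mem_nhds ((isOpen_ne.preimage continuous_fst).mem_nhds hx0)
    have e3 : ∀ᶠ Y in 𝓝[{Y : Pt n | 0 ≤ Y.2}] ((x, 0) : Pt n), U Y < M :=
      (hU.continuousWithinAt hxX le_rfl fun h => hx0 (congrArg Prod.fst h)).tendsto.eventually
        (gt_mem_nhds (by have := le_abs_self (U (x, 0)); linarith))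
    have e4 : ∀ᶠ Y in 𝓝[{Y : Pt n | 0 ≤ Y.2}] ((x, 0) : Pt n),
        |bdry σ U Y.1 - bdry σ U x| < k / 2 := by
      have h1 : ContinuousAt (fun Y : Pt n => bdry σ U Y.1) (x, 0) :=
        ContinuousAt.comp (g := bdry σ U) (f := Prod.fst) (x := ((x, 0) : Pt n))
          (hU.continuousAt_bdry hx hx0) continuousAt_fst
      have h2 := (h1.sub (continuousAt_const (y := bdry σ U x))).abs
      refine mem_nhdsWithin_of_mem_nhds (h2.eventually (gt_mem_nhds ?_))
      simpa using hk0
    have e5 := e1.and (e2.and (e3.and e4))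
    rw [eventually_iff, Metric.mem_nhdsWithin_iff] at e5
    obtain ⟨ρ₀, h1, h2⟩ := e5
    exact ⟨ρ₀, h1, fun Y h3 h4 => by
      obtain ⟨a1, a2, a3, a4⟩ := h2 ⟨h3, h4⟩
      exact ⟨a1, a2, a3.le, a4.le⟩⟩
  set ρ := min (ρ₀ / 4) 1 with hρdef
  have hρpos : 0 < ρ := lt_min (by positivity) one_pos
  have hρ1 : ρ ≤ 1 := min_le_right _ _
  have hρ2 : ρ ≤ ρ₀ / 4 := min_le_left _ _
  set C := M / ρ ^ 2 * ((n + 2) * A + A + 1) with hC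
  have hC0 : 0 ≤ C := by positivity
  have ev1 : ∀ᶠ T in 𝓝[>] (0 : ℝ), T < ρ := mem_nhdsWithin_of_mem_nhds (gt_mem_nhds hρpos)
  have ev2 : ∀ᶠ T in 𝓝[>] (0 : ℝ), A * T ^ 2 < 2 * ρ := by
    have : Continuous fun T : ℝ => A * T ^ 2 := by fun_prop
    refine mem_nhdsWithin_of_mem_nhds ((this.tendsto 0).eventually (gt_mem_nhds ?_))
    simpa using hρpos
  have ev3 : ∀ᶠ T in 𝓝[>] (0 : ℝ), C * T ^ (2 - 2 * σ) < ε / 2 := by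
    have := (tendsto_rpow_nhdsGT_zero (r := 2 - 2 * σ) (by linarith)).const_mul C
    exact this.eventually (gt_mem_nhds (by simpa using hε))
  filter_upwards [ev1, ev2, ev3, self_mem_nhdsWithin] with T h1 h2 h3 (hT : 0 < T)
  intro v hv
  rcases eq_or_ne v 0 with rfl | hv0
  · simp; positivity
  have hvn : 0 < ‖v‖ := norm_pos_iff.2 hv0
  set e := ‖v‖⁻¹ • v with he
  have he1 : ‖e‖ = 1 := norm_smul_inv_norm hv0
  set m := x + (1 / 2 : ℝ) • v with hm
  have hYm : x + v - m = (1 / 2 : ℝ) • v := by rw [hm]; module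
  have hinner : inner ℝ ((1 / 2 : ℝ) • v) e = ‖v‖ / 2 := by
    rw [he, real_inner_smul_left, real_inner_smul_right, real_inner_self_eq_norm_sq]
    field_simp
  have hnorm : ‖(1 / 2 : ℝ) • v‖ = ‖v‖ / 2 := by rw [norm_smul]; norm_num; ring
  have hmx : ‖m - x‖ = ‖v‖ / 2 := by rw [hm, add_sub_cancel_left, hnorm]
  have hball : ∀ y, ‖y - m‖ ≤ ρ → dist y x < ρ₀ := fun y hy => by
    rw [dist_eq_norm]
    calc ‖y - x‖ ≤ ‖y - m‖ + ‖m - x‖ := norm_sub_le_norm_sub_add_norm_sub _ _ _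
      _ < ρ₀ := by rw [hmx]; linarith
  have hrefl : reflPt m e (x + v, T) = (x, T) := by
    rw [reflPt_mk, hYm, hinner, he, smul_smul]
    congr 1
    rw [show 2 * (‖v‖ / 2) * ‖v‖⁻¹ = 1 by field_simp, one_smul, add_sub_cancel_right]
  have hb : ∀ s : ℝ, |s| = 1 → s * (U (x + v, T) - U (x, T)) ≤ ε * T ^ (2 * σ) := fun s hs => by
    have key := hU.reflect_bound he1 hρpos hρ1 hT hk0.le hs (M := M) (m := m)
      (fun Y h4 h5 h6 => by
        obtain ⟨a1, a2, a3, -⟩ := hρ Y (by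
          rw [Prod.dist_eq]
          refine max_lt (hball _ h4) ?_
          rw [Real.dist_eq, sub_zero, abs_of_nonneg h5]; linarith) h5
        exact ⟨a1, a2, a3⟩)
      (fun y y' h4 h5 => by
        have a1 := (hρ (y, 0) (by rw [Prod.dist_eq, dist_self]; exact max_lt (hball y h4) hρ₀) le_rfl).2.2.2
        have a2 := (hρ (y', 0) (by rw [Prod.dist_eq, dist_self]; exact max_lt (hball y' h5) hρ₀) le_rfl).2.2.2
        rw [abs_le] at a1 a2 ⊢
        constructor <;> linarith [a1.1, a1.2, a2.1, a2.2])
      (x + v, T) (by rw [hYm, hinner]; positivity) (by rw [hYm, hnorm]; linarith) hT.le h1.le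
    rw [hrefl] at key
    simp only [hYm, hinner, hnorm] at key
    refine key.trans ?_
    set w := ‖v‖ / 2 with hw
    have hw0 : 0 < w := by positivity
    have hwA : 2 * w ≤ A * T ^ 2 := by rw [hw]; linarith
    have hw1 : w ≤ 1 := by linarith
    set P := T ^ (2 * σ) with hP
    have hP0 : 0 < P := Real.rpow_pos_of_pos hT _
    have hP2 : T ^ (2 * σ - 2) * T ^ 2 = P := by
      rw [Real.rpow_sub hT, show T ^ (2 : ℝ) = T ^ 2 by norm_cast]
      field_simp
      exact hP.symm
    have hT22 : T ^ (2 - 2 * σ) * P = T ^ 2 := by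
      rw [hP, ← Real.rpow_add hT, sub_add_cancel]; norm_cast
    have b4 : C * T ^ 2 ≤ ε / 2 * P := by
      rw [← hT22, ← mul_assoc]
      exact mul_le_mul_of_nonneg_right h3.le hP0.le
    have b5 : k * (1 + 2 * A) = ε / 2 := by rw [hk]; field_simp
    exact horizontal_arith hk0 hP2 (Real.rpow_pos_of_pos hT _) hρpos hρ1 hw0 hw1 (by linarith)
      hwA hσ hσ' hM0 n.cast_nonneg b4 b5
  rw [abs_le]
  have := hb 1 (by simp)
  have := hb (-1) (by simp)
  constructor <;> linarith

theorem Sol.vflux_kel (hU : Sol n σ U) {c x : EuclideanSpace ℝ (Fin n)} {l : ℝ} (hl : 0 < l)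
    (hxc : x ≠ c) (h0 : kelPt c l (x, 0) ≠ 0) (h2 : nsq (kelPt c l (x, 0)) < 4) :
    VFlux σ (kel ((n : ℝ) - 2 * σ) c l U) x (-bdry σ (kel ((n : ℝ) - 2 * σ) c l U) x) := by
  have hσ := hU.pos
  have hσ' := hU.lt_one
  set q := (n : ℝ) - 2 * σ with hq
  have hq0 : 0 < q := hU.q_pos
  set N := ‖x - c‖ ^ 2 with hN
  have hxc' : 0 < ‖x - c‖ := norm_pos_iff.2 (sub_ne_zero.2 hxc)
  have hN0 : 0 < N := by positivity
  set J : ℝ → ℝ := fun z => l / (N + z) with hJ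
  set j := l / N with hj
  have hj0 : 0 < j := by positivity
  set y := c + j • (x - c) with hy
  have hnsq : ∀ t : ℝ, nsq ((x, t) - ((c, 0) : Pt n)) = N + t ^ 2 := fun t => by simp [nsq, hN]
  have hpt : ∀ t : ℝ, kelPt c l (x, t) = (y + (J (t ^ 2) - j) • (x - c), J (t ^ 2) * t) := fun t => by
    rw [kelPt, hnsq]
    refine Prod.ext ?_ ?_
    · simp only [Prod.fst_add, Prod.smul_fst, Prod.fst_sub, hJ, hy]; module
    · simp [hJ]
  have hJ0 : J (0 ^ 2) = j := by simp [hJ, hj]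
  have hpt0 : kelPt c l (x, 0) = (y, 0) := by rw [hpt, hJ0]; simp
  have hyne : y ≠ 0 := fun h => h0 (by rw [hpt0, h]; rfl)
  have hy2 : ‖y‖ < 2 := by
    have := norm_fst_lt_two h2
    rwa [hpt0] at this
  have hkel : ∀ t : ℝ, kel q c l U (x, t) = J (t ^ 2) ^ (q / 2) *
      U (y + (J (t ^ 2) - j) • (x - c), J (t ^ 2) * t) := fun t => by
    rw [kel, hpt, hnsq]
  have hkel0 : kel q c l U (x, 0) = j ^ (q / 2) * U (y, 0) := by
    rw [hkel, hJ0]; simp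
  have hdJ : HasDerivAt J (l * (-1 / N ^ 2)) 0 := by
    have h := ((hasDerivAt_id (0 : ℝ)).const_add N).inv (by simpa using hN0.ne')
    have := h.const_mul l
    simpa [hJ, div_eq_mul_inv] using this
  have hJt : Tendsto (fun t : ℝ => J (t ^ 2)) (𝓝[>] 0) (𝓝 j) := by
    have h : ContinuousAt (fun t : ℝ => J (t ^ 2)) 0 :=
      ContinuousAt.comp (f := fun t : ℝ => t ^ 2) (g := J)
        (by simpa using hdJ.continuousAt) (by fun_prop)
    have := h.tendsto
    simp only [hJ0] at this
    exact this.mono_left nhdsWithin_le_nhds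
  have hJpos : ∀ t : ℝ, 0 < J (t ^ 2) := fun t => by simp only [hJ]; positivity
  have hst : Tendsto (fun t : ℝ => J (t ^ 2) * t) (𝓝[>] 0) (𝓝[>] 0) := by
    refine tendsto_nhdsWithin_iff.2 ⟨?_, ?_⟩
    · have h := hJt.mul ((tendsto_id (x := 𝓝 (0 : ℝ))).mono_left
        (nhdsWithin_le_nhds (s := Set.Ioi 0)))
      simpa using h
    · filter_upwards [self_mem_nhdsWithin] with t (ht : 0 < t)
      exact mul_pos (hJpos t) ht
  -- the weight
  have l1 : Tendsto (fun t : ℝ => (J (t ^ 2) ^ (q / 2) - j ^ (q / 2)) / t ^ (2 * σ)) (𝓝[>] 0)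
      (𝓝 0) := by
    have hd : HasDerivAt (fun z => J z ^ (q / 2)) _ 0 :=
      hdJ.rpow_const (p := q / 2) (Or.inl (by simp [hJ]; exact ⟨hl.ne', hN0.ne'⟩))
    have := vflux_of_sq (x := x) (F := fun Y : Pt n => J (Y.2 ^ 2) ^ (q / 2)) hσ' hd fun _ => rfl
    simpa only [VFlux, hJ0] using this
  -- vertical increment
  have l2 : Tendsto (fun t : ℝ => (U (y, J (t ^ 2) * t) - U (y, 0)) / (J (t ^ 2) * t) ^ (2 * σ))
      (𝓝[>] 0) (𝓝 (-bdry σ U y)) := (hU.vflux y hy2 hyne).comp hst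
  -- horizontal increment
  have l3 : Tendsto (fun t : ℝ => (U (y + (J (t ^ 2) - j) • (x - c), J (t ^ 2) * t) -
      U (y, J (t ^ 2) * t)) / (J (t ^ 2) * t) ^ (2 * σ)) (𝓝[>] 0) (𝓝 0) := by
    rw [NormedAddGroup.tendsto_nhds_zero]
    intro ε hε
    have hA : 0 ≤ ‖x - c‖ * (j / N) * (4 / j ^ 2) := by positivity
    have e1 := hst.eventually (hU.horizontal hy2 hyne hA (half_pos hε))
    have e2 := hJt.eventually (lt_mem_nhds (half_lt_self hj0))
    filter_upwards [e1, e2, self_mem_nhdsWithin] with t h3 h4 (ht : 0 < t)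
    have hs : 0 < J (t ^ 2) * t := mul_pos (hJpos t) ht
    have hP := Real.rpow_pos_of_pos hs (2 * σ)
    have hJd : |J (t ^ 2) - j| ≤ j / N * t ^ 2 := by
      have : J (t ^ 2) - j = -(j * t ^ 2 / (N + t ^ 2)) := by
        simp only [hJ, hj]; field_simp; ring
      rw [this, abs_neg, abs_of_nonneg (by positivity)]
      calc j * t ^ 2 / (N + t ^ 2) ≤ j * t ^ 2 / N :=
            div_le_div_of_nonneg_left (by positivity) hN0 (le_add_of_nonneg_right (sq_nonneg t))
        _ = j / N * t ^ 2 := by ring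
    have h5 := h3 ((J (t ^ 2) - j) • (x - c)) (by
      rw [norm_smul, Real.norm_eq_abs]
      calc |J (t ^ 2) - j| * ‖x - c‖ ≤ j / N * t ^ 2 * ‖x - c‖ := by gcongr
        _ = ‖x - c‖ * (j / N) * (4 / j ^ 2) * (j / 2 * t) ^ 2 := by field_simp; norm_num
        _ ≤ _ := by gcongr)
    rw [Real.norm_eq_abs, abs_div, abs_of_pos hP, div_lt_iff₀ hP]
    exact h5.trans_lt (mul_lt_mul_of_pos_right (half_lt_self hε) hP)
  have l4 : Tendsto (fun t : ℝ => J (t ^ 2) ^ (q / 2) * J (t ^ 2) ^ (2 * σ)) (𝓝[>] 0)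
      (𝓝 (j ^ (q / 2) * j ^ (2 * σ))) :=
    (hJt.rpow_const (Or.inl hj0.ne')).mul (hJt.rpow_const (Or.inl hj0.ne'))
  have l5 := (l4.mul (l3.add l2)).add (l1.mul_const (U (y, 0)))
  have hval : -bdry σ (kel q c l U) x =
      j ^ (q / 2) * j ^ (2 * σ) * (0 + -bdry σ U y) + 0 * U (y, 0) := by
    have hUy : 0 ≤ U (y, 0) := by
      rw [← hpt0]
      exact hU.nonneg _ h2.le (by rw [hpt0]) h0
    rw [bdry, bdry, hkel0, ← hq, Real.mul_rpow (by positivity) hUy, ← Real.rpow_mul hj0.le,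
      ← Real.rpow_add hj0, show q / 2 * (((n : ℝ) + 2 * σ) / q) = q / 2 + 2 * σ by
        field_simp; rw [hq]; ring]
    ring
  rw [hval]
  refine l5.congr' ?_
  filter_upwards [self_mem_nhdsWithin] with t (ht : 0 < t)
  have hP := (Real.rpow_pos_of_pos ht (2 * σ)).ne'
  have hP' := (Real.rpow_pos_of_pos (hJpos t) (2 * σ)).ne'
  rw [hkel, hkel0, Real.mul_rpow (hJpos t).le ht.le]
  field_simp
  ring

end KelvinFlux

/-! ### Interior Harnack inequality -/

section BumpWeights

variable {n : ℕ}

/-- The weight `(1 - |Z|²)₊²`. -/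
def wEta {n : ℕ} (Z : Pt n) : ℝ := max (1 - nsq Z) 0 ^ 2

/-- The weight `(1 - |Z|²)₊³ / 6`, whose gradient is `-wEta Z • Z`. -/
def wZeta {n : ℕ} (Z : Pt n) : ℝ := max (1 - nsq Z) 0 ^ 3 / 6

@[fun_prop]
theorem continuous_wEta : Continuous (wEta : Pt n → ℝ) := by unfold wEta; fun_prop

@[fun_prop]
theorem continuous_wZeta : Continuous (wZeta : Pt n → ℝ) := by unfold wZeta; fun_prop

theorem wEta_nonneg (Z : Pt n) : 0 ≤ wEta Z := sq_nonneg _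

theorem wZeta_nonneg (Z : Pt n) : 0 ≤ wZeta Z := by unfold wZeta; positivity

theorem wEta_le_one (Z : Pt n) : wEta Z ≤ 1 := by
  unfold wEta
  have h1 : max (1 - nsq Z) 0 ≤ 1 := max_le (by linarith [nsq_nonneg Z]) zero_le_one
  exact pow_le_one₀ (le_max_right _ _) h1

theorem wZeta_le (Z : Pt n) : wZeta Z ≤ wEta Z / 6 := by
  unfold wZeta wEta
  have h0 : 0 ≤ max (1 - nsq Z) 0 := le_max_right _ _
  have h1 : max (1 - nsq Z) 0 ≤ 1 := max_le (by linarith [nsq_nonneg Z]) zero_le_one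
  have := pow_le_pow_of_le_one h0 h1 (show 2 ≤ 3 by norm_num)
  linarith

theorem wEta_eq_zero {Z : Pt n} (h : 1 ≤ nsq Z) : wEta Z = 0 := by
  rw [wEta, max_eq_right (by linarith)]; norm_num

theorem wZeta_eq_zero {Z : Pt n} (h : 1 ≤ nsq Z) : wZeta Z = 0 := by
  rw [wZeta, max_eq_right (by linarith)]; norm_num

theorem norm_le_of_nsq_le {Z : Pt n} {r : ℝ} (hr : 0 ≤ r) (h : nsq Z ≤ r ^ 2) : ‖Z‖ ≤ r := by
  unfold nsq at h
  refine max_le (abs_le_of_sq_le_sq' (by nlinarith [sq_nonneg Z.2]) hr).2 ?_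
  exact abs_le.2 (abs_le_of_sq_le_sq' (by nlinarith [sq_nonneg ‖Z.1‖]) hr)

theorem hasCompactSupport_of_nsq {f : Pt n → ℝ} (h : ∀ Z, 1 ≤ nsq Z → f Z = 0) :
    HasCompactSupport f := by
  refine HasCompactSupport.of_support_subset_isCompact (isCompact_closedBall (0 : Pt n) 1) ?_
  intro Z hZ
  rw [mem_closedBall_zero_iff]
  refine norm_le_of_nsq_le zero_le_one ?_
  by_contra! h1
  exact hZ (h Z (by linarith))

theorem continuous_of_nsq {f : Pt n → ℝ} (h : ∀ Z, 1 ≤ nsq Z → f Z = 0)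
    (h' : ∀ Z, nsq Z < 2 → ContinuousAt f Z) : Continuous f := by
  refine continuous_iff_continuousAt.2 fun Z => ?_
  rcases lt_or_ge (nsq Z) 2 with h1 | h1
  · exact h' Z h1
  · have : f =ᶠ[𝓝 Z] fun _ => 0 := by
      filter_upwards [(isOpen_lt continuous_const continuous_nsq).mem_nhds
        (show (1 : ℝ) < nsq Z by linarith)] with W hW using h W (le_of_lt hW)
    exact continuousAt_const.congr this.symm

theorem hasDerivAt_pos_cube (z : ℝ) : HasDerivAt (fun z : ℝ => max z 0 ^ 3) (3 * max z 0 ^ 2) z := by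
  rcases lt_trichotomy z 0 with h | rfl | h
  · have : (fun z : ℝ => max z 0 ^ 3) =ᶠ[𝓝 z] fun _ => 0 := by
      filter_upwards [gt_mem_nhds h] with w hw
      simp [max_eq_right (le_of_lt hw)]
    simpa [max_eq_right h.le] using (hasDerivAt_const z (0 : ℝ)).congr_of_eventuallyEq this
  · rw [hasDerivAt_iff_isLittleO]
    simp only [sub_zero, max_self, ne_eq, OfNat.ofNat_ne_zero, not_false_eq_true, zero_pow,
      mul_zero, smul_eq_mul]
    have h1 : (fun z : ℝ => max z 0 ^ 3) =O[𝓝 0] fun z => z ^ 3 := by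
      refine Asymptotics.IsBigO.of_bound 1 (Eventually.of_forall fun z => ?_)
      rw [norm_pow, norm_pow, one_mul]
      refine pow_le_pow_left₀ (norm_nonneg _) ?_ 3
      rw [Real.norm_eq_abs, Real.norm_eq_abs, abs_of_nonneg (le_max_right z 0)]
      exact max_le (le_abs_self z) (abs_nonneg z)
    exact h1.trans_isLittleO (by
      simpa using Asymptotics.isLittleO_pow_pow (𝕜 := ℝ) (show 1 < 3 by norm_num))
  · have : (fun z : ℝ => max z 0 ^ 3) =ᶠ[𝓝 z] fun z => z ^ 3 := by
      filter_upwards [lt_mem_nhds h] with w hw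
      simp [max_eq_left (le_of_lt hw)]
    simpa [max_eq_left h.le] using (hasDerivAt_pow 3 z).congr_of_eventuallyEq this

/-- The Euclidean inner product with `Z` on `ℝ^{n+1}`. -/
def innerPt {n : ℕ} (Z : Pt n) : Pt n →L[ℝ] ℝ :=
  (innerSL ℝ Z.1).comp (ContinuousLinearMap.fst ℝ _ _) +
    Z.2 • ContinuousLinearMap.snd ℝ (EuclideanSpace ℝ (Fin n)) ℝ

theorem innerPt_stdVec (Z : Pt n) (i : Option (Fin n)) : innerPt Z (stdVec i) = coord Z i := by
  rcases i with _ | i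
  · simp [innerPt, stdVec, coord]
  · simp [innerPt, stdVec, coord, EuclideanSpace.inner_single_right]

theorem hasFDerivAt_nsq (Z : Pt n) : HasFDerivAt nsq ((2 : ℝ) • innerPt Z) Z := by
  have h1 := (hasStrictFDerivAt_norm_sq Z.1).hasFDerivAt.comp Z (hasFDerivAt_fst (𝕜 := ℝ) (p := Z))
  have h2 := (hasFDerivAt_snd (𝕜 := ℝ) (p := Z)).pow 2
  refine (h1.add h2).congr_fderiv ?_
  ext v <;> simp [innerPt, two_smul]

theorem hasFDerivAt_wZeta (Z : Pt n) : HasFDerivAt wZeta (-(wEta Z) • innerPt Z) Z := by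
  have h1 := (hasDerivAt_pos_cube (1 - nsq Z)).comp_hasFDerivAt Z
    ((hasFDerivAt_nsq Z).const_sub 1)
  have h2 := h1.const_mul (1 / 6 : ℝ)
  have h3 : wZeta = fun W : Pt n => (1 / 6 : ℝ) * ((fun z : ℝ => max z 0 ^ 3) ∘ fun W => 1 - nsq W) W := by
    funext W; simp [wZeta]; ring
  rw [h3]
  refine h2.congr_fderiv ?_
  ext v <;> simp [wEta] <;> ring

theorem continuous_coord (i : Option (Fin n)) : Continuous fun Z : Pt n => coord Z i := by
  simp only [← innerPt_stdVec]
  unfold innerPt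
  rcases i with _ | i <;> simp [stdVec] <;> fun_prop

end BumpWeights

section MeanValue

variable {n : ℕ}

theorem isAddHaarMeasure_volume_pt : (volume : Measure (Pt n)).IsAddHaarMeasure :=
  inferInstanceAs ((volume : Measure (EuclideanSpace ℝ (Fin n))).prod
    (volume : Measure ℝ)).IsAddHaarMeasure

theorem hasFDerivAt_comp_line {V : Pt n → ℝ} (hV : Differentiable ℝ V) (X : Pt n) (ρ : ℝ)
    (Z : Pt n) : HasFDerivAt (fun Z => V (X + ρ • Z)) (ρ • fderiv ℝ V (X + ρ • Z)) Z := by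
  have h1 : HasFDerivAt (fun Z : Pt n => X + ρ • Z) (ρ • ContinuousLinearMap.id ℝ (Pt n)) Z :=
    ((hasFDerivAt_id Z).const_smul ρ).const_add X
  refine ((hV (X + ρ • Z)).hasFDerivAt.comp Z h1).congr_fderiv ?_
  ext v <;> simp

theorem integrable_of_nsq {f : Pt n → ℝ} (hf : Continuous f) (h : ∀ Z, 1 ≤ nsq Z → f Z = 0) :
    Integrable f := hf.integrable_of_hasCompactSupport (hasCompactSupport_of_nsq h)

/-- Divergence theorem against the weight `wZeta`. -/
theorem integral_fderiv_wEta {V : Pt n → ℝ} (hV : ContDiff ℝ 2 V) (X : Pt n) (ρ : ℝ) :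
    ∫ Z, fderiv ℝ V (X + ρ • Z) Z * wEta Z = ∫ Z, ρ * lapl V (X + ρ • Z) * wZeta Z := by
  have hV1 : ContDiff ℝ 1 (fderiv ℝ V) := hV.fderiv_right (by norm_num)
  have hc1 : Continuous (fderiv ℝ V) := hV1.continuous
  have hc2 : Continuous (fderiv ℝ (fderiv ℝ V)) := hV1.continuous_fderiv (by norm_num)
  have key : ∀ i : Option (Fin n),
      ∫ Z, fderiv ℝ V (X + ρ • Z) (stdVec i) * (coord Z i * wEta Z) =
        ∫ Z, ρ * fderiv ℝ (fderiv ℝ V) (X + ρ • Z) (stdVec i) (stdVec i) * wZeta Z := fun i => by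
    have hd : ∀ Z, HasFDerivAt (fun Z : Pt n => fderiv ℝ V (X + ρ • Z) (stdVec i))
        (ρ • fderiv ℝ (fun W => fderiv ℝ V W (stdVec i)) (X + ρ • Z)) Z := fun Z =>
      hasFDerivAt_comp_line (V := fun W => fderiv ℝ V W (stdVec i))
        ((hV1.clm_apply contDiff_const).differentiable (by norm_num)) X ρ Z
    have hd' : ∀ Z, fderiv ℝ (fun Z : Pt n => fderiv ℝ V (X + ρ • Z) (stdVec i)) Z (stdVec i) =
        ρ * fderiv ℝ (fderiv ℝ V) (X + ρ • Z) (stdVec i) (stdVec i) := fun Z => by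
      rw [(hd Z).fderiv]
      rw [fderiv_clm_apply (hV1.differentiable (by norm_num) _) (differentiableAt_const _)]
      simp
    have hz : ∀ Z : Pt n, fderiv ℝ wZeta Z (stdVec i) = -(coord Z i * wEta Z) := fun Z => by
      rw [(hasFDerivAt_wZeta Z).fderiv]
      simp [innerPt_stdVec, mul_comm]
    have hci := continuous_coord (n := n) i
    have := isAddHaarMeasure_volume_pt (n := n)
    have := integral_mul_fderiv_eq_neg_fderiv_mul_of_integrable (μ := (volume : Measure (Pt n)))
      (f := fun Z : Pt n => fderiv ℝ V (X + ρ • Z) (stdVec i)) (g := wZeta) (v := stdVec i)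
      (by simp only [hd']
          exact integrable_of_nsq (by fun_prop) fun Z h => by rw [wZeta_eq_zero h, mul_zero])
      (by simp only [hz]
          exact integrable_of_nsq (by fun_prop) fun Z h => by rw [wEta_eq_zero h]; simp)
      (integrable_of_nsq (by fun_prop) fun Z h => by rw [wZeta_eq_zero h, mul_zero])
      (fun Z _ => (hd Z).differentiableAt)
      (fun Z _ => (hasFDerivAt_wZeta Z).differentiableAt)
    simp only [hd', hz, mul_neg, integral_neg, neg_inj] at this
    exact this
  have e1 : ∀ Z : Pt n, fderiv ℝ V (X + ρ • Z) Z * wEta Z =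
      ∑ i, fderiv ℝ V (X + ρ • Z) (stdVec i) * (coord Z i * wEta Z) := fun Z => by
    rw [← sum_coord_mul, Finset.sum_mul]
    exact Finset.sum_congr rfl fun i _ => by ring
  have e2 : ∀ Z : Pt n, ρ * lapl V (X + ρ • Z) * wZeta Z =
      ∑ i, ρ * fderiv ℝ (fderiv ℝ V) (X + ρ • Z) (stdVec i) (stdVec i) * wZeta Z := fun Z => by
    rw [lapl_eq_sum hV.contDiffAt, Finset.mul_sum, Finset.sum_mul]
  simp only [e1, e2]
  rw [integral_finsetSum, integral_finsetSum]
  · exact Finset.sum_congr rfl fun i _ => key i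
  · exact fun i _ => integrable_of_nsq (by fun_prop) fun Z h => by
      rw [wZeta_eq_zero h, mul_zero]
  · exact fun i _ => integrable_of_nsq (by have := continuous_coord (n := n) i; fun_prop)
      fun Z h => by rw [wEta_eq_zero h]; simp

theorem hasDerivAt_integral_wEta {V : Pt n → ℝ} (hV : ContDiff ℝ 2 V) (X : Pt n) (ρ : ℝ) :
    HasDerivAt (fun ρ : ℝ => ∫ Z, V (X + ρ • Z) * wEta Z)
      (∫ Z, fderiv ℝ V (X + ρ • Z) Z * wEta Z) ρ := by
  have hc1 : Continuous (fderiv ℝ V) := hV.continuous_fderiv (by norm_num)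
  have hc : Continuous V := hV.continuous
  obtain ⟨M, hM⟩ : ∃ M, ∀ p ∈ Metric.closedBall ρ 1 ×ˢ Metric.closedBall (0 : Pt n) 1,
      ‖fderiv ℝ V (X + p.1 • p.2) p.2‖ ≤ M :=
    ((isCompact_closedBall _ _).prod (isCompact_closedBall _ _)).exists_bound_of_continuousOn
      (by fun_prop)
  refine (hasDerivAt_integral_of_dominated_loc_of_deriv_le (bound := fun Z => M * wEta Z)
    (F' := fun ρ Z => fderiv ℝ V (X + ρ • Z) Z * wEta Z)
    (Metric.closedBall_mem_nhds ρ one_pos) ?_ ?_ ?_ ?_ ?_ ?_).2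
  · exact Eventually.of_forall fun r => (by fun_prop : Continuous fun Z : Pt n =>
      V (X + r • Z) * wEta Z).aestronglyMeasurable
  · exact integrable_of_nsq (by fun_prop) fun Z h => by rw [wEta_eq_zero h, mul_zero]
  · exact (by fun_prop : Continuous fun Z : Pt n =>
      fderiv ℝ V (X + ρ • Z) Z * wEta Z).aestronglyMeasurable
  · refine Eventually.of_forall fun Z r hr => ?_
    rcases le_or_gt 1 (nsq Z) with h | h
    · rw [wEta_eq_zero h]; simp
    · rw [norm_mul, Real.norm_eq_abs (wEta Z), abs_of_nonneg (wEta_nonneg Z)]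
      refine mul_le_mul_of_nonneg_right (hM (r, Z) ⟨hr, ?_⟩) (wEta_nonneg Z)
      rw [mem_closedBall_zero_iff]
      exact norm_le_of_nsq_le zero_le_one (by linarith)
  · exact integrable_of_nsq (by fun_prop) fun Z h => by rw [wEta_eq_zero h, mul_zero]
  · refine Eventually.of_forall fun Z r _ => ?_
    have h1 : HasDerivAt (fun r : ℝ => X + r • Z) Z r := by
      simpa using ((hasDerivAt_id r).smul_const Z).const_add X
    exact ((hV.differentiable (by norm_num) _).hasFDerivAt.comp_hasDerivAt r h1).mul_const _

/-- The second integration by parts, which uses the equation. -/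
theorem integral_lapl_wZeta {V : Pt n → ℝ} {a : ℝ} (hV : ContDiff ℝ 2 V) {X : Pt n} {ρ : ℝ}
    (ht : 0 < X.2) (hρ : |ρ| ≤ X.2 / 8)
    (hpde : ∀ Z, nsq Z < 1 → lapl V (X + ρ • Z) + a / (X + ρ • Z).2 * dt V (X + ρ • Z) = 0) :
    ∫ Z, ρ * lapl V (X + ρ • Z) * wZeta Z = ∫ Z, a * (-(Z.2 * wEta Z) * (X.2 + ρ * Z.2)⁻¹ -
      wZeta Z * ρ * ((X.2 + ρ * Z.2)⁻¹) ^ 2) * V (X + ρ • Z) := by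
  have hc1 : Continuous (fderiv ℝ V) := hV.continuous_fderiv (by norm_num)
  have hc : Continuous V := hV.continuous
  have hw : ∀ Z : Pt n, nsq Z < 2 → 0 < X.2 + ρ * Z.2 := fun Z hZ => by
    have h1 : |Z.2| ≤ 2 := abs_le_of_sq_le_sq (by unfold nsq at hZ; nlinarith [sq_nonneg ‖Z.1‖]) (by norm_num)
    have h2 : |ρ * Z.2| ≤ X.2 / 8 * 2 := by
      rw [abs_mul]; exact mul_le_mul hρ h1 (abs_nonneg _) (by positivity)
    linarith [neg_abs_le (ρ * Z.2)]
  set f : Pt n → ℝ := fun Z => wZeta Z * (X.2 + ρ * Z.2)⁻¹ with hf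
  set f' : Pt n → ℝ := fun Z => -(Z.2 * wEta Z) * (X.2 + ρ * Z.2)⁻¹ -
      wZeta Z * ρ * ((X.2 + ρ * Z.2)⁻¹) ^ 2 with hf'
  have hf0 : ∀ Z, 1 ≤ nsq Z → f Z = 0 := fun Z h => by simp [hf, wZeta_eq_zero h]
  have hf'0 : ∀ Z, 1 ≤ nsq Z → f' Z = 0 := fun Z h => by
    simp [hf', wZeta_eq_zero h, wEta_eq_zero h]
  have hfc : Continuous f := continuous_of_nsq hf0 fun Z hZ => by
    have := (hw Z hZ).ne'
    have h1 : ContinuousAt (fun Z : Pt n => (X.2 + ρ * Z.2)⁻¹) Z :=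
      ContinuousAt.inv₀ (by fun_prop) this
    exact continuous_wZeta.continuousAt.mul h1
  have hf'c : Continuous f' := continuous_of_nsq hf'0 fun Z hZ => by
    have := (hw Z hZ).ne'
    have h1 : ContinuousAt (fun Z : Pt n => (X.2 + ρ * Z.2)⁻¹) Z :=
      ContinuousAt.inv₀ (by fun_prop) this
    have h2 : Continuous fun Z : Pt n => -(Z.2 * wEta Z) := by fun_prop
    have h3 : Continuous fun Z : Pt n => wZeta Z * ρ := by fun_prop
    exact (h2.continuousAt.mul h1).sub (h3.continuousAt.mul (h1.pow 2))
  have hfd : ∀ Z, DifferentiableAt ℝ f Z ∧ fderiv ℝ f Z (stdVec none) = f' Z := fun Z => by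
    rcases lt_or_ge (nsq Z) 2 with hZ | hZ
    · have h0 := (hw Z hZ).ne'
      have h1 : HasFDerivAt (fun Z : Pt n => X.2 + ρ * Z.2)
          (ρ • ContinuousLinearMap.snd ℝ (EuclideanSpace ℝ (Fin n)) ℝ) Z :=
        ((hasFDerivAt_snd (𝕜 := ℝ) (p := Z)).const_mul ρ).const_add X.2
      have h2 := (hasDerivAt_inv h0).comp_hasFDerivAt Z h1
      have h3 := (hasFDerivAt_wZeta Z).mul h2
      refine ⟨h3.differentiableAt, ?_⟩
      have h4 := h3.fderiv
      change fderiv ℝ f Z = _ at h4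
      rw [h4]
      simp [innerPt_stdVec, hf', coord]
      simp [stdVec]
      ring
    · have h1 : f =ᶠ[𝓝 Z] fun _ => 0 := by
        filter_upwards [(isOpen_lt continuous_const continuous_nsq).mem_nhds
          (show (1 : ℝ) < nsq Z by linarith)] with W hW using hf0 W (le_of_lt hW)
      exact ⟨(differentiableAt_const _).congr_of_eventuallyEq h1, by
        rw [h1.fderiv_eq, hf'0 Z (by linarith)]; simp⟩
  have hg := fun Z => hasFDerivAt_comp_line (hV.differentiable (by norm_num)) X ρ Z
  have hg' : ∀ Z, fderiv ℝ (fun Z => V (X + ρ • Z)) Z (stdVec none) = ρ * dt V (X + ρ • Z) :=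
    fun Z => by rw [(hg Z).fderiv]; rfl
  have hdtc : Continuous (dt V) := by unfold dt; fun_prop
  have := isAddHaarMeasure_volume_pt (n := n)
  have := integral_mul_fderiv_eq_neg_fderiv_mul_of_integrable (μ := (volume : Measure (Pt n)))
    (f := f) (g := fun Z => V (X + ρ • Z)) (v := stdVec none)
    (by simp only [fun Z => (hfd Z).2]
        exact integrable_of_nsq (by fun_prop) fun Z h => by rw [hf'0 Z h, zero_mul])
    (by simp only [hg']
        exact integrable_of_nsq (by fun_prop) fun Z h => by rw [hf0 Z h, zero_mul])
    (integrable_of_nsq (by fun_prop) fun Z h => by rw [hf0 Z h, zero_mul])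
    (fun Z _ => (hfd Z).1) (fun Z _ => (hg Z).differentiableAt)
  simp only [hg', fun Z => (hfd Z).2] at this
  have e1 : ∀ Z, ρ * lapl V (X + ρ • Z) * wZeta Z = -a * (f Z * (ρ * dt V (X + ρ • Z))) :=
    fun Z => by
      rcases le_or_gt 1 (nsq Z) with h | h
      · rw [hf0 Z h, wZeta_eq_zero h]; ring
      · have h1 := hpde Z h
        rw [eq_neg_of_add_eq_zero_left h1]
        simp only [hf, Prod.snd_add, Prod.smul_snd, smul_eq_mul, div_eq_mul_inv]
        ring
  simp only [e1, mul_assoc a]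
  rw [integral_const_mul, integral_const_mul, this]
  ring

end MeanValue

section InteriorHarnack

variable {n : ℕ} {σ : ℝ} {U : Pt n → ℝ}

theorem nsq_smul (r : ℝ) (X : Pt n) : nsq (r • X) = r ^ 2 * nsq X := by
  simp only [nsq, Prod.smul_fst, Prod.smul_snd, norm_smul, mul_pow, Real.norm_eq_abs, sq_abs,
    smul_eq_mul]
  ring

theorem nsq_add_le (X Y : Pt n) : nsq (X + Y) ≤ 2 * nsq X + 2 * nsq Y := by
  simp only [nsq, Prod.fst_add, Prod.snd_add]
  have h1 := norm_add_le X.1 Y.1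
  have h2 := sq_nonneg (‖X.1‖ - ‖Y.1‖)
  have h3 : ‖X.1 + Y.1‖ ^ 2 ≤ (‖X.1‖ + ‖Y.1‖) ^ 2 := pow_le_pow_left₀ (norm_nonneg _) h1 2
  nlinarith [sq_nonneg (X.2 - Y.2)]

theorem nsq_neg (X : Pt n) : nsq (-X) = nsq X := by simp [nsq]

theorem nsq_sub_le (X Y : Pt n) : nsq (X - Y) ≤ 2 * nsq X + 2 * nsq Y := by
  rw [sub_eq_add_neg, ← nsq_neg Y]; exact nsq_add_le _ _

theorem nsq_le_norm_sq (X : Pt n) : nsq X ≤ 2 * ‖X‖ ^ 2 := by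
  have h1 : ‖X.1‖ ^ 2 ≤ ‖X‖ ^ 2 := pow_le_pow_left₀ (norm_nonneg _) (norm_fst_le X) 2
  have h2 : ‖X.2‖ ^ 2 ≤ ‖X‖ ^ 2 := pow_le_pow_left₀ (norm_nonneg _) (norm_snd_le X) 2
  rw [Real.norm_eq_abs, sq_abs] at h2
  unfold nsq
  linarith

theorem abs_snd_le_of_nsq_le {X : Pt n} {r : ℝ} (hr : 0 ≤ r) (h : nsq X ≤ r ^ 2) : |X.2| ≤ r :=
  (norm_snd_le X).trans (norm_le_of_nsq_le hr h)

theorem le_exp_mul_of_abs_deriv_le {F F' : ℝ → ℝ} {K R : ℝ} (hR : 0 ≤ R)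
    (hF : ∀ r, HasDerivAt F (F' r) r) (h : ∀ r ∈ Set.Icc 0 R, |F' r| ≤ K * F r) :
    F 0 ≤ Real.exp (K * R) * F R ∧ F R ≤ Real.exp (K * R) * F 0 := by
  have key : ∀ s r : ℝ, HasDerivAt (fun r => Real.exp (K * r) * (s * F (s * (r - R / 2) + R / 2)))
      (Real.exp (K * r) * K * (s * F (s * (r - R / 2) + R / 2)) +
        Real.exp (K * r) * (s * (F' (s * (r - R / 2) + R / 2) * s))) r := fun s r => by
    have h1 : HasDerivAt (fun r => Real.exp (K * r)) (Real.exp (K * r) * K) r := by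
      simpa using ((hasDerivAt_id r).const_mul K).exp
    have h2 : HasDerivAt (fun r => s * (r - R / 2) + R / 2) s r := by
      simpa using (((hasDerivAt_id r).sub_const (R / 2)).const_mul s).add_const (R / 2)
    exact h1.mul (((hF _).comp r h2).const_mul s)
  have mono : ∀ s : ℝ, |s| = 1 → MonotoneOn
      (fun r => Real.exp (K * r) * F (s * (r - R / 2) + R / 2)) (Set.Icc 0 R) := fun s hs => by
    have hss : s * s = 1 := by rw [← abs_mul_abs_self, hs, one_mul]
    have hd : ∀ r, HasDerivAt (fun r => Real.exp (K * r) * F (s * (r - R / 2) + R / 2))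
      (Real.exp (K * r) * (K * F (s * (r - R / 2) + R / 2) + F' (s * (r - R / 2) + R / 2) * s)) r :=
      fun r => by
        have := (key s r).const_mul s
        refine (this.congr_deriv ?_).congr_of_eventuallyEq (Eventually.of_forall fun r => ?_)
        · linear_combination (Real.exp (K * r) * K * F (s * (r - R / 2) + R / 2) +
            Real.exp (K * r) * (F' (s * (r - R / 2) + R / 2) * s)) * hss
        · linear_combination -(Real.exp (K * r) * F (s * (r - R / 2) + R / 2)) * hss
    refine monotoneOn_of_deriv_nonneg (convex_Icc 0 R)
      (fun r _ => (hd r).continuousAt.continuousWithinAt)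
      (fun r _ => (hd r).differentiableAt.differentiableWithinAt) fun r hr => ?_
    rw [interior_Icc] at hr
    rw [(hd r).deriv]
    refine mul_nonneg (Real.exp_pos _).le ?_
    have hmem : s * (r - R / 2) + R / 2 ∈ Set.Icc 0 R := by
      rcases eq_or_eq_neg_of_abs_eq hs with rfl | rfl <;> constructor <;> linarith [hr.1, hr.2]
    have := h _ hmem
    have h3 : |F' (s * (r - R / 2) + R / 2) * s| ≤ K * F (s * (r - R / 2) + R / 2) := by
      rwa [abs_mul, hs, mul_one]
    linarith [neg_abs_le (F' (s * (r - R / 2) + R / 2) * s)]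
  have h0 : (0 : ℝ) ∈ Set.Icc 0 R := ⟨le_rfl, hR⟩
  have h1 : R ∈ Set.Icc 0 R := ⟨hR, le_rfl⟩
  constructor
  · have := mono 1 (by simp) h0 h1 hR
    simpa using this
  · have := mono (-1) (by simp) h0 h1 hR
    simp only [mul_zero, Real.exp_zero] at this
    rw [show -1 * (0 - R / 2) + R / 2 = R by ring, show -1 * (R - R / 2) + R / 2 = 0 by ring] at this
    linarith

theorem weight_bound {η ζ s t ρ w : ℝ} (hη : 0 ≤ η) (hζ : 0 ≤ ζ) (hζη : ζ ≤ η / 6) (hs : |s| ≤ 1)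
    (ht : 0 < t) (hρ : |ρ| ≤ t / 8) (hw : 0 ≤ w) (hwt : t * w ≤ 8 / 7) :
    |-(s * η) * w - ζ * ρ * w ^ 2| ≤ 2 / t * η := by
  have h1 : |-(s * η) * w| ≤ η * w := by
    rw [abs_mul, abs_neg, abs_mul, abs_of_nonneg hη, abs_of_nonneg hw]
    exact mul_le_mul_of_nonneg_right (by nlinarith) hw
  have h2 : |ζ * ρ * w ^ 2| ≤ η / 6 * (t / 8) * w ^ 2 := by
    rw [abs_mul, abs_mul, abs_of_nonneg hζ, abs_of_nonneg (sq_nonneg w)]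
    gcongr
  have h3 : η * w + η / 6 * (t / 8) * w ^ 2 ≤ 2 / t * η := by
    have h4 : η * w + η / 6 * (t / 8) * w ^ 2 = 1 / t * η * (t * w * (1 + t * w / 48)) := by
      field_simp
      ring
    have h0 : 0 ≤ t * w := by positivity
    have h5 : t * w * (1 + t * w / 48) ≤ 2 := by nlinarith
    calc _ = 1 / t * η * (t * w * (1 + t * w / 48)) := h4
      _ ≤ 1 / t * η * 2 := mul_le_mul_of_nonneg_left h5 (by positivity)
      _ = _ := by ring
  calc _ ≤ |-(s * η) * w| + |ζ * ρ * w ^ 2| := abs_sub _ _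
    _ ≤ _ := by linarith

theorem mean_value_bounds {V : Pt n → ℝ} {a : ℝ} (ha : |a| ≤ 1) (hV : ContDiff ℝ 2 V) {X : Pt n}
    {R : ℝ} (hR : 0 ≤ R) (ht : 0 < X.2) (hRt : R ≤ X.2 / 8) (h0 : ∀ Y, 0 ≤ V Y)
    (hpde : ∀ Y, nsq (Y - X) ≤ R ^ 2 → lapl V Y + a / Y.2 * dt V Y = 0) :
    V X * ∫ Z : Pt n, wEta Z ≤ 2 * ∫ Z, V (X + R • Z) * wEta Z ∧
    ∫ Z, V (X + R • Z) * wEta Z ≤ 2 * (V X * ∫ Z : Pt n, wEta Z) := by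
  have hc : Continuous V := hV.continuous
  have hint : ∀ r : ℝ, Integrable fun Z : Pt n => V (X + r • Z) * wEta Z := fun r =>
    integrable_of_nsq (by fun_prop) fun Z h => by rw [wEta_eq_zero h, mul_zero]
  have key := le_exp_mul_of_abs_deriv_le (K := 2 / X.2) hR (hasDerivAt_integral_wEta hV X)
    fun r hr => by
      have hr8 : |r| ≤ X.2 / 8 := by rw [abs_of_nonneg hr.1]; exact hr.2.trans hRt
      rw [integral_fderiv_wEta hV, integral_lapl_wZeta (a := a) hV ht hr8 (fun Z hZ => hpde _ (by
        rw [add_sub_cancel_left, nsq_smul]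
        have := nsq_nonneg Z
        have : r ^ 2 ≤ R ^ 2 := pow_le_pow_left₀ hr.1 hr.2 2
        nlinarith [sq_nonneg r])), ← integral_const_mul]
      rw [← Real.norm_eq_abs]
      refine norm_integral_le_of_norm_le ((hint r).const_mul _) (Eventually.of_forall fun Z => ?_)
      rcases le_or_gt 1 (nsq Z) with h | h
      · simp [wEta_eq_zero h, wZeta_eq_zero h]
      have hs : |Z.2| ≤ 1 := abs_snd_le_of_nsq_le zero_le_one (by linarith)
      have h1 : |r * Z.2| ≤ X.2 / 8 * 1 := by
        rw [abs_mul]; exact mul_le_mul hr8 hs (abs_nonneg _) (by positivity)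
      have h2 : 7 / 8 * X.2 ≤ X.2 + r * Z.2 := by linarith [neg_abs_le (r * Z.2)]
      have h3 : 0 < X.2 + r * Z.2 := by linarith
      have h4 : X.2 * (X.2 + r * Z.2)⁻¹ ≤ 8 / 7 := by
        rw [← div_eq_mul_inv, div_le_iff₀ h3]; linarith
      have := weight_bound (wEta_nonneg Z) (wZeta_nonneg Z) (wZeta_le Z) hs ht hr8
        (inv_nonneg.2 h3.le) h4
      rw [norm_mul, norm_mul, Real.norm_eq_abs, Real.norm_eq_abs, Real.norm_eq_abs,
        abs_of_nonneg (h0 _)]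
      calc _ ≤ 1 * (2 / X.2 * wEta Z) * V (X + r • Z) :=
            mul_le_mul_of_nonneg_right (mul_le_mul ha this (abs_nonneg _) zero_le_one) (h0 _)
        _ = _ := by ring
  have he : Real.exp (2 / X.2 * R) ≤ 2 := by
    have h1 : 2 / X.2 * R ≤ 1 / 2 := by
      rw [div_mul_eq_mul_div, div_le_iff₀ ht]; linarith
    have h2 : Real.exp (1 / 2) ^ 2 ≤ 2 ^ 2 := by
      rw [← Real.exp_nat_mul]
      have := Real.exp_one_lt_d9
      norm_num; linarith
    exact (Real.exp_le_exp.2 h1).trans (abs_le_of_sq_le_sq' h2 (by norm_num)).2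
  have hzero : ∫ Z, V (X + (0 : ℝ) • Z) * wEta Z = V X * ∫ Z : Pt n, wEta Z := by
    simp [integral_const_mul]
  have p1 : 0 ≤ ∫ Z, V (X + R • Z) * wEta Z :=
    integral_nonneg fun Z => mul_nonneg (h0 _) (wEta_nonneg Z)
  have p2 : 0 ≤ V X * ∫ Z : Pt n, wEta Z :=
    mul_nonneg (h0 _) (integral_nonneg fun Z => wEta_nonneg Z)
  simp only [hzero] at key
  exact ⟨key.1.trans (mul_le_mul_of_nonneg_right he p1),
    key.2.trans (mul_le_mul_of_nonneg_right he p2)⟩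

theorem integral_wEta_shift_le {V : Pt n → ℝ} (hc : Continuous V) (h0 : ∀ Y, 0 ≤ V Y) {X Y : Pt n}
    {ρ : ℝ} (hρ : 0 < ρ) (hXY : nsq (Y - X) ≤ ρ ^ 2) :
    ∫ Z, V (X + ρ • Z) * wEta Z ≤
      3 ^ Module.finrank ℝ (Pt n) * (4 * ∫ Z, V (Y + (3 * ρ) • Z) * wEta Z) := by
  have := isAddHaarMeasure_volume_pt (n := n)
  set b : Pt n := ρ⁻¹ • (Y - X) with hb
  have hbn : nsq b ≤ 1 := by
    rw [hb, nsq_smul, inv_pow, inv_mul_le_iff₀ (by positivity)]; linarith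
  set g : Pt n → ℝ := fun Z => V (X + ρ • Z) * wEta Z with hg
  have e1 : ∫ Z, g Z = 3 ^ Module.finrank ℝ (Pt n) * ∫ Z, g ((3 : ℝ) • Z + b) := by
    have h1 := Measure.integral_comp_smul (volume : Measure (Pt n)) (fun Z => g (Z + b)) 3
    rw [integral_add_right_eq_self g b] at h1
    rw [h1, smul_eq_mul, abs_of_nonneg (by positivity), ← mul_assoc, mul_inv_cancel₀ (by positivity),
      one_mul]
  rw [e1]
  refine mul_le_mul_of_nonneg_left ?_ (by positivity)
  rw [← integral_const_mul]
  have e2 : ∀ Z, g ((3 : ℝ) • Z + b) = V (Y + (3 * ρ) • Z) * wEta ((3 : ℝ) • Z + b) := fun Z => by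
    simp only [hg]
    congr 2
    rw [smul_add, hb, smul_smul, smul_smul, mul_inv_cancel₀ hρ.ne', one_smul, mul_comm ρ 3]
    abel
  simp only [e2]
  have hzero : ∀ Z : Pt n, 1 ≤ nsq Z → wEta ((3 : ℝ) • Z + b) = 0 := fun Z hZ => wEta_eq_zero (by
    have h1 := nsq_sub_le ((3 : ℝ) • Z + b) b
    rw [add_sub_cancel_right, nsq_smul] at h1
    linarith)
  refine integral_mono (integrable_of_nsq (by fun_prop) fun Z h => by rw [hzero Z h, mul_zero])
    ((integrable_of_nsq (by fun_prop) fun Z h => by rw [wEta_eq_zero h, mul_zero]).const_mul _)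
    fun Z => ?_
  have hle : wEta ((3 : ℝ) • Z + b) ≤ 4 * wEta Z := by
    rcases le_or_gt 1 (nsq ((3 : ℝ) • Z + b)) with h | h
    · rw [wEta_eq_zero h]; have := wEta_nonneg Z; positivity
    · have h1 := nsq_sub_le ((3 : ℝ) • Z + b) b
      rw [add_sub_cancel_right, nsq_smul] at h1
      have h2 : (5 / 9 : ℝ) ≤ max (1 - nsq Z) 0 := le_max_of_le_left (by linarith)
      have h3 := wEta_le_one ((3 : ℝ) • Z + b)
      have h4 : (5 / 9 : ℝ) ^ 2 ≤ wEta Z := pow_le_pow_left₀ (by norm_num) h2 2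
      linarith
  calc _ ≤ V (Y + (3 * ρ) • Z) * (4 * wEta Z) := mul_le_mul_of_nonneg_left hle (h0 _)
    _ = _ := by ring

end InteriorHarnack

section Chain

variable {n : ℕ} {σ : ℝ} {U : Pt n → ℝ}

/-- The constant of the interior Harnack inequality on small balls. -/
def harnackConst (n : ℕ) : ℝ := 16 * 3 ^ Module.finrank ℝ (Pt n)

theorem one_le_harnackConst (n : ℕ) : 1 ≤ harnackConst n := by
  have : (1 : ℝ) ≤ 3 ^ Module.finrank ℝ (Pt n) := one_le_pow₀ (by norm_num)
  unfold harnackConst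
  linarith

theorem integral_wEta_pos : 0 < ∫ Z : Pt n, wEta Z := by
  have := isAddHaarMeasure_volume_pt (n := n)
  refine continuous_wEta.integral_pos_of_hasCompactSupport_nonneg_nonzero
    (hasCompactSupport_of_nsq fun Z h => wEta_eq_zero h) wEta_nonneg (x := 0) ?_
  simp [wEta, nsq]

theorem nsq_lt_four_of_near {X Y : Pt n} (hX : ‖X‖ ≤ 1) (h : ‖Y - X‖ ≤ 1 / 4) : nsq Y < 4 := by
  have h1 : ‖Y‖ ≤ 5 / 4 := by
    have := norm_add_le (Y - X) X
    rw [sub_add_cancel] at this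
    linarith
  have h2 : ‖Y‖ ^ 2 ≤ (5 / 4) ^ 2 := pow_le_pow_left₀ (norm_nonneg _) h1 2
  have := nsq_le_norm_sq Y
  linarith

theorem Sol.harnack_step (hU : Sol n σ U) {X Y : Pt n} (hX : ‖X‖ ≤ 1) (ht : 0 < X.2)
    (hXY : ‖Y - X‖ ≤ X.2 / 80) : U X ≤ harnackConst n * U Y := by
  set t := X.2 with htdef
  have ht1 : t ≤ 1 := (le_abs_self t).trans ((norm_snd_le X).trans hX)
  have hσ := hU.pos
  have hσ' := hU.lt_one
  have hdom : ∀ W : Pt n, ‖W - X‖ ≤ t / 4 → nsq W < 4 ∧ 0 < W.2 := fun W hW => by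
    refine ⟨nsq_lt_four_of_near hX (by linarith), ?_⟩
    have := (norm_snd_le (W - X)).trans hW
    rw [Prod.snd_sub, Real.norm_eq_abs, abs_le] at this
    linarith [this.1]
  let f : ContDiffBump X := ⟨t / 8, t / 4, by positivity, by linarith⟩
  set V : Pt n → ℝ := fun Y => f Y * U Y with hVdef
  have hV : ContDiff ℝ 2 V := by
    refine contDiff_iff_contDiffAt.2 fun W => ?_
    rcases le_or_gt (‖W - X‖) (t / 4) with h | h
    · exact f.contDiff.contDiffAt.mul (hU.contDiffAt W (hdom W h).1 (hdom W h).2)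
    · have h1 : V =ᶠ[𝓝 W] fun _ => 0 := by
        have ho : IsOpen {W : Pt n | t / 4 < ‖W - X‖} :=
          isOpen_lt continuous_const (by fun_prop)
        filter_upwards [ho.mem_nhds h] with Z hZ
        have : f Z = 0 := f.zero_of_le_dist (by rw [dist_eq_norm]; exact le_of_lt hZ)
        simp [hVdef, this]
      exact contDiffAt_const.congr_of_eventuallyEq h1
  have h0 : ∀ W, 0 ≤ V W := fun W => by
    rcases le_or_gt (‖W - X‖) (t / 4) with h | h
    · have hW := hdom W h
      exact mul_nonneg f.nonneg (hU.nonneg W hW.1.le hW.2.le fun h => by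
        rw [h] at hW; exact lt_irrefl _ hW.2)
    · have : f W = 0 := f.zero_of_le_dist (by rw [dist_eq_norm]; exact h.le)
      simp [hVdef, this]
  have hVU : ∀ W, ‖W - X‖ < t / 8 → V =ᶠ[𝓝 W] U := fun W hW => by
    filter_upwards [f.eventuallyEq_one_of_mem_ball (by
      rw [Metric.mem_ball, dist_eq_norm]; exact hW)] with Z hZ
    simp [hVdef, hZ]
  have hpde : ∀ W, ‖W - X‖ < t / 8 → lapl V W + (1 - 2 * σ) / W.2 * dt V W = 0 := fun W hW => by
    have h1 := hVU W hW
    have h2 : ∀ v, d2 V W v = d2 U W v := fun v => by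
      unfold d2
      have : (fun Y => fderiv ℝ V Y v) =ᶠ[𝓝 W] fun Y => fderiv ℝ U Y v :=
        h1.fderiv.mono fun Y hY => congrArg (fun L : Pt n →L[ℝ] ℝ => L v) hY
      exact congrArg (fun L : Pt n →L[ℝ] ℝ => L v) this.fderiv_eq
    have h3 : lapl V W = lapl U W := by simp only [lapl, h2]
    have h4 : dt V W = dt U W := by unfold dt; rw [h1.fderiv_eq]
    obtain ⟨h5, h6⟩ := hdom W (by linarith)
    rw [h3, h4, hU.pde W h5 h6]
  set ρ := t / 40 with hρ
  have hρ0 : 0 < ρ := by positivity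
  have hYX : nsq (Y - X) ≤ ρ ^ 2 := by
    have h1 := nsq_le_norm_sq (Y - X)
    have h2 : ‖Y - X‖ ^ 2 ≤ (t / 80) ^ 2 := pow_le_pow_left₀ (norm_nonneg _) hXY 2
    rw [hρ]; nlinarith
  have hY2 : 39 / 40 * t ≤ Y.2 := by
    have := abs_snd_le_of_nsq_le hρ0.le hYX
    rw [Prod.snd_sub, abs_le] at this
    rw [hρ, ← htdef] at this
    linarith [this.1]
  have ha : |1 - 2 * σ| ≤ 1 := abs_le.2 ⟨by linarith, by linarith⟩
  have b1 := (mean_value_bounds ha hV (X := X) hρ0.le ht (by rw [hρ]; linarith) h0 fun W hW =>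
    hpde W ((norm_le_of_nsq_le hρ0.le hW).trans_lt (by rw [hρ]; linarith))).1
  have b2 := (mean_value_bounds ha hV (X := Y) (R := 3 * ρ) (by positivity) (by linarith)
    (by rw [hρ]; linarith) h0 fun W hW => hpde W (by
      have h1 := nsq_add_le (W - Y) (Y - X)
      rw [sub_add_sub_cancel] at h1
      have h2 := norm_le_of_nsq_le (Z := W - X) (r := 9 / 2 * ρ) (by positivity) (by nlinarith)
      refine h2.trans_lt ?_
      rw [hρ]; linarith)).2
  have b3 := integral_wEta_shift_le hV.continuous h0 hρ0 hYX
  have hX' : V X = U X := (hVU X (by simp; positivity)).eq_of_nhds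
  have hY' : V Y = U Y := (hVU Y (by linarith)).eq_of_nhds
  rw [hX'] at b1
  rw [hY'] at b2
  have hI := integral_wEta_pos (n := n)
  refine le_of_mul_le_mul_right ?_ hI
  have hT : (0 : ℝ) < 3 ^ Module.finrank ℝ (Pt n) := by positivity
  unfold harnackConst
  set T : ℝ := 3 ^ Module.finrank ℝ (Pt n)
  set I := ∫ Z : Pt n, wEta Z
  calc U X * I ≤ _ := b1
    _ ≤ 2 * (T * (4 * (2 * (U Y * I)))) := by gcongr; exact b3.trans (by gcongr)
    _ = _ := by ring

theorem Sol.chain (hU : Sol n σ U) (D : ℝ) : ∃ C : ℝ, 1 ≤ C ∧ ∀ h : ℝ, 0 < h → ∀ X Y : Pt n,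
    ‖X‖ ≤ 1 → ‖Y‖ ≤ 1 → h ≤ X.2 → h ≤ Y.2 → ‖Y - X‖ ≤ D * h → U X ≤ C * U Y := by
  obtain ⟨N, hN⟩ := exists_nat_gt (max (80 * D) 0)
  have hN0 : (0 : ℝ) < N := (le_max_right _ _).trans_lt hN
  have hND : 80 * D ≤ N := (le_max_left _ _).trans hN.le
  refine ⟨harnackConst n ^ N, one_le_pow₀ (one_le_harnackConst n), ?_⟩
  intro h hh X Y hX hY hXh hYh hXY
  have hseg : ∀ k : ℕ, k ≤ N → ‖X + ((k : ℝ) / N) • (Y - X)‖ ≤ 1 ∧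
      h ≤ (X + ((k : ℝ) / N) • (Y - X)).2 := fun k hk => by
    have h0 : 0 ≤ (k : ℝ) / N := by positivity
    have h1 : (k : ℝ) / N ≤ 1 := div_le_one_of_le₀ (by exact_mod_cast hk) hN0.le
    constructor
    · have := (convex_closedBall (0 : Pt n) 1).add_smul_sub_mem (x := X) (y := Y)
        (by simpa using hX) (by simpa using hY) ⟨h0, h1⟩
      simpa using this
    · simp only [Prod.snd_add, Prod.smul_snd, Prod.snd_sub, smul_eq_mul]
      nlinarith
  have key : ∀ k : ℕ, k ≤ N → U X ≤ harnackConst n ^ k * U (X + ((k : ℝ) / N) • (Y - X)) := by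
    intro k
    induction k with
    | zero => intro _; simp
    | succ k ih =>
      intro hk
      obtain ⟨h1, h2⟩ := hseg k (by omega)
      refine (ih (by omega)).trans ?_
      rw [pow_succ, mul_assoc]
      refine mul_le_mul_of_nonneg_left (hU.harnack_step h1 (hh.trans_le h2) ?_)
        (pow_nonneg (zero_le_one.trans (one_le_harnackConst n)) _)
      have e : X + (((k + 1 : ℕ) : ℝ) / N) • (Y - X) - (X + ((k : ℝ) / N) • (Y - X)) =
          (N : ℝ)⁻¹ • (Y - X) := by
        push_cast
        rw [add_sub_add_left_eq_sub, ← sub_smul]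
        congr 1
        field_simp
        ring
      rw [e, norm_smul, Real.norm_eq_abs, abs_of_pos (by positivity), inv_mul_le_iff₀ hN0]
      have h3 : N * (h / 80) ≤ N * ((X + ((k : ℝ) / N) • (Y - X)).2 / 80) :=
        mul_le_mul_of_nonneg_left (by linarith) hN0.le
      have h4 : 80 * D * h ≤ N * h := mul_le_mul_of_nonneg_right hND hh.le
      linarith
  have := key N le_rfl
  rwa [div_self hN0.ne', one_smul, add_sub_cancel] at this

end Chain

/-! ### Barriers on cylinders -/

section Barriers

variable {n : ℕ} {σ : ℝ} {U : Pt n → ℝ} {x₀ : EuclideanSpace ℝ (Fin n)} {ρ t₀ h m : ℝ}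

theorem Sol.continuousOn_of_subset (hU : Sol n σ U) {K : Set (Pt n)}
    (hK : ∀ Y ∈ K, nsq Y < 4 ∧ 0 ≤ Y.2 ∧ Y ≠ 0) : ContinuousOn U K :=
  hU.cont.mono fun Y hY => ⟨(hK Y hY).1.le, (hK Y hY).2⟩

/-- Comparison with an explicit solution on the cylinder `|x - x₀| ≤ ρ`, `t₀ ≤ t ≤ h`. -/
theorem Sol.compare (hU : Sol n σ U) (ht₀ : 0 ≤ t₀) (ht₀h : t₀ < h) (hh : h ≤ 1)
    (hdom : ∀ Y : Pt n, ‖Y.1 - x₀‖ ≤ ρ → 0 ≤ Y.2 → Y.2 ≤ h → nsq Y < 4 ∧ Y.1 ≠ 0)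
    {A₀ A₁ A₂ A₃ : ℝ} (hA : A₁ * (2 * n) + A₃ * (2 * (2 - 2 * σ)) = 0)
    (hlat : ∀ Y : Pt n, ‖Y.1 - x₀‖ = ρ → t₀ ≤ Y.2 → Y.2 ≤ h →
      A₀ + A₁ * ρ ^ 2 + A₂ * Y.2 ^ (2 * σ) + A₃ * Y.2 ^ 2 ≤ U Y)
    (htop : ∀ x, ‖x - x₀‖ ≤ ρ →
      A₀ + A₁ * ‖x - x₀‖ ^ 2 + A₂ * h ^ (2 * σ) + A₃ * h ^ 2 ≤ U (x, h))
    (hbot : ∀ x, ‖x - x₀‖ ≤ ρ →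
      A₀ + A₁ * ‖x - x₀‖ ^ 2 + A₂ * t₀ ^ (2 * σ) + A₃ * t₀ ^ 2 ≤ U (x, t₀) ∨
        (t₀ = 0 ∧ -bdry σ U x ≤ A₂)) :
    ∀ Y : Pt n, ‖Y.1 - x₀‖ ≤ ρ → t₀ ≤ Y.2 → Y.2 ≤ h →
      A₀ + A₁ * ‖Y.1 - x₀‖ ^ 2 + A₂ * Y.2 ^ (2 * σ) + A₃ * Y.2 ^ 2 ≤ U Y := by
  have hσ := hU.pos
  have hσ' := hU.lt_one
  set φ : Pt n → ℝ := fun Y =>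
    A₀ + A₁ * ‖Y.1 - x₀‖ ^ 2 + A₂ * Y.2 ^ (2 * σ) + A₃ * Y.2 ^ 2 with hφ
  have hφc : Continuous φ := by
    have h1 : Continuous fun Y : Pt n => Y.2 ^ (2 * σ) :=
      continuous_snd.rpow_const fun _ => Or.inr (by positivity)
    fun_prop
  set K : Set (Pt n) := Metric.closedBall x₀ ρ ×ˢ Set.Icc t₀ h with hK
  have hKc : IsCompact K := (isCompact_closedBall _ _).prod isCompact_Icc
  have hmem : ∀ Y : Pt n, Y ∈ K ↔ ‖Y.1 - x₀‖ ≤ ρ ∧ t₀ ≤ Y.2 ∧ Y.2 ≤ h := fun Y => by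
    rw [hK, Set.mem_prod, mem_closedBall_iff_norm, Set.mem_Icc]
  have hUc : ContinuousOn U K := hU.continuousOn_of_subset fun Y hY => by
    obtain ⟨h1, h2, h3⟩ := (hmem Y).1 hY
    obtain ⟨h4, h5⟩ := hdom Y h1 (ht₀.trans h2) h3
    exact ⟨h4, ht₀.trans h2, fun h => h5 (by rw [h]; rfl)⟩
  have key := max_principle_simple (W := fun Y => U Y - φ Y) hσ hσ' rfl hKc
    (fun Y hY => ⟨ht₀.trans ((hmem Y).1 hY).2.1, ((hmem Y).1 hY).2.2.trans hh⟩)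
    (hUc.sub hφc.continuousOn) fun Y hY hneg => by
      obtain ⟨h1, h2, h3⟩ := (hmem Y).1 hY
      obtain ⟨h4, h5⟩ := hdom Y h1 (ht₀.trans h2) h3
      have e1 : ‖Y.1 - x₀‖ < ρ := lt_of_le_of_ne h1 fun he => by
        have := hlat Y he h2 h3
        rw [← he] at this
        linarith
      have e2 : Y.2 < h := lt_of_le_of_ne h3 fun he => by
        have := htop Y.1 h1
        rw [← he] at this
        linarith
      rcases h2.lt_or_eq with h2 | h2
      · left
        have ht : 0 < Y.2 := ht₀.trans_lt h2
        refine ⟨prod_mem_nhds (Metric.closedBall_mem_nhds_of_mem (by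
          rwa [Metric.mem_ball, dist_eq_norm])) (Icc_mem_nhds h2 e2), ht, 0, ?_, le_rfl⟩
        have hop := (((HasOp.const (1 - 2 * σ) Y A₀).add
          ((hasOp_norm_sq (a := 1 - 2 * σ) (X := Y) x₀).const_mul A₁)).add
          ((hasOp_snd_rpow (σ := σ) ht rfl).const_mul A₂)).add ((hasOp_snd_sq ht).const_mul A₃)
        have := (hU.hasOp h4 ht).sub hop
        convert this using 1
        linear_combination hA
      · right
        rcases hbot Y.1 h1 with h6 | ⟨h6, h7⟩
        · rw [h2] at h6
          linarith
        · have hY0 : Y.2 = 0 := by rw [← h2, h6]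
          refine ⟨hY0, ?_, -bdry σ U Y.1 - A₂, ?_, by linarith⟩
          · have : ∀ᶠ t in 𝓝[>] (0 : ℝ), t < h :=
              mem_nhdsWithin_of_mem_nhds (gt_mem_nhds (ht₀.trans_lt ht₀h))
            filter_upwards [this, self_mem_nhdsWithin] with t ht ht' using
              (hmem (Y.1, t)).2 ⟨h1, by rw [h6]; exact le_of_lt ht', ht.le⟩
          · have f1 := hU.vflux Y.1 (norm_fst_lt_two h4) h5
            have f2 := (((VFlux.const (σ := σ) (x := Y.1) A₀).add
              ((vflux_fst fun x => ‖x - x₀‖ ^ 2).const_mul A₁)).add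
              ((vflux_snd_rpow hσ).const_mul A₂)).add ((vflux_snd_sq hσ').const_mul A₃)
            have := f1.sub f2
            convert this using 1
            ring
  intro Y h1 h2 h3
  have := key Y ((hmem Y).2 ⟨h1, h2, h3⟩)
  linarith

theorem Sol.down_barrier (hU : Sol n σ U) (hρ : 0 < ρ) (hρ1 : ρ ≤ 1) (hm : 0 ≤ m)
    (hh : h = (1 - σ) / n * ρ)
    (hdom : ∀ Y : Pt n, ‖Y.1 - x₀‖ ≤ ρ → 0 ≤ Y.2 → Y.2 ≤ h → nsq Y < 4 ∧ Y.1 ≠ 0)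
    (htop : ∀ x, ‖x - x₀‖ ≤ ρ → m ≤ U (x, h)) :
    ∀ t, 0 ≤ t → t ≤ h → m / 2 ≤ U (x₀, t) := by
  have hσ := hU.pos
  have hσ' := hU.lt_one
  have hn : (2 : ℝ) ≤ n := by exact_mod_cast hU.two_le
  have hs : 0 < 1 - σ := by linarith
  have hs' : 2 - 2 * σ = 2 * (1 - σ) := by ring
  have hh0 : 0 < h := by rw [hh]; positivity
  have hh1 : h ≤ 1 := by
    rw [hh]
    have : (1 - σ) / n ≤ 1 := by rw [div_le_one (by positivity)]; linarith
    nlinarith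
  set B := n / ((2 - 2 * σ) * ρ ^ 2) with hB
  have hB0 : 0 < B := by rw [hB, hs']; positivity
  have hBh : B * h ^ 2 ≤ 1 / 4 := by
    have : B * h ^ 2 = (1 - σ) / (2 * n) := by rw [hB, hh, hs']; field_simp
    rw [this, div_le_div_iff₀ (by positivity) (by norm_num)]
    linarith
  have hBt : ∀ t, 0 ≤ t → t ≤ h → B * t ^ 2 ≤ 1 / 4 := fun t h1 h2 =>
    (mul_le_mul_of_nonneg_left (pow_le_pow_left₀ h1 h2 2) hB0.le).trans hBh
  have key := hU.compare le_rfl hh0 hh1 hdom (A₀ := m / 2) (A₁ := -(m / ρ ^ 2)) (A₂ := 0)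
    (A₃ := m * B) (by rw [hB, hs']; field_simp; ring)
    (fun Y h1 h2 h3 => by
      have h4 := hBt Y.2 h2 h3
      obtain ⟨h5, h6⟩ := hdom Y h1.le h2 h3
      refine le_trans ?_ (hU.nonneg Y h5.le h2 fun h => h6 (by rw [h]; rfl))
      have : -(m / ρ ^ 2) * ρ ^ 2 = -m := by field_simp
      rw [this]
      nlinarith)
    (fun x h1 => by
      refine le_trans ?_ (htop x h1)
      have : 0 ≤ m / ρ ^ 2 * ‖x - x₀‖ ^ 2 := by positivity
      nlinarith)
    (fun x h1 => Or.inr ⟨rfl, by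
      rw [neg_nonpos]
      obtain ⟨h5, h6⟩ := hdom (x, 0) h1 le_rfl hh0.le
      have := hU.nonneg (x, 0) h5.le le_rfl fun h => h6 (by rw [h]; rfl)
      unfold bdry
      positivity⟩)
  intro t h1 h2
  have := key (x₀, t) (by simp [hρ.le]) h1 h2
  simp only [sub_self, norm_zero] at this
  refine le_trans ?_ this
  have : 0 ≤ m * B * t ^ 2 := by positivity
  linarith

/-- Comparison from below by a solution which is positive on the bottom of a cylinder. -/
theorem Sol.up_barrier (hU : Sol n σ U) (hρ1 : ρ ≤ 1) (hm : 0 ≤ m) (ht₀ : 0 ≤ t₀)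
    (ht₀ρ : t₀ < ρ)
    (hdom : ∀ Y : Pt n, ‖Y.1 - x₀‖ ≤ ρ → 0 ≤ Y.2 → Y.2 ≤ ρ → nsq Y < 4 ∧ Y.1 ≠ 0)
    (hbot : ∀ x, ‖x - x₀‖ ≤ ρ → m ≤ U (x, t₀) ∨
      (t₀ = 0 ∧ m * (1 + n / (2 - 2 * σ)) / ρ ^ (2 * σ) ≤ bdry σ U x)) :
    ∀ t, t₀ ≤ t → t ≤ ρ → m * (1 - (1 + n / (2 - 2 * σ)) * (t / ρ) ^ (2 * σ)) ≤ U (x₀, t) := by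
  have hσ := hU.pos
  have hσ' := hU.lt_one
  have hρ : 0 < ρ := ht₀.trans_lt ht₀ρ
  have hs : 0 < 2 - 2 * σ := by linarith
  set b := n / (2 - 2 * σ) with hb
  have hb0 : 0 ≤ b := by positivity
  have hρσ : 0 < ρ ^ (2 * σ) := Real.rpow_pos_of_pos hρ _
  have hval : ∀ t, 0 ≤ t → -(m * (1 + b) / ρ ^ (2 * σ)) * t ^ (2 * σ) + m * b / ρ ^ 2 * t ^ 2 =
      m * (b * (t / ρ) ^ 2 - (1 + b) * (t / ρ) ^ (2 * σ)) := fun t h1 => by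
    rw [Real.div_rpow h1 hρ.le]
    field_simp
    ring
  have hle : ∀ t, 0 ≤ t → t ≤ ρ → b * (t / ρ) ^ 2 - (1 + b) * (t / ρ) ^ (2 * σ) ≤ 0 :=
    fun t h1 h2 => by
      have h3 : 0 ≤ t / ρ := by positivity
      have h4 : t / ρ ≤ 1 := div_le_one_of_le₀ h2 hρ.le
      have h5 : (t / ρ) ^ 2 ≤ (t / ρ) ^ (2 * σ) := by
        rcases h3.lt_or_eq with h6 | h6
        · rw [← Real.rpow_two]
          exact Real.rpow_le_rpow_of_exponent_ge h6 h4 (by linarith)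
        · rw [← h6, Real.zero_rpow (by positivity)]; simp
      have h6 : 0 ≤ (t / ρ) ^ (2 * σ) := Real.rpow_nonneg h3 _
      nlinarith
  have hU0 : ∀ Y : Pt n, ‖Y.1 - x₀‖ ≤ ρ → 0 ≤ Y.2 → Y.2 ≤ ρ → 0 ≤ U Y := fun Y h1 h2 h3 => by
    obtain ⟨h5, h6⟩ := hdom Y h1 h2 h3
    exact hU.nonneg Y h5.le h2 fun h => h6 (by rw [h]; rfl)
  have key := hU.compare ht₀ ht₀ρ hρ1 hdom (A₀ := m) (A₁ := -(m / ρ ^ 2))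
    (A₂ := -(m * (1 + b) / ρ ^ (2 * σ))) (A₃ := m * b / ρ ^ 2)
    (by
      have : (2 - 2 * σ) ≠ 0 := hs.ne'
      rw [hb]
      generalize 2 - 2 * σ = s at this
      field_simp
      ring)
    (fun Y h1 h2 h3 => by
      refine le_trans ?_ (hU0 Y h1.le (ht₀.trans h2) h3)
      have : -(m / ρ ^ 2) * ρ ^ 2 = -m := by field_simp
      rw [this, add_neg_cancel, zero_add, hval _ (ht₀.trans h2)]
      exact mul_nonpos_of_nonneg_of_nonpos hm (hle _ (ht₀.trans h2) h3))
    (fun x h1 => by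
      refine le_trans ?_ (hU0 (x, ρ) h1 hρ.le le_rfl)
      have : 0 ≤ m / ρ ^ 2 * ‖x - x₀‖ ^ 2 := by positivity
      rw [add_assoc, hval ρ hρ.le, div_self hρ.ne']
      simp only [Real.one_rpow]
      linarith)
    (fun x h1 => by
      rcases hbot x h1 with h2 | ⟨h2, h3⟩
      · left
        refine le_trans ?_ h2
        have : 0 ≤ m / ρ ^ 2 * ‖x - x₀‖ ^ 2 := by positivity
        rw [add_assoc, hval t₀ ht₀]
        have := mul_nonpos_of_nonneg_of_nonpos hm (hle t₀ ht₀ ht₀ρ.le)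
        linarith
      · exact Or.inr ⟨h2, neg_le_neg h3⟩)
  intro t h1 h2
  have h3 := ht₀.trans h1
  have := key (x₀, t) (by simp [hρ.le]) h1 h2
  simp only [sub_self, norm_zero] at this
  rw [add_assoc, hval t h3] at this
  refine le_trans ?_ this
  have : 0 ≤ m * (b * (t / ρ) ^ 2) := by positivity
  linarith

end Barriers

/-! ### The punctured half-ball -/

section Punctured

variable {n : ℕ} {σ : ℝ} {U : Pt n → ℝ}

theorem hasOp_fundamental {q a l : ℝ} {X : Pt n} (c : EuclideanSpace ℝ (Fin n))
    (hq : q = n - 1 + a) (hl : 0 < l) (ht : 0 < X.2) :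
    HasOp a (fun Y => (l / nsq (Y - ((c, 0) : Pt n))) ^ (q / 2)) X 0 := by
  have hN : 0 < nsq (X - ((c, 0) : Pt n)) := nsq_pos.2 fun h => ht.ne' (by
    simpa using congrArg Prod.snd h)
  have := hasOp_kelvin (U := fun _ => (1 : ℝ)) hq hl ht hN contDiffAt_const (by
    simp [lapl, d2, dt])
  unfold kel at this
  simpa using this

theorem vflux_fundamental {q l : ℝ} {c x : EuclideanSpace ℝ (Fin n)} (hσ : σ < 1) (hl : 0 < l)
    (hx : x ≠ c) : VFlux σ (fun Y => (l / nsq (Y - ((c, 0) : Pt n))) ^ (q / 2)) x 0 := by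
  have hN : 0 < ‖x - c‖ := norm_pos_iff.2 (sub_ne_zero.2 hx)
  have h1 : HasDerivAt (fun z : ℝ => l / (‖x - c‖ ^ 2 + z)) (l * (-1 / (‖x - c‖ ^ 2) ^ 2)) 0 := by
    have h := ((hasDerivAt_id (0 : ℝ)).const_add (‖x - c‖ ^ 2)).inv (by
      have : 0 < ‖x - c‖ ^ 2 := by positivity
      simpa using hN.ne')
    simpa [div_eq_mul_inv] using h.const_mul l
  refine vflux_of_sq hσ (h1.rpow_const (p := q / 2) (Or.inl ?_)) fun t => by simp [nsq]
  have : 0 < l / (‖x - c‖ ^ 2 + 0) := by positivity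
  exact this.ne'

theorem continuousOn_fundamental {q l : ℝ} (c : EuclideanSpace ℝ (Fin n)) (hq : 0 ≤ q) :
    ContinuousOn (fun Y => (l / nsq (Y - ((c, 0) : Pt n))) ^ (q / 2)) {Y | Y ≠ (c, 0)} := by
  have h1 : Continuous fun Y : Pt n => nsq (Y - ((c, 0) : Pt n)) := by fun_prop
  refine ContinuousOn.rpow_const (continuousOn_const.div h1.continuousOn fun Y hY => ?_)
    fun _ _ => Or.inr (by positivity)
  exact (nsq_pos.2 (sub_ne_zero.2 hY)).ne'

theorem isCompact_nsq_le {K : Set (Pt n)} (hK : IsClosed K) {r : ℝ} (h : ∀ X ∈ K, nsq X ≤ r) :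
    IsCompact K := by
  refine (isCompact_closedBall (0 : Pt n) (max r 1)).of_isClosed_subset hK fun X hX => ?_
  rw [mem_closedBall_zero_iff]
  refine norm_le_of_nsq_le (by positivity) ((h X hX).trans ?_)
  nlinarith [le_max_left r 1, le_max_right r 1]

theorem eventually_vertical {p : Pt n → Prop} {x : EuclideanSpace ℝ (Fin n)}
    (h : ∀ᶠ Y in 𝓝 ((x, 0) : Pt n), p Y) : ∀ᶠ t in 𝓝[>] (0 : ℝ), p (x, t) := by
  have hc : Continuous fun t : ℝ => ((x, t) : Pt n) := by fun_prop
  exact mem_nhdsWithin_of_mem_nhds ((hc.tendsto 0).eventually h)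

/-- Maximum principle on a domain punctured at the origin, where `W` is bounded below. -/
theorem Sol.punctured_max_principle (hU : Sol n σ U) {W G : Pt n → ℝ} {B : ℝ} (hG : Continuous G)
    (hB : 0 ≤ B)
    (hW : ContinuousOn W {X | 0 ≤ X.2 ∧ X ≠ 0 ∧ nsq X ≤ 9 / 16 ∧ 0 ≤ G X})
    (hbelow : ∀ X, 0 ≤ X.2 → X ≠ 0 → nsq X ≤ 9 / 16 → 0 ≤ G X → -B ≤ W X)
    (hG0 : ∀ X, 0 ≤ X.2 → X ≠ 0 → nsq X ≤ 9 / 16 → G X = 0 → 0 ≤ W X)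
    (hout : ∀ X, 0 ≤ X.2 → X ≠ 0 → nsq X = 9 / 16 → 0 ≤ G X → 0 ≤ W X)
    (hop : ∀ X, 0 < X.2 → nsq X ≤ 9 / 16 → 0 ≤ G X → HasOp (1 - 2 * σ) W X 0)
    (hfl : ∀ x, x ≠ 0 → nsq ((x, 0) : Pt n) ≤ 9 / 16 → 0 < G (x, 0) → ∃ κ, VFlux σ W x κ ∧ κ ≤ 0) :
    ∀ X, 0 ≤ X.2 → X ≠ 0 → nsq X ≤ 9 / 16 → 0 ≤ G X → 0 ≤ W X := by
  have hσ := hU.pos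
  have hσ' := hU.lt_one
  set q := (n : ℝ) - 2 * σ with hq
  have hq0 : 0 < q := hU.q_pos
  intro X hX hX0 hX1 hXG
  have hXn : 0 < nsq X := nsq_pos.2 hX0
  have key : ∀ ε, 0 < ε → ε ≤ nsq X → -(B * (ε / nsq X) ^ (q / 2)) ≤ W X := fun ε hε hεX => by
    set K : Set (Pt n) := {Y | 0 ≤ Y.2 ∧ ε ≤ nsq Y ∧ nsq Y ≤ 9 / 16 ∧ 0 ≤ G Y} with hK
    have hKcl : IsClosed K :=
      (isClosed_le continuous_const continuous_snd).inter
        ((isClosed_le continuous_const continuous_nsq).inter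
          ((isClosed_le continuous_nsq continuous_const).inter
            (isClosed_le continuous_const hG)))
    have hKc : IsCompact K := isCompact_nsq_le hKcl fun Y hY => hY.2.2.1
    have hne : ∀ Y ∈ K, Y ≠ 0 := fun Y hY => nsq_pos.1 (hε.trans_le hY.2.1)
    set W' : Pt n → ℝ := fun Y => W Y + B * (ε / nsq (Y - ((0, 0) : Pt n))) ^ (q / 2) with hW'
    have hz : ∀ Y : Pt n, Y - ((0, 0) : Pt n) = Y := fun Y => sub_zero Y
    have hW'ge : ∀ Y ∈ K, W Y ≤ W' Y := fun Y hY => by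
      have : 0 ≤ (ε / nsq (Y - ((0, 0) : Pt n))) ^ (q / 2) :=
        Real.rpow_nonneg (div_nonneg hε.le (nsq_nonneg _)) _
      simp only [hW']
      nlinarith
    have := max_principle_simple (W := W') hσ hσ' rfl hKc
      (fun Y hY => ⟨hY.1, by
        have h1 := hY.2.2.1
        have h2 := abs_snd_le_of_nsq_le zero_le_one (by linarith : nsq Y ≤ 1 ^ 2)
        exact (le_abs_self _).trans h2⟩)
      ((hW.mono fun Y hY => ⟨hY.1, hne Y hY, hY.2.2.1, hY.2.2.2⟩).add
        (((continuousOn_fundamental 0 hq0.le).mono fun Y hY => hne Y hY).const_smul B))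
      fun Y hY hneg => by
        obtain ⟨h1, h2, h3, h4⟩ := hY
        have hY' : Y ∈ K := ⟨h1, h2, h3, h4⟩
        have hY0 := hne Y hY'
        have hWneg : W Y < 0 := (hW'ge Y hY').trans_lt hneg
        have e2 : ε < nsq Y := lt_of_le_of_ne h2 fun he => by
          have := hbelow Y h1 hY0 h3 h4
          simp only [hW', hz, ← he, div_self hε.ne', Real.one_rpow] at hneg
          linarith
        have e3 : nsq Y < 9 / 16 := lt_of_le_of_ne h3 fun he => by
          linarith [hout Y h1 hY0 he h4]
        have e4 : 0 < G Y := lt_of_le_of_ne h4 fun he => by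
          linarith [hG0 Y h1 hY0 h3 he.symm]
        have hnear : ∀ᶠ Z in 𝓝 Y, ε ≤ nsq Z ∧ nsq Z ≤ 9 / 16 ∧ 0 ≤ G Z := by
          filter_upwards [continuous_nsq.continuousAt.eventually (lt_mem_nhds e2),
            continuous_nsq.continuousAt.eventually (gt_mem_nhds e3),
            hG.continuousAt.eventually (lt_mem_nhds e4)] with Z a1 a2 a3 using
            ⟨a1.le, a2.le, a3.le⟩
        rcases h1.lt_or_eq with ht | ht
        · left
          refine ⟨?_, ht, 0, ?_, le_rfl⟩
          · filter_upwards [hnear, continuous_snd.continuousAt.eventually (lt_mem_nhds ht)] with Z a b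
              using ⟨b.le, a⟩
          · have := (hop Y ht h3 h4).add ((hasOp_fundamental (q := q) (a := 1 - 2 * σ) 0
              (by rw [hq]; ring) hε ht).const_mul B)
            simpa using this
        · right
          have hYx : Y = (Y.1, 0) := Prod.ext rfl ht.symm
          have hx0 : Y.1 ≠ 0 := fun h => hY0 (by rw [hYx, h]; rfl)
          refine ⟨ht.symm, ?_, ?_⟩
          · rw [hYx] at hnear
            filter_upwards [eventually_vertical hnear, self_mem_nhdsWithin] with t a b
            exact ⟨le_of_lt b, a⟩
          · obtain ⟨κ, k1, k2⟩ := hfl Y.1 hx0 (by rwa [← hYx]) (by rwa [← hYx])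
            refine ⟨κ, ?_, k2⟩
            have := k1.add ((vflux_fundamental (q := q) hσ' hε hx0).const_mul B)
            simpa using this
    have := this X ⟨hX, hεX, hX1, hXG⟩
    simp only [hW', hz] at this
    linarith
  have hlim : Tendsto (fun ε : ℝ => -(B * (ε / nsq X) ^ (q / 2))) (𝓝[>] 0) (𝓝 0) := by
    have hc : Continuous fun ε : ℝ => -(B * (ε / nsq X) ^ (q / 2)) := by
      have : Continuous fun ε : ℝ => (ε / nsq X) ^ (q / 2) :=
        (continuous_id.div_const _).rpow_const fun _ => Or.inr (by positivity)
      fun_prop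
    have := hc.tendsto 0
    rw [zero_div, Real.zero_rpow (by positivity), mul_zero, neg_zero] at this
    exact this.mono_left nhdsWithin_le_nhds
  refine le_of_tendsto hlim ?_
  filter_upwards [self_mem_nhdsWithin, mem_nhdsWithin_of_mem_nhds (ge_mem_nhds hXn)] with ε h1 h2
  exact key ε h1 h2

theorem Sol.bdry_nonneg (hU : Sol n σ U) {x : EuclideanSpace ℝ (Fin n)}
    (h : 0 ≤ U (x, 0)) : 0 ≤ bdry σ U x := by
  have := hU.pos
  unfold bdry
  positivity

/-- Unless it vanishes identically near the origin, a solution is bounded below. -/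
theorem Sol.exists_lower_bound (hU : Sol n σ U)
    (hpos : ∃ X : Pt n, ‖X‖ ≤ 1 ∧ 0 < X.2 ∧ U X ≠ 0) :
    ∃ m : ℝ, 0 < m ∧ ∀ X : Pt n, 0 ≤ X.2 → X ≠ 0 → nsq X ≤ 9 / 16 → m ≤ U X := by
  have hσ := hU.pos
  have hσ' := hU.lt_one
  have hn : (2 : ℝ) ≤ n := by exact_mod_cast hU.two_le
  have hdom : ∀ X : Pt n, ‖X‖ ≤ 1 → nsq X < 4 := fun X hX => by
    have := nsq_le_norm_sq X
    nlinarith [norm_nonneg X]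
  obtain ⟨X₁, hX₁, ht₁, hne⟩ := hpos
  have hX₁U : 0 < U X₁ := lt_of_le_of_ne (hU.nonneg X₁ (hdom X₁ hX₁).le ht₁.le
    fun h => by rw [h] at ht₁; exact lt_irrefl _ ht₁) (Ne.symm hne)
  have hint : ∀ X : Pt n, ‖X‖ ≤ 1 → 0 < X.2 → 0 < U X := fun X hX ht => by
    set h := min X.2 X₁.2 with hh
    have hh0 : 0 < h := lt_min ht ht₁
    obtain ⟨C, hC, hchain⟩ := hU.chain (2 / h)
    have h1 := hchain h hh0 X₁ X hX₁ hX (min_le_right _ _) (min_le_left _ _) (by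
      rw [div_mul_cancel₀ _ hh0.ne']
      exact (norm_sub_le _ _).trans (by linarith))
    by_contra! h2
    nlinarith
  have hflat : ∀ x : EuclideanSpace ℝ (Fin n), x ≠ 0 → ‖x‖ ≤ 3 / 4 → 0 < U (x, 0) := fun x hx hx1 => by
    have hxp : 0 < ‖x‖ := norm_pos_iff.2 hx
    set ρ := ‖x‖ / 4 with hρ
    have hρ0 : 0 < ρ := by positivity
    set h := (1 - σ) / n * ρ with hh
    have hs : 0 < (1 - σ) / n := div_pos (by linarith) (by positivity)
    have hs1 : (1 - σ) / n ≤ 1 := by rw [div_le_one (by positivity)]; linarith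
    have hh0 : 0 < h := by positivity
    have hhρ : h ≤ ρ := by rw [hh]; nlinarith
    have hball : ∀ y, ‖y - x‖ ≤ ρ → ‖y‖ ≤ 1 ∧ y ≠ 0 := fun y hy => by
      refine ⟨?_, fun h => ?_⟩
      · have := norm_add_le (y - x) x
        rw [sub_add_cancel] at this
        linarith
      · rw [h, zero_sub, norm_neg] at hy
        linarith
    have hdisc : ∀ y : EuclideanSpace ℝ (Fin n), ‖y - x‖ ≤ ρ → ∀ t, 0 ≤ t → t ≤ h →
        ‖((y, t) : Pt n)‖ ≤ 1 := fun y hy t h1 h2 =>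
      max_le (hball y hy).1 (by rw [Real.norm_eq_abs, abs_of_nonneg h1]; linarith)
    have hcd : ContinuousOn (fun y => U (y, h)) (Metric.closedBall x ρ) := by
      have hc : Continuous fun y : EuclideanSpace ℝ (Fin n) => ((y, h) : Pt n) := by fun_prop
      refine (hU.continuousOn_of_subset (K := {Y : Pt n | ‖Y.1 - x‖ ≤ ρ ∧ Y.2 = h}) ?_).comp
        hc.continuousOn fun y hy => ⟨by rwa [mem_closedBall_iff_norm] at hy, rfl⟩
      rintro ⟨y, t⟩ ⟨h1, h2⟩
      obtain rfl : t = h := h2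
      exact ⟨hdom _ (hdisc y h1 h hh0.le le_rfl), hh0.le, fun he => hh0.ne' (congrArg Prod.snd he)⟩
    obtain ⟨y, hy, hmin⟩ := (isCompact_closedBall x ρ).exists_isMinOn
      ⟨x, Metric.mem_closedBall_self hρ0.le⟩ hcd
    have hm : 0 < U (y, h) := hint _ (hdisc y (by rwa [mem_closedBall_iff_norm] at hy) h hh0.le le_rfl) hh0
    have := hU.down_barrier hρ0 (by linarith) hm.le rfl
      (fun Y h1 h2 h3 => ⟨hdom Y (hdisc Y.1 h1 Y.2 h2 h3), (hball Y.1 h1).2⟩)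
      (fun y' hy' => hmin (by rw [mem_closedBall_iff_norm]; exact hy')) 0 le_rfl hh0.le
    linarith
  have hall : ∀ X : Pt n, 0 ≤ X.2 → X ≠ 0 → nsq X ≤ 9 / 16 → 0 < U X := fun X h1 h2 h3 => by
    have h4 := norm_le_of_nsq_le (Z := X) (r := 3 / 4) (by norm_num) (by linarith)
    rcases h1.lt_or_eq with h | h
    · exact hint X (by linarith) h
    · have hXx : X = (X.1, 0) := Prod.ext rfl h.symm
      rw [hXx]
      exact hflat X.1 (fun h => h2 (by rw [hXx, h]; rfl)) ((norm_fst_le X).trans h4)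
  set S : Set (Pt n) := {X | 0 ≤ X.2 ∧ nsq X = 9 / 16} with hS
  have hS0 : ∀ X ∈ S, X ≠ 0 := fun X hX => nsq_pos.1 (by rw [hX.2]; norm_num)
  have hSc : IsCompact S := isCompact_nsq_le
    ((isClosed_le continuous_const continuous_snd).inter (isClosed_eq continuous_nsq continuous_const))
    fun X hX => hX.2.le
  have hSne : S.Nonempty := ⟨(0, 3 / 4), by norm_num, by norm_num [nsq]⟩
  obtain ⟨Z, hZ, hmin⟩ := hSc.exists_isMinOn hSne
    (hU.continuousOn_of_subset fun X hX => ⟨by rw [hX.2]; norm_num, hX.1, hS0 X hX⟩)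
  refine ⟨U Z, hall Z hZ.1 (hS0 Z hZ) hZ.2.le, fun X h1 h2 h3 => ?_⟩
  have hmp := hU.punctured_max_principle (W := fun X => U X - U Z) (G := fun _ => 1) (B := U Z)
    continuous_const (hall Z hZ.1 (hS0 Z hZ) hZ.2.le).le
    ((hU.continuousOn_of_subset fun X hX => ⟨by linarith [hX.2.2.1], hX.1, hX.2.1⟩).sub
      continuousOn_const)
    (fun X a b c _ => by linarith [hall X a b c]) (fun X _ _ _ h => absurd h one_ne_zero)
    (fun X a b c _ => sub_nonneg.2 (hmin ⟨a, c⟩))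
    (fun X a b _ => by
      simpa using (hU.hasOp (by linarith) a).sub (HasOp.const (1 - 2 * σ) X (U Z)))
    (fun x a b _ => ⟨_, (hU.vflux x (norm_fst_lt_two (X := (x, 0)) (by linarith)) a).sub
      (VFlux.const (U Z)), by
        have := hU.bdry_nonneg (hall (x, 0) le_rfl (fun h => a (congrArg Prod.fst h)) b).le
        linarith⟩)
    X h1 h2 h3 zero_le_one
  linarith

end Punctured

/-! ### Moving spheres -/

section MovingSpheres

variable {n : ℕ} {σ : ℝ} {U : Pt n → ℝ}

/-- Data for the method of moving spheres centred at `(c, 0)`, for squared radii up to `L`. -/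
structure Spheres (n : ℕ) (σ : ℝ) (U : Pt n → ℝ) (c : EuclideanSpace ℝ (Fin n)) (L g : ℝ) :
    Prop where
  sol : Sol n σ U
  pos : 0 < L
  lt : L < ‖c‖ ^ 2
  small : ‖c‖ ≤ 1 / 4
  gap_pos : 0 < g
  lower : ∀ X : Pt n, 0 ≤ X.2 → X ≠ 0 → nsq X ≤ 9 / 16 → 2 * g ≤ U X
  upper : ∀ Z : Pt n, 0 ≤ Z.2 → nsq (Z - (c, 0)) ≤ 4 * L ^ 2 →
    (4 * L) ^ (((n : ℝ) - 2 * σ) / 2) * U Z ≤ g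

theorem nsq_flat (x : EuclideanSpace ℝ (Fin n)) : nsq ((x, 0) : Pt n) = ‖x‖ ^ 2 := by
  simp [nsq]

theorem nsq_kelPt_sub (c : EuclideanSpace ℝ (Fin n)) (l : ℝ) (X : Pt n) :
    nsq (kelPt c l X - (c, 0)) = l ^ 2 / nsq (X - (c, 0)) := by
  rw [kelPt, add_sub_cancel_left, nsq_smul]
  by_cases h : nsq (X - ((c, 0) : Pt n)) = 0
  · simp [h]
  · field_simp

theorem snd_kelPt (c : EuclideanSpace ℝ (Fin n)) (l : ℝ) (X : Pt n) :
    (kelPt c l X).2 = l / nsq (X - (c, 0)) * X.2 := by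
  simp [kelPt]

theorem kelPt_self {c : EuclideanSpace ℝ (Fin n)} {l : ℝ} {X : Pt n} (hl : 0 < l)
    (h : nsq (X - (c, 0)) = l) : kelPt c l X = X := by
  rw [kelPt, h, div_self hl.ne', one_smul, add_sub_cancel]

theorem kel_self {c : EuclideanSpace ℝ (Fin n)} {q l : ℝ} {X : Pt n} (hl : 0 < l)
    (h : nsq (X - (c, 0)) = l) : kel q c l U X = U X := by
  rw [kel, kelPt_self hl h, h, div_self hl.ne', Real.one_rpow, one_mul]

namespace Spheres

variable {c : EuclideanSpace ℝ (Fin n)} {L g : ℝ}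

theorem sq_le (S : Spheres n σ U c L g) : ‖c‖ ^ 2 ≤ 1 / 16 := by
  nlinarith [S.small, norm_nonneg c]

theorem mem_domain (S : Spheres n σ U c L g) {Z : Pt n} (h : nsq (Z - (c, 0)) < ‖c‖ ^ 2) :
    nsq Z ≤ 1 / 4 ∧ Z ≠ 0 := by
  refine ⟨?_, ?_⟩
  · have h1 := nsq_add_le (Z - ((c, 0) : Pt n)) (c, 0)
    rw [sub_add_cancel, nsq_flat] at h1
    linarith [S.sq_le]
  · rintro rfl
    rw [zero_sub, nsq_neg, nsq_flat] at h
    exact lt_irrefl _ h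

theorem image_le {l : ℝ} {X : Pt n} (hl : 0 ≤ l) (hX : l ≤ nsq (X - (c, 0))) :
    nsq (kelPt c l X - (c, 0)) ≤ l := by
  rw [nsq_kelPt_sub]
  rcases (hl.trans hX).lt_or_eq with h | h
  · rw [div_le_iff₀ h]
    nlinarith
  · rw [← h, div_zero]
    exact hl

theorem image_mem (S : Spheres n σ U c L g) {l : ℝ} {X : Pt n} (hl : 0 ≤ l) (hlL : l ≤ L)
    (hX : l ≤ nsq (X - (c, 0))) : nsq (kelPt c l X) < 4 ∧ kelPt c l X ≠ 0 := by
  have := S.mem_domain (((image_le hl hX).trans hlL).trans_lt S.lt)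
  exact ⟨by linarith, this.2⟩

theorem snd_image_nonneg {l : ℝ} {X : Pt n} (hl : 0 ≤ l) (ht : 0 ≤ X.2) : 0 ≤ (kelPt c l X).2 := by
  rw [snd_kelPt]
  exact mul_nonneg (div_nonneg hl (nsq_nonneg _)) ht

theorem kel_nonneg (S : Spheres n σ U c L g) {l : ℝ} {X : Pt n} (hl : 0 ≤ l) (hlL : l ≤ L)
    (ht : 0 ≤ X.2) (hX : l ≤ nsq (X - (c, 0))) : 0 ≤ kel ((n : ℝ) - 2 * σ) c l U X := by
  obtain ⟨h1, h2⟩ := S.image_mem hl hlL hX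
  exact mul_nonneg (Real.rpow_nonneg (div_nonneg hl (nsq_nonneg _)) _)
    (S.sol.nonneg _ h1.le (snd_image_nonneg hl ht) h2)

theorem continuousOn_kel_prod (S : Spheres n σ U c L g) :
    ContinuousOn (fun P : ℝ × Pt n => kel ((n : ℝ) - 2 * σ) c P.1 U P.2)
      {P | 0 ≤ P.1 ∧ P.1 ≤ L ∧ 0 ≤ P.2.2 ∧ P.1 ≤ nsq (P.2 - (c, 0)) ∧ 0 < nsq (P.2 - (c, 0))} := by
  have hN : Continuous fun P : ℝ × Pt n => nsq (P.2 - ((c, 0) : Pt n)) := by fun_prop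
  have hd : ContinuousOn (fun P : ℝ × Pt n => P.1 / nsq (P.2 - ((c, 0) : Pt n)))
      {P | 0 ≤ P.1 ∧ P.1 ≤ L ∧ 0 ≤ P.2.2 ∧ P.1 ≤ nsq (P.2 - (c, 0)) ∧ 0 < nsq (P.2 - (c, 0))} :=
    continuousOn_fst.div hN.continuousOn fun P hP => hP.2.2.2.2.ne'
  refine (hd.rpow_const fun _ _ => Or.inr ?_).mul (ContinuousOn.comp
    (t := {Z : Pt n | nsq Z < 4 ∧ 0 ≤ Z.2 ∧ Z ≠ 0}) (g := U)
    (S.sol.continuousOn_of_subset fun Y hY => hY) ?_ ?_)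
  · have := S.sol.q_pos
    positivity
  · have : Continuous fun P : ℝ × Pt n => P.2 - ((c, 0) : Pt n) := by fun_prop
    exact continuousOn_const.add (hd.smul this.continuousOn)
  · rintro ⟨l, X⟩ ⟨h1, h2, h3, h4, -⟩
    obtain ⟨a, b⟩ := S.image_mem h1 h2 h4
    exact ⟨a, snd_image_nonneg h1 h3, b⟩

theorem continuousOn_kel (S : Spheres n σ U c L g) {l : ℝ} (hl : 0 < l) (hlL : l ≤ L) :
    ContinuousOn (kel ((n : ℝ) - 2 * σ) c l U) {X | 0 ≤ X.2 ∧ l ≤ nsq (X - (c, 0))} := by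
  have h : Continuous fun X : Pt n => (l, X) := by fun_prop
  exact S.continuousOn_kel_prod.comp h.continuousOn fun X hX =>
    ⟨hl.le, hlL, hX.1, hX.2, hl.trans_le hX.2⟩

theorem hasOp_kel (S : Spheres n σ U c L g) {l : ℝ} (hl : 0 < l) (hlL : l ≤ L) {X : Pt n}
    (ht : 0 < X.2) (hX : l ≤ nsq (X - (c, 0))) :
    HasOp (1 - 2 * σ) (kel ((n : ℝ) - 2 * σ) c l U) X 0 := by
  obtain ⟨h1, h2⟩ := S.image_mem hl.le hlL hX
  have hN := hl.trans_le hX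
  have h3 : 0 < (kelPt c l X).2 := by rw [snd_kelPt]; positivity
  exact hasOp_kelvin (by ring) hl ht hN (S.sol.contDiffAt _ h1 h3) (S.sol.pde _ h1 h3)

theorem vflux_kel (S : Spheres n σ U c L g) {l : ℝ} (hl : 0 < l) (hlL : l ≤ L)
    {x : EuclideanSpace ℝ (Fin n)} (hX : l ≤ nsq (((x, 0) : Pt n) - (c, 0))) :
    VFlux σ (kel ((n : ℝ) - 2 * σ) c l U) x (-bdry σ (kel ((n : ℝ) - 2 * σ) c l U) x) := by
  obtain ⟨h1, h2⟩ := S.image_mem hl.le hlL hX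
  refine S.sol.vflux_kel hl (fun h => ?_) h2 h1
  rw [h, sub_self] at hX
  simp [nsq] at hX
  linarith

theorem kel_le_of_outer (S : Spheres n σ U c L g) {l : ℝ} (hl : 0 < l) (hlL : l ≤ L) {X : Pt n}
    (ht : 0 ≤ X.2) (hX : nsq X = 9 / 16) : kel ((n : ℝ) - 2 * σ) c l U X ≤ g := by
  have hq := S.sol.q_pos
  have hs := S.sq_le
  have hLc := S.lt
  have hN : 1 / 4 ≤ nsq (X - ((c, 0) : Pt n)) := by
    have h1 : ‖X.1‖ ^ 2 + X.2 ^ 2 = 9 / 16 := hX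
    have h2 : nsq (X - ((c, 0) : Pt n)) = ‖X.1 - c‖ ^ 2 + X.2 ^ 2 := by simp [nsq]
    have h3 : ‖X.1‖ ≤ 3 / 4 := by nlinarith [norm_nonneg X.1, sq_nonneg X.2]
    have h4 := norm_sub_norm_le X.1 c
    rw [h2]
    rcases le_total ‖X.1‖ ‖c‖ with h | h
    · nlinarith [norm_nonneg X.1, S.small, sq_nonneg (‖X.1 - c‖)]
    · nlinarith [norm_nonneg X.1, norm_nonneg c, S.small]
  have hlN : l ≤ nsq (X - ((c, 0) : Pt n)) := by linarith
  obtain ⟨h1, h2⟩ := S.image_mem hl.le hlL hlN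
  have hU0 := S.sol.nonneg _ h1.le (snd_image_nonneg hl.le ht) h2
  refine le_trans ?_ (S.upper (kelPt c l X) (snd_image_nonneg hl.le ht) ?_)
  · refine mul_le_mul_of_nonneg_right (Real.rpow_le_rpow (by positivity) ?_ (by positivity)) hU0
    rw [div_le_iff₀ (by linarith)]
    nlinarith [S.pos]
  · rw [nsq_kelPt_sub, div_le_iff₀ (by linarith)]
    have : l ^ 2 ≤ L ^ 2 := by nlinarith
    nlinarith [sq_nonneg L]

/-- Once the reflected function lies below `U`, it does so with a definite gap. -/
theorem gap (S : Spheres n σ U c L g) {l : ℝ} (hl : 0 < l) (hlL : l ≤ L)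
    (h : ∀ X : Pt n, 0 ≤ X.2 → X ≠ 0 → nsq X ≤ 9 / 16 → l ≤ nsq (X - (c, 0)) →
      kel ((n : ℝ) - 2 * σ) c l U X ≤ U X) :
    ∀ X : Pt n, 0 ≤ X.2 → X ≠ 0 → nsq X ≤ 9 / 16 → l ≤ nsq (X - (c, 0)) →
      kel ((n : ℝ) - 2 * σ) c l U X +
        g * (1 - (l / nsq (X - (c, 0))) ^ (((n : ℝ) - 2 * σ) / 2)) ≤ U X := by
  have hq := S.sol.q_pos
  have hσ := S.sol.pos
  have hg := S.gap_pos
  intro X h1 h2 h3 h4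
  have hF : ∀ Y : Pt n, 0 ≤ (l / nsq (Y - (c, 0))) ^ (((n : ℝ) - 2 * σ) / 2) := fun Y =>
    Real.rpow_nonneg (div_nonneg hl.le (nsq_nonneg _)) _
  have := S.sol.punctured_max_principle (G := fun Y => nsq (Y - (c, 0)) - l) (B := g)
    (W := fun Y => U Y - kel ((n : ℝ) - 2 * σ) c l U Y -
      g * (1 - (l / nsq (Y - (c, 0))) ^ (((n : ℝ) - 2 * σ) / 2))) (by fun_prop) hg.le
    (((S.sol.continuousOn_of_subset fun Y hY => ⟨by linarith [hY.2.2.1], hY.1, hY.2.1⟩).sub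
      ((S.continuousOn_kel hl hlL).mono fun Y hY => ⟨hY.1, sub_nonneg.1 hY.2.2.2⟩)).sub
      (continuousOn_const.mul (continuousOn_const.sub ((continuousOn_fundamental c hq.le).mono
        fun Y hY hYc => by
          have := hY.2.2.2
          simp [hYc, nsq] at this
          linarith))))
    (fun Y a b d e => by nlinarith [h Y a b d (sub_nonneg.1 e), hF Y])
    (fun Y a b d e => by
      have e' := sub_eq_zero.1 e
      have := h Y a b d e'.ge
      simp only [e', div_self hl.ne', Real.one_rpow]
      linarith)
    (fun Y a b d e => by
      nlinarith [S.kel_le_of_outer hl hlL a d, S.lower Y a b d.le, hF Y])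
    (fun Y a b d => by
      have hY0 : Y ≠ 0 := fun h => by rw [h] at a; exact lt_irrefl _ a
      have := ((S.sol.hasOp (by linarith) a).sub (S.hasOp_kel hl hlL a (sub_nonneg.1 d))).sub
        (((HasOp.const (1 - 2 * σ) Y 1).sub (hasOp_fundamental (q := (n : ℝ) - 2 * σ)
          (a := 1 - 2 * σ) c (by ring) hl a)).const_mul g)
      simpa using this)
    (fun x a b d => by
      have d' : l ≤ nsq (((x, 0) : Pt n) - (c, 0)) := (sub_pos.1 d).le
      refine ⟨_, ((S.sol.vflux x (norm_fst_lt_two (X := (x, 0)) (by linarith)) a).sub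
        (S.vflux_kel hl hlL d')).sub (((VFlux.const 1).sub (vflux_fundamental
          (q := (n : ℝ) - 2 * σ) S.sol.lt_one hl fun hx => ?_)).const_mul g), ?_⟩
      · rw [hx, sub_self] at d'
        simp [nsq] at d'
        linarith
      · have h0 := S.kel_nonneg hl.le hlL (X := (x, 0)) le_rfl d'
        have h5 := h (x, 0) le_rfl (fun h => a (congrArg Prod.fst h)) b d'
        have : bdry σ (kel ((n : ℝ) - 2 * σ) c l U) x ≤ bdry σ U x := by
          unfold bdry
          gcongr
        linarith)
    X h1 h2 h3 (sub_nonneg.2 h4)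
  linarith

end Spheres

end MovingSpheres

section MovingSpheres

variable {n : ℕ} {σ : ℝ} {U : Pt n → ℝ}

theorem rpow_sub_rpow_le {p u v M : ℝ} (hp : 1 ≤ p) (hu : 0 ≤ u) (huv : u ≤ v) (hv : v ≤ M) :
    v ^ p - u ^ p ≤ p * M ^ (p - 1) * (v - u) := by
  rcases (hu.trans huv).lt_or_eq with h | h
  · have h1 := one_add_mul_self_le_rpow_one_add (s := u / v - 1)
      (by have : 0 ≤ u / v := by positivity
          linarith) hp
    rw [add_sub_cancel, Real.div_rpow hu h.le, le_div_iff₀ (by positivity)] at h1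
    have h2 : v ^ p = v ^ (p - 1) * v := by
      rw [← Real.rpow_add_one h.ne', sub_add_cancel]
    have h3 : v ^ (p - 1) ≤ M ^ (p - 1) := Real.rpow_le_rpow h.le hv (by linarith)
    have h4 : (1 + p * (u / v - 1)) * v ^ p = v ^ p + p * v ^ (p - 1) * (u - v) := by
      rw [h2]
      field_simp
    rw [h4] at h1
    have : p * v ^ (p - 1) * (v - u) ≤ p * M ^ (p - 1) * (v - u) := by
      gcongr
    linarith
  · obtain rfl : u = v := le_antisymm huv (h ▸ hu)
    simp

theorem one_le_exponent {n : ℕ} {σ : ℝ} (hσ : 0 < σ) (hq : 0 < (n : ℝ) - 2 * σ) :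
    1 ≤ ((n : ℝ) + 2 * σ) / ((n : ℝ) - 2 * σ) := by
  rw [one_le_div hq]
  linarith

theorem barrier_pos {K t t₁ A σ : ℝ} (hK : 0 < K) (ht : 0 ≤ t) (ht₁ : 0 < t₁) (hσ : 0 < σ)
    (hσ' : σ < 1) (h1 : K * t₁ ^ (2 * σ) ≤ 1 / 2) (hA : A = K * t₁ ^ (2 * σ - 2)) :
    0 < 1 + A * t ^ 2 - K * t ^ (2 * σ) := by
  rcases le_total t t₁ with h | h
  · have h2 : K * t ^ (2 * σ) ≤ K * t₁ ^ (2 * σ) := by gcongr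
    have : 0 ≤ A * t ^ 2 := by rw [hA]; positivity
    linarith
  · have ht' := ht₁.trans_le h
    have h2 : t ^ (2 * σ - 2) ≤ t₁ ^ (2 * σ - 2) :=
      Real.rpow_le_rpow_of_nonpos ht₁ h (by linarith)
    have h3 : t ^ (2 * σ) = t ^ (2 * σ - 2) * t ^ 2 := by
      rw [← Real.rpow_natCast t 2, ← Real.rpow_add ht']
      norm_num
    have h4 : K * t ^ (2 * σ) ≤ A * t ^ 2 := by
      rw [h3, hA, ← mul_assoc]
      gcongr
    linarith

namespace Spheres

variable {c : EuclideanSpace ℝ (Fin n)} {L g : ℝ}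

theorem exists_bound (S : Spheres n σ U c L g) :
    ∃ M, 0 < M ∧ ∀ Z : Pt n, 0 ≤ Z.2 → nsq (Z - (c, 0)) ≤ L → U Z ≤ M := by
  set K : Set (Pt n) := {Z | 0 ≤ Z.2 ∧ nsq (Z - (c, 0)) ≤ L} with hK
  have hd : ∀ Z ∈ K, nsq Z ≤ 1 / 4 ∧ Z ≠ 0 := fun Z hZ => S.mem_domain (hZ.2.trans_lt S.lt)
  have hc : Continuous fun Z : Pt n => nsq (Z - ((c, 0) : Pt n)) := by fun_prop
  have hKc : IsCompact K := isCompact_nsq_le ((isClosed_le continuous_const continuous_snd).inter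
    (isClosed_le hc continuous_const)) fun Z hZ => (hd Z hZ).1
  obtain ⟨M, hM⟩ := hKc.bddAbove_image (S.sol.continuousOn_of_subset fun Y hY =>
    ⟨by linarith [(hd Y hY).1], hY.1, (hd Y hY).2⟩)
  exact ⟨max M 1, by positivity, fun Z h1 h2 =>
    (hM ⟨Z, ⟨h1, h2⟩, rfl⟩).trans (le_max_left _ _)⟩

theorem kel_le (S : Spheres n σ U c L g) {M : ℝ}
    (h : ∀ Z : Pt n, 0 ≤ Z.2 → nsq (Z - (c, 0)) ≤ L → U Z ≤ M) {l : ℝ} {X : Pt n} (hl : 0 < l)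
    (hlL : l ≤ L) (ht : 0 ≤ X.2) (hX : l ≤ nsq (X - (c, 0))) :
    kel ((n : ℝ) - 2 * σ) c l U X ≤ M := by
  have hN := hl.trans_le hX
  have hq := S.sol.q_pos
  obtain ⟨h1, h2⟩ := S.image_mem hl.le hlL hX
  calc kel ((n : ℝ) - 2 * σ) c l U X ≤ 1 * M := by
        refine mul_le_mul (Real.rpow_le_one (by positivity) ?_ (by positivity))
          (h _ (snd_image_nonneg hl.le ht) ((image_le hl.le hX).trans hlL))
          (S.sol.nonneg _ h1.le (snd_image_nonneg hl.le ht) h2) zero_le_one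
        rwa [div_le_one hN]
    _ = M := one_mul M

set_option maxHeartbeats 600000 in
/-- Maximum principle in thin shells around the spheres. -/
theorem shell (S : Spheres n σ U c L g) : ∃ η, 0 < η ∧ L + η < ‖c‖ ^ 2 ∧
    ∀ l, 0 < l → l ≤ L →
      (∀ X : Pt n, 0 ≤ X.2 → nsq (X - (c, 0)) = l + η →
        kel ((n : ℝ) - 2 * σ) c l U X ≤ U X) →
      ∀ X : Pt n, 0 ≤ X.2 → l ≤ nsq (X - (c, 0)) → nsq (X - (c, 0)) ≤ l + η →
        kel ((n : ℝ) - 2 * σ) c l U X ≤ U X := by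
  have hσ := S.sol.pos
  have hσ' := S.sol.lt_one
  have hq := S.sol.q_pos
  have hLc := S.lt
  have hn : (2 : ℝ) ≤ n := by exact_mod_cast S.sol.two_le
  obtain ⟨M, hM, hUM⟩ := S.exists_bound
  set p := ((n : ℝ) + 2 * σ) / ((n : ℝ) - 2 * σ) with hp
  have hp1 : 1 ≤ p := one_le_exponent hσ hq
  set B := p * M ^ (p - 1) / (2 * σ) with hB
  have hB0 : 0 < B := by positivity
  set K := 2 * B + 1 with hK
  set t₁ := (1 / (2 * K)) ^ (1 / (2 * σ)) with ht₁
  have hK0 : 0 < K := by positivity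
  have ht₁0 : 0 < t₁ := by positivity
  have hKt : K * t₁ ^ (2 * σ) ≤ 1 / 2 := by
    rw [ht₁, ← Real.rpow_mul (by positivity), one_div_mul_cancel (by positivity), Real.rpow_one]
    apply le_of_eq
    field_simp
  set A := K * t₁ ^ (2 * σ - 2) with hA
  have hA0 : 0 < A := by positivity
  set η := min (1 / A) ((‖c‖ ^ 2 - L) / 2) with hη
  have hη0 : 0 < η := lt_min (by positivity) (by linarith)
  have hηA : A * η ≤ 1 := by
    have : η ≤ 1 / A := min_le_left _ _
    rw [le_div_iff₀ hA0] at this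
    linarith
  have hηL : L + η < ‖c‖ ^ 2 := by
    have : η ≤ (‖c‖ ^ 2 - L) / 2 := min_le_right _ _
    linarith
  refine ⟨η, hη0, hηL, fun l hl hlL hbd => ?_⟩
  set Q : Set (Pt n) := {X | 0 ≤ X.2 ∧ l ≤ nsq (X - (c, 0)) ∧ nsq (X - (c, 0)) ≤ l + η} with hQ
  have hd : ∀ Z ∈ Q, nsq Z ≤ 1 / 4 ∧ Z ≠ 0 := fun Z hZ =>
    S.mem_domain (hZ.2.2.trans_lt (by linarith))
  have hN : ∀ X : Pt n, nsq (X - ((c, 0) : Pt n)) = ‖X.1 - c‖ ^ 2 + X.2 ^ 2 := fun X => by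
    simp [nsq]
  have hc : Continuous fun Z : Pt n => nsq (Z - ((c, 0) : Pt n)) := by fun_prop
  have hQc : IsCompact Q := isCompact_nsq_le ((isClosed_le continuous_const continuous_snd).inter
    ((isClosed_le continuous_const hc).inter (isClosed_le hc continuous_const)))
    fun Z hZ => (hd Z hZ).1
  have hφc : Continuous fun X : Pt n => 1 + A * (l + η - ‖X.1 - c‖ ^ 2) - K * X.2 ^ (2 * σ) := by
    have : Continuous fun X : Pt n => X.2 ^ (2 * σ) :=
      continuous_snd.rpow_const fun _ => Or.inr (by positivity)
    fun_prop
  have := max_principle (a := 1 - 2 * σ) (σ := σ) hQc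
    (W := fun X => U X - kel ((n : ℝ) - 2 * σ) c l U X)
    (φ := fun X => 1 + A * (l + η - ‖X.1 - c‖ ^ 2) - K * X.2 ^ (2 * σ))
    ((S.sol.continuousOn_of_subset fun Y hY => ⟨by linarith [(hd Y hY).1], hY.1, (hd Y hY).2⟩).sub
      ((S.continuousOn_kel hl hlL).mono fun Y hY => ⟨hY.1, hY.2.1⟩)) hφc.continuousOn
    (fun X hX => by
      have h1 := barrier_pos hK0 hX.1 ht₁0 hσ hσ' hKt hA
      have h2 := hX.2.2
      rw [hN] at h2
      nlinarith)
    fun X hX hneg => by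
      obtain ⟨h1, h2, h3⟩ := hX
      obtain ⟨d1, d2⟩ := hd X ⟨h1, h2, h3⟩
      have e2 : l < nsq (X - (c, 0)) := lt_of_le_of_ne h2 fun he => by
        rw [kel_self hl he.symm] at hneg
        linarith
      have e3 : nsq (X - (c, 0)) < l + η := lt_of_le_of_ne h3 fun he => by
        linarith [hbd X h1 he]
      have hnear : ∀ᶠ Z in 𝓝 X, l ≤ nsq (Z - ((c, 0) : Pt n)) ∧
          nsq (Z - ((c, 0) : Pt n)) ≤ l + η := by
        filter_upwards [hc.continuousAt.eventually (lt_mem_nhds e2),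
          hc.continuousAt.eventually (gt_mem_nhds e3)] with Z a1 a2 using ⟨a1.le, a2.le⟩
      rcases h1.lt_or_eq with ht | ht
      · left
        refine ⟨?_, 0, -(A * (2 * n)), ?_, ?_, le_rfl, ?_⟩
        · filter_upwards [hnear, continuous_snd.continuousAt.eventually (lt_mem_nhds ht)] with Z a b
            using ⟨b.le, a⟩
        · simpa using (S.sol.hasOp (by linarith) ht).sub (S.hasOp_kel hl hlL ht h2)
        · have := ((HasOp.const (1 - 2 * σ) X 1).add (((HasOp.const (1 - 2 * σ) X (l + η)).sub
            (hasOp_norm_sq c)).const_mul A)).sub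
            ((hasOp_snd_rpow (a := 1 - 2 * σ) (σ := σ) ht rfl).const_mul K)
          simpa using this
        · have : 0 < A * (2 * n) := by positivity
          linarith
      · right
        have hXx : X = (X.1, 0) := Prod.ext rfl ht.symm
        refine ⟨ht.symm, ?_, -bdry σ U X.1 - -bdry σ (kel ((n : ℝ) - 2 * σ) c l U) X.1, -K,
          ?_, ?_, ?_⟩
        · rw [hXx] at hnear
          filter_upwards [eventually_vertical hnear, self_mem_nhdsWithin] with t a b
          exact ⟨le_of_lt b, a⟩
        · rw [hXx] at d1 d2 h2
          exact (S.sol.vflux X.1 (norm_fst_lt_two (X := (X.1, 0)) (by linarith))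
            fun h => d2 (by rw [h]; rfl)).sub (S.vflux_kel hl hlL h2)
        · have := ((VFlux.const (σ := σ) (x := X.1) 1).add (((VFlux.const (l + η)).sub
            (vflux_fst fun y => ‖y - c‖ ^ 2)).const_mul A)).sub
            ((vflux_snd_rpow (σ := σ) hσ).const_mul K)
          simpa using this
        · intro m hm he
          rw [← ht, Real.zero_rpow (by positivity)] at he
          have hk := S.kel_le hUM hl hlL h1 h2
          have hU0 := S.sol.nonneg X (by linarith) h1 d2
          have hr := rpow_sub_rpow_le hp1 hU0 (by linarith) hk
          have hb : bdry σ (kel ((n : ℝ) - 2 * σ) c l U) X.1 - bdry σ U X.1 ≤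
              B * (kel ((n : ℝ) - 2 * σ) c l U X - U X) := by
            rw [bdry, bdry, ← hXx, ← hp, hB, ← sub_div, div_mul_eq_mul_div]
            gcongr
          have h4 : l ≤ ‖X.1 - c‖ ^ 2 := by
            rw [hN, ← ht] at h2
            linarith
          have h5 : 1 + A * (l + η - ‖X.1 - c‖ ^ 2) ≤ 2 := by
            have : A * (l + η - ‖X.1 - c‖ ^ 2) ≤ A * η := by gcongr; linarith
            linarith
          have h6 : kel ((n : ℝ) - 2 * σ) c l U X - U X ≤ m * 2 := by
            have := mul_le_mul_of_nonneg_left h5 hm.le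
            linarith
          have h7 : B * (kel ((n : ℝ) - 2 * σ) c l U X - U X) ≤ B * (m * 2) := by gcongr
          have h8 : m * -K = -(B * (m * 2)) - m := by rw [hK]; ring
          rw [h8]
          linarith
  exact fun X h1 h2 h3 => sub_nonneg.1 (this X ⟨h1, h2, h3⟩)

/-- The moving-sphere inequality. -/
theorem kel_le_self (S : Spheres n σ U c L g) {X : Pt n} (ht : 0 ≤ X.2) (hX0 : X ≠ 0)
    (hX : nsq X ≤ 9 / 16) (hXL : L ≤ nsq (X - (c, 0))) :
    kel ((n : ℝ) - 2 * σ) c L U X ≤ U X := by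
  have hq := S.sol.q_pos
  have hg := S.gap_pos
  have hL := S.pos
  obtain ⟨η, hη, hηL, hshell⟩ := S.shell
  have hN : Continuous fun P : ℝ × Pt n => nsq (P.2 - ((c, 0) : Pt n)) := by fun_prop
  set K : Set (ℝ × Pt n) := {P | 0 ≤ P.1 ∧ P.1 ≤ L ∧ 0 ≤ P.2.2 ∧ P.1 ≤ nsq (P.2 - (c, 0)) ∧
    η ≤ nsq (P.2 - (c, 0)) ∧ nsq P.2 ≤ 9 / 16} with hK
  have hKcl : IsClosed K := (isClosed_le continuous_const continuous_fst).inter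
    ((isClosed_le continuous_fst continuous_const).inter
    ((isClosed_le continuous_const (continuous_snd.comp continuous_snd)).inter
    ((isClosed_le continuous_fst hN).inter
    ((isClosed_le continuous_const hN).inter
    (isClosed_le (continuous_nsq.comp continuous_snd) continuous_const)))))
  have hKc : IsCompact K := (isCompact_Icc (a := 0) (b := L)).prod
    (isCompact_nsq_le (K := {X : Pt n | nsq X ≤ 9 / 16})
      (isClosed_le continuous_nsq continuous_const) fun _ h => h) |>.of_isClosed_subset hKcl
      fun P hP => ⟨⟨hP.1, hP.2.1⟩, hP.2.2.2.2.2⟩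
  have huc := hKc.uniformContinuousOn_of_continuous (S.continuousOn_kel_prod.mono fun P hP =>
    ⟨hP.1, hP.2.1, hP.2.2.1, hP.2.2.2.1, hη.trans_le hP.2.2.2.2.1⟩)
  rw [Metric.uniformContinuousOn_iff] at huc
  set e := g * (1 - (L / (L + η)) ^ (((n : ℝ) - 2 * σ) / 2)) with he
  have he0 : 0 < e := by
    have : (L / (L + η)) ^ (((n : ℝ) - 2 * σ) / 2) < 1 :=
      Real.rpow_lt_one (by positivity) (by rw [div_lt_one (by positivity)]; linarith)
        (by positivity)
    exact mul_pos hg (by linarith)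
  obtain ⟨δ, hδ, huc⟩ := huc e he0
  have step : ∀ l, 0 ≤ l → l ≤ L → ∀ l', l ≤ l' → 0 < l' → l' ≤ L → l' < l + δ →
      (∀ X : Pt n, 0 ≤ X.2 → X ≠ 0 → nsq X ≤ 9 / 16 → l ≤ nsq (X - (c, 0)) →
        kel ((n : ℝ) - 2 * σ) c l U X +
          g * (1 - (l / nsq (X - (c, 0))) ^ (((n : ℝ) - 2 * σ) / 2)) ≤ U X) →
      ∀ X : Pt n, 0 ≤ X.2 → X ≠ 0 → nsq X ≤ 9 / 16 → l' ≤ nsq (X - (c, 0)) →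
        kel ((n : ℝ) - 2 * σ) c l' U X +
          g * (1 - (l' / nsq (X - (c, 0))) ^ (((n : ℝ) - 2 * σ) / 2)) ≤ U X := by
    intro l hl hlL l' hll hl' hlL' hδl h
    refine S.gap hl' hlL' ?_
    have far : ∀ X : Pt n, 0 ≤ X.2 → X ≠ 0 → nsq X ≤ 9 / 16 → l' + η ≤ nsq (X - (c, 0)) →
        kel ((n : ℝ) - 2 * σ) c l' U X ≤ U X := by
      intro X h1 h2 h3 h4
      have h5 := h X h1 h2 h3 (by linarith)
      have h6 := huc (l', X) ⟨hl'.le, hlL', h1, by dsimp only; linarith, by dsimp only; linarith, h3⟩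
        (l, X) ⟨hl, hlL, h1, by dsimp only; linarith, by dsimp only; linarith, h3⟩ (by
          rw [Prod.dist_eq, dist_self, Real.dist_eq, max_eq_left (abs_nonneg _),
            abs_of_nonneg (by dsimp only; linarith)]
          dsimp only
          linarith)
      rw [Real.dist_eq] at h6
      have h7 := (abs_lt.1 h6).2
      have h8 : e ≤ g * (1 - (l / nsq (X - (c, 0))) ^ (((n : ℝ) - 2 * σ) / 2)) := by
        rw [he]
        have h9 : l / nsq (X - (c, 0)) ≤ L / (L + η) := by
          rw [div_le_div_iff₀ (by linarith) (by linarith)]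
          nlinarith
        have : 0 ≤ l / nsq (X - (c, 0)) := div_nonneg hl (nsq_nonneg _)
        gcongr
      linarith
    intro X h1 h2 h3 h4
    rcases le_total (l' + η) (nsq (X - (c, 0))) with h5 | h5
    · exact far X h1 h2 h3 h5
    · refine hshell l' hl' hlL' (fun Z z1 z2 => ?_) X h1 h4 h5
      obtain ⟨d1, d2⟩ := S.mem_domain (Z := Z) (by linarith)
      exact far Z z1 d2 (by linarith) z2.ge
  have ind : ∀ k : ℕ, ∀ X : Pt n, 0 ≤ X.2 → X ≠ 0 → nsq X ≤ 9 / 16 →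
      min (k * (δ / 2)) L ≤ nsq (X - (c, 0)) →
        kel ((n : ℝ) - 2 * σ) c (min (k * (δ / 2)) L) U X +
          g * (1 - (min (k * (δ / 2)) L / nsq (X - (c, 0))) ^ (((n : ℝ) - 2 * σ) / 2)) ≤ U X := by
    intro k
    induction k with
    | zero =>
      intro X h1 h2 h3 _
      have h4 : min (((0 : ℕ) : ℝ) * (δ / 2)) L = 0 := by
        rw [Nat.cast_zero, zero_mul]
        exact min_eq_left hL.le
      rw [h4, kel, zero_div, Real.zero_rpow (by positivity)]
      linarith [S.lower X h1 h2 h3]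
    | succ k ih =>
      have hk : (0 : ℝ) ≤ k * (δ / 2) := by positivity
      have hk' : ((k + 1 : ℕ) : ℝ) * (δ / 2) = k * (δ / 2) + δ / 2 := by push_cast; ring
      refine step _ (le_min hk hL.le) (min_le_right _ _) _ ?_ ?_ (min_le_right _ _) ?_ ih
      · exact min_le_min_right _ (by linarith)
      · exact lt_min (by linarith) hL
      · rcases le_total (k * (δ / 2)) L with h | h
        · rw [min_eq_left h]
          exact (min_le_left _ _).trans_lt (by linarith)
        · rw [min_eq_right h]
          exact (min_le_right _ _).trans_lt (by linarith)
  obtain ⟨k, hk⟩ := exists_nat_ge (L / (δ / 2))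
  rw [div_le_iff₀ (by positivity)] at hk
  have h := ind k X ht hX0 hX
  rw [min_eq_right hk] at h
  have h1 := h hXL
  have : (L / nsq (X - (c, 0))) ^ (((n : ℝ) - 2 * σ) / 2) ≤ 1 :=
    Real.rpow_le_one (div_nonneg hL.le (nsq_nonneg _))
      ((div_le_one (hL.trans_le hXL)).2 hXL) (by positivity)
  nlinarith

end Spheres

end MovingSpheres

/-! ### Consequences of the moving-sphere inequality -/

section Reflection

variable {n : ℕ} {σ : ℝ} {U : Pt n → ℝ} {g : ℝ}

theorem norm_fst_le_of_nsq_le {Z : Pt n} {r : ℝ} (hr : 0 ≤ r) (h : nsq Z ≤ r ^ 2) : ‖Z.1‖ ≤ r :=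
  (norm_fst_le Z).trans (norm_le_of_nsq_le hr h)

/-- Reflection in the sphere centred at `(2x - y, 0)` that exchanges `(x, t)` and `(y, 2t)`. -/
theorem Sol.reflect (hU : Sol n σ U) (hg : 0 < g)
    (hlow : ∀ X : Pt n, 0 ≤ X.2 → X ≠ 0 → nsq X ≤ 9 / 16 → 2 * g ≤ U X)
    {x y : EuclideanSpace ℝ (Fin n)} {t S : ℝ} (ht : 0 ≤ t) (hS : S = ‖y - x‖ ^ 2 + t ^ 2)
    (hSpos : 0 < S) (hSc : 2 * S < ‖(2 : ℝ) • x - y‖ ^ 2) (hc : ‖(2 : ℝ) • x - y‖ ≤ 1 / 4)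
    (hup : ∀ Z : Pt n, 0 ≤ Z.2 → nsq (Z - ((2 : ℝ) • x - y, 0)) ≤ (4 * S) ^ 2 →
      (8 * S) ^ (((n : ℝ) - 2 * σ) / 2) * U Z ≤ g)
    (hy0 : ((y, 2 * t) : Pt n) ≠ 0) (hy : nsq ((y, 2 * t) : Pt n) ≤ 9 / 16) :
    (1 / 2) ^ (((n : ℝ) - 2 * σ) / 2) * U (x, t) ≤ U (y, 2 * t) := by
  have D : Spheres n σ U ((2 : ℝ) • x - y) (2 * S) g :=
    { sol := hU
      pos := by linarith
      lt := hSc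
      small := hc
      gap_pos := hg
      lower := hlow
      upper := fun Z h1 h2 => by
        have := hup Z h1 (by nlinarith)
        rwa [show 4 * (2 * S) = 8 * S by ring] }
  have hsub : ((y, 2 * t) : Pt n) - ((2 : ℝ) • x - y, 0) = ((2 : ℝ) • (y - x), 2 * t) := by
    ext1
    · simp only [Prod.fst_sub]
      module
    · simp
  have hN : nsq (((y, 2 * t) : Pt n) - ((2 : ℝ) • x - y, 0)) = 2 * (2 * S) := by
    rw [hsub, nsq, norm_smul, hS]
    simp
    ring
  have h := D.kel_le_self (X := (y, 2 * t)) (by simpa using ht) hy0 hy (by rw [hN]; linarith)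
  have hhalf : 2 * S / (2 * (2 * S)) = 1 / 2 := by field_simp
  have hpt : kelPt ((2 : ℝ) • x - y) (2 * S) (y, 2 * t) = (x, t) := by
    rw [kelPt, hN, hsub, hhalf]
    ext1
    · simp only [Prod.fst_add, Prod.smul_fst]
      module
    · simp
  rwa [kel, hN, hhalf, hpt] at h

/-- Near the flat boundary, values of a solution control the values above them. -/
theorem Sol.le_below (hU : Sol n σ U) : ∃ C : ℝ, 1 ≤ C ∧
    ∀ x : EuclideanSpace ℝ (Fin n), x ≠ 0 → ‖x‖ ≤ 1 / 2 →
      ∀ h, 0 < h → h ≤ (1 - σ) / n * (‖x‖ / 2) → ∀ t, 0 ≤ t → t ≤ h → U (x, h) ≤ C * U (x, t) := by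
  have hσ := hU.pos
  have hσ' := hU.lt_one
  have hn : (2 : ℝ) ≤ n := by exact_mod_cast hU.two_le
  set s := (1 - σ) / n with hs
  have hs0 : 0 < s := div_pos (by linarith) (by positivity)
  have hs1 : s ≤ 1 := by rw [hs, div_le_one (by positivity)]; linarith
  obtain ⟨C, hC, hchain⟩ := hU.chain (1 / s)
  refine ⟨2 * C, by linarith, fun x hx hx1 h hh hhx t ht hth => ?_⟩
  have hxp : 0 < ‖x‖ := norm_pos_iff.2 hx
  set ρ := h / s with hρ
  have hρ0 : 0 < ρ := by positivity
  have hρx : ρ ≤ ‖x‖ / 2 := by rw [hρ, div_le_iff₀ hs0]; linarith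
  have hhs : h = s * ρ := by rw [hρ]; field_simp
  have hh1 : h ≤ 1 := by nlinarith
  have hball : ∀ y, ‖y - x‖ ≤ ρ → ‖y‖ ≤ 1 ∧ y ≠ 0 := fun y hy => by
    refine ⟨?_, fun h => ?_⟩
    · have := norm_add_le (y - x) x
      rw [sub_add_cancel] at this
      linarith
    · rw [h, zero_sub, norm_neg] at hy
      linarith
  have hcyl : ∀ y : EuclideanSpace ℝ (Fin n), ‖y - x‖ ≤ ρ → ∀ t, 0 ≤ t → t ≤ h →
      ‖((y, t) : Pt n)‖ ≤ 1 := fun y hy t h1 h2 =>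
    max_le (hball y hy).1 (by rw [Real.norm_eq_abs, abs_of_nonneg h1]; linarith)
  have hdom : ∀ X : Pt n, ‖X‖ ≤ 1 → nsq X < 4 := fun X hX => by
    have := nsq_le_norm_sq X
    nlinarith [norm_nonneg X]
  have hx0 : ‖x - x‖ ≤ ρ := by rw [sub_self, norm_zero]; exact hρ0.le
  have hU0 : 0 ≤ U (x, h) := hU.nonneg _ (hdom _ (hcyl x hx0 h hh.le le_rfl)).le hh.le
    fun h => hx (congrArg Prod.fst h)
  have := hU.down_barrier (x₀ := x) (m := U (x, h) / C) hρ0 (by linarith) (by positivity) hhs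
    (fun Y h1 h2 h3 => ⟨hdom Y (hcyl Y.1 h1 Y.2 h2 h3), (hball Y.1 h1).2⟩)
    (fun y hy => by
      rw [div_le_iff₀ (by linarith), mul_comm]
      refine hchain h hh (x, h) (y, h) (hcyl x hx0 h hh.le le_rfl) (hcyl y hy h hh.le le_rfl)
        le_rfl le_rfl ?_
      rw [Prod.mk_sub_mk, sub_self]
      refine max_le ?_ ?_
      · rw [one_div_mul_eq_div]
        exact hy
      · simp
        positivity)
    t ht hth
  rw [div_div, div_le_iff₀ (by positivity)] at this
  linarith

/-- The reflection inequality together with the bound it needs near the centre. -/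
theorem Sol.reflect_of_bound (hU : Sol n σ U) (hg : 0 < g)
    (hlow : ∀ X : Pt n, 0 ≤ X.2 → X ≠ 0 → nsq X ≤ 9 / 16 → 2 * g ≤ U X)
    {x y : EuclideanSpace ℝ (Fin n)} {t d M : ℝ} (ht : 0 ≤ t) (hd : 0 < d)
    (hd1 : d ≤ 1 / 16) (hdx : d ≤ ‖x‖) (hx : ‖x‖ ≤ 1 / 8)
    (hyx : ‖y - x‖ ≤ d / 10) (htd : t ≤ d / 10)
    (hM : ∀ Z : Pt n, 0 ≤ Z.2 → Z.2 ≤ d ^ 2 / 10 → ‖Z.1 - x‖ ≤ d / 2 → U Z ≤ M)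
    (hM0 : 0 ≤ M) (hMg : (d ^ 2) ^ (((n : ℝ) - 2 * σ) / 2) * M ≤ g) :
    (1 / 2) ^ (((n : ℝ) - 2 * σ) / 2) * U (x, t) ≤ U (y, 2 * t) := by
  have hq := hU.q_pos
  set S := ‖y - x‖ ^ 2 + t ^ 2 with hS
  have hSd : S ≤ d ^ 2 / 50 := by
    have h1 : ‖y - x‖ ^ 2 ≤ (d / 10) ^ 2 := by gcongr
    have h2 : t ^ 2 ≤ (d / 10) ^ 2 := by gcongr
    nlinarith
  have hdd : d ^ 2 ≤ d / 16 := by nlinarith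
  have hcx : (2 : ℝ) • x - y - x = -(y - x) := by module
  have hcx' : ‖(2 : ℝ) • x - y - x‖ ≤ d / 10 := by rwa [hcx, norm_neg]
  have hc1 : ‖(2 : ℝ) • x - y‖ ≤ ‖x‖ + d / 10 := by
    have := norm_add_le ((2 : ℝ) • x - y - x) x
    rw [sub_add_cancel] at this
    linarith
  have hc2 : d / 2 ≤ ‖(2 : ℝ) • x - y‖ := by
    have := norm_sub_norm_le x ((2 : ℝ) • x - y)
    rw [norm_sub_rev x] at this
    linarith
  have hy1 : ‖y‖ ≤ ‖x‖ + d / 10 := by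
    have := norm_add_le (y - x) x
    rw [sub_add_cancel] at this
    linarith
  have hy2 : 0 < ‖y‖ := by
    have := norm_sub_norm_le x y
    rw [norm_sub_rev x] at this
    linarith
  have hy0 : ((y, 2 * t) : Pt n) ≠ 0 := fun h => hy2.ne' (by
    have : y = 0 := congrArg Prod.fst h
    rw [this, norm_zero])
  have hyn : nsq ((y, 2 * t) : Pt n) ≤ 9 / 16 := by
    have h1 : ‖y‖ ^ 2 ≤ (1 / 4) ^ 2 := by gcongr; linarith
    have h2 : (2 * t) ^ 2 ≤ (1 / 4) ^ 2 := by gcongr; linarith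
    simp only [nsq]
    linarith
  have hS0 : 0 ≤ S := by positivity
  rcases hS0.lt_or_eq with h | h
  · refine hU.reflect hg hlow ht hS h ?_ (by linarith) (fun Z h1 h2 => ?_) hy0 hyn
    · have : (d / 2) ^ 2 ≤ ‖(2 : ℝ) • x - y‖ ^ 2 := by gcongr
      nlinarith
    · have h3 := norm_fst_le_of_nsq_le (by positivity) h2
      have h4 := (le_abs_self _).trans (abs_snd_le_of_nsq_le (by positivity) h2)
      simp only [Prod.fst_sub, Prod.snd_sub, sub_zero] at h3 h4
      have h5 : ‖Z.1 - x‖ ≤ d / 2 := by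
        have := norm_add_le (Z.1 - ((2 : ℝ) • x - y)) ((2 : ℝ) • x - y - x)
        rw [sub_add_sub_cancel] at this
        linarith
      calc (8 * S) ^ (((n : ℝ) - 2 * σ) / 2) * U Z ≤ (d ^ 2) ^ (((n : ℝ) - 2 * σ) / 2) * M := by
            refine mul_le_mul (Real.rpow_le_rpow (by positivity) (by linarith) (by positivity))
              (hM Z h1 (by linarith) h5) ?_ (by positivity)
            have hZ0 : Z ≠ 0 := fun h => by
              rw [h, Prod.fst_zero, zero_sub, norm_neg] at h5
              linarith
            refine hU.nonneg Z ?_ h1 hZ0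
            have h6 : ‖Z.1‖ ≤ 1 := by
              have := norm_add_le (Z.1 - x) x
              rw [sub_add_cancel] at this
              linarith
            have h7 : Z.2 ≤ 1 := by linarith
            simp only [nsq]
            nlinarith [norm_nonneg Z.1]
        _ ≤ g := hMg
  · have h1 : ‖y - x‖ = 0 :=
      pow_eq_zero_iff two_ne_zero |>.1 (le_antisymm (by linarith [sq_nonneg t]) (sq_nonneg _))
    have h2 : t = 0 :=
      pow_eq_zero_iff two_ne_zero |>.1 (le_antisymm (by linarith [sq_nonneg ‖y - x‖]) (sq_nonneg _))
    obtain rfl : y = x := sub_eq_zero.1 (norm_eq_zero.1 h1)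
    rw [h2, mul_zero]
    rw [h2, mul_zero] at hyn hy0
    have h3 := hU.nonneg _ (by linarith) le_rfl hy0
    have : (1 / 2 : ℝ) ^ (((n : ℝ) - 2 * σ) / 2) ≤ 1 :=
      Real.rpow_le_one (by norm_num) (by norm_num) (by positivity)
    nlinarith

end Reflection

/-! ### A priori bound on the flat boundary -/

section Apriori

theorem exists_doubling_point {E : Type*} [NormedAddCommGroup E] [ProperSpace E] {f : E → ℝ} {z : E}
    {s e K : ℝ} (hs : 0 < s) (he : 0 < e) (hK : 0 < K)
    (hf : ContinuousOn f (Metric.closedBall z s)) (hz : K < f z * s ^ e) :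
    ∃ x d, 0 < d ∧ d ≤ s - ‖x - z‖ ∧ 0 < f x ∧ f x * d ^ e = K ∧
      ∀ y, ‖y - x‖ ≤ d / 2 → f y ≤ 2 ^ e * f x := by
  have hw : ContinuousOn (fun x => f x * (s - ‖x - z‖) ^ e) (Metric.closedBall z s) := by
    refine hf.mul (ContinuousOn.rpow_const ?_ fun _ _ => Or.inr he.le)
    have : Continuous fun x => s - ‖x - z‖ := by fun_prop
    exact this.continuousOn
  obtain ⟨x, hx, hmax⟩ := (isCompact_closedBall z s).exists_isMaxOn
    ⟨z, Metric.mem_closedBall_self hs.le⟩ hw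
  rw [mem_closedBall_iff_norm] at hx
  set δ := s - ‖x - z‖ with hδ
  have h1 : K < f x * δ ^ e := by
    have := hmax (Metric.mem_closedBall_self hs.le)
    simp only [Set.mem_ofPred_eq, sub_self, norm_zero, sub_zero] at this
    linarith
  have hδ0 : 0 ≤ δ := sub_nonneg.2 hx
  have hδe : 0 ≤ δ ^ e := Real.rpow_nonneg hδ0 _
  have hfx : 0 < f x := by
    by_contra! h
    nlinarith
  have hδp : 0 < δ := by
    rcases hδ0.lt_or_eq with h | h
    · exact h
    · rw [← h, Real.zero_rpow he.ne', mul_zero] at h1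
      linarith
  have hde : ((K / f x) ^ (1 / e)) ^ e = K / f x := by
    rw [← Real.rpow_mul (by positivity), one_div_mul_cancel he.ne', Real.rpow_one]
  have hdδ : (K / f x) ^ (1 / e) ≤ δ := by
    refine (Real.rpow_le_rpow_iff (by positivity) hδ0 he).1 ?_
    rw [hde, div_le_iff₀ hfx]
    linarith
  refine ⟨x, (K / f x) ^ (1 / e), by positivity, hdδ, hfx, ?_, fun y hy => ?_⟩
  · rw [hde]
    field_simp
  · have h2 : ‖y - z‖ ≤ ‖y - x‖ + ‖x - z‖ := norm_sub_le_norm_sub_add_norm_sub y x z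
    have h3 : δ / 2 ≤ s - ‖y - z‖ := by linarith
    have h4 : f y * (s - ‖y - z‖) ^ e ≤ f x * δ ^ e :=
      hmax (by rw [mem_closedBall_iff_norm]; linarith)
    by_cases h5 : f y ≤ 0
    · exact h5.trans (by positivity)
    push Not at h5
    have h6 : (δ / 2) ^ e ≤ (s - ‖y - z‖) ^ e := by gcongr
    rw [Real.div_rpow hδ0 zero_le_two] at h6
    have h7 : f y * (δ ^ e / 2 ^ e) ≤ f x * δ ^ e := (mul_le_mul_of_nonneg_left h6 h5.le).trans h4
    have h8 : 0 < δ ^ e := by positivity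
    have h9 : (0 : ℝ) < 2 ^ e := by positivity
    rw [mul_div_assoc', div_le_iff₀ h9] at h7
    nlinarith

theorem rpow_mul_scale {u d K e p τ : ℝ} (hu : 0 < u) (hd : 0 < d) (hK : u * d ^ e = K)
    (he : e * (p - 1) = τ) : u ^ p * d ^ τ = u * K ^ (p - 1) := by
  rw [← hK, Real.mul_rpow hu.le (by positivity), ← Real.rpow_mul hd.le, he, ← mul_assoc]
  congr 1
  rw [mul_comm u, ← Real.rpow_add_one hu.ne', sub_add_cancel]

theorem rpow_sq_mul_le {d e u K C g A : ℝ} (hd : 0 < d) (hud : u * d ^ e = K)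
    (hK : 0 < K) (hC : 0 < C) (hA : 0 < A) (h : d ^ e ≤ g / (K * C * A)) :
    (d ^ 2) ^ e * (C * (A * u)) ≤ g := by
  rw [le_div_iff₀ (by positivity)] at h
  calc (d ^ 2) ^ e * (C * (A * u)) = d ^ e * ((u * d ^ e) * C * A) := by
        rw [sq, Real.mul_rpow hd.le hd.le]
        ring
    _ ≤ g := by rw [hud]; exact h

variable {n : ℕ} {σ : ℝ} {U : Pt n → ℝ} {g : ℝ}

theorem nsq_lt_four {Y : Pt n} (h1 : ‖Y.1‖ ≤ 1) (h2 : 0 ≤ Y.2) (h3 : Y.2 ≤ 1) : nsq Y < 4 := by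
  simp only [nsq]
  nlinarith [norm_nonneg Y.1]

theorem exists_small_scale {e G ρ : ℝ} (he : 0 < e) (hG : 0 < G) (hρ : 0 < ρ) :
    ∃ r, 0 < r ∧ r ≤ ρ ∧ ∀ d, 0 < d → d ≤ r → d ^ e ≤ G := by
  refine ⟨min ρ (G ^ (1 / e)), by positivity, min_le_left _ _, fun d hd hdr => ?_⟩
  calc d ^ e ≤ (G ^ (1 / e)) ^ e := by
        have := hdr.trans (min_le_right _ _)
        gcongr
    _ = G := by rw [← Real.rpow_mul hG.le, one_div_mul_cancel he.ne', Real.rpow_one]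

set_option maxHeartbeats 1000000 in
/-- The universal upper bound `u(z) ≤ K |z|^{-(n-2σ)/2}` near the puncture. -/
theorem Sol.apriori (hU : Sol n σ U) (hg : 0 < g)
    (hlow : ∀ X : Pt n, 0 ≤ X.2 → X ≠ 0 → nsq X ≤ 9 / 16 → 2 * g ≤ U X) :
    ∃ K r, 0 < K ∧ 0 < r ∧ ∀ z : EuclideanSpace ℝ (Fin n), z ≠ 0 → ‖z‖ ≤ r →
      U (z, 0) * (‖z‖ / 2) ^ (((n : ℝ) - 2 * σ) / 2) ≤ K := by
  have hσ := hU.pos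
  have hσ' := hU.lt_one
  have hq := hU.q_pos
  have hn : (2 : ℝ) ≤ n := by exact_mod_cast hU.two_le
  obtain ⟨C, hC, hbelow⟩ := hU.le_below
  set s := (1 - σ) / n with hs
  have hs0 : 0 < s := div_pos (by linarith) (by positivity)
  set e := ((n : ℝ) - 2 * σ) / 2 with he
  have he0 : 0 < e := by positivity
  set p := ((n : ℝ) + 2 * σ) / ((n : ℝ) - 2 * σ) with hp
  have hep : e * (p - 1) = 2 * σ := by rw [he, hp]; field_simp; ring
  have hp1 : 0 < p - 1 := by
    by_contra! h
    nlinarith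
  set b := 1 + (n : ℝ) / (2 - 2 * σ) with hb
  have hb0 : 0 < b := by
    have : 0 < (n : ℝ) / (2 - 2 * σ) := div_pos (by positivity) (by linarith)
    linarith
  set β := (1 / 2 : ℝ) ^ (e * p) * (1 / 10) ^ (2 * σ) / (2 * σ * b) with hβ
  have hβ0 : 0 < β := by positivity
  set K := (2 / β) ^ (1 / (p - 1)) with hK
  have hK0 : 0 < K := by positivity
  have hKp : K ^ (p - 1) = 2 / β := by
    rw [hK, ← Real.rpow_mul (by positivity), one_div_mul_cancel hp1.ne', Real.rpow_one]
  obtain ⟨r, hr, hr1, hrg⟩ := exists_small_scale (G := g / (K * C * 2 ^ e)) (ρ := min (1 / 12) s)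
    he0 (by positivity) (by positivity)
  have hr12 : r ≤ 1 / 12 := hr1.trans (min_le_left _ _)
  have hrs : r ≤ s := hr1.trans (min_le_right _ _)
  refine ⟨K, r, hK0, hr, fun z hz hzr => ?_⟩
  by_contra! hlt
  have hzp : 0 < ‖z‖ := norm_pos_iff.2 hz
  have hcont : ContinuousOn (fun x : EuclideanSpace ℝ (Fin n) => U (x, 0))
      (Metric.closedBall z (‖z‖ / 2)) := by
    have hc : Continuous fun y : EuclideanSpace ℝ (Fin n) => ((y, 0) : Pt n) := by fun_prop
    refine (hU.continuousOn_of_subset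
      (K := {Y : Pt n | ‖Y.1‖ ≤ 1 ∧ Y.1 ≠ 0 ∧ Y.2 = 0}) ?_).comp hc.continuousOn fun y hy => ?_
    · rintro ⟨y, t⟩ ⟨h1, h2, h3⟩
      obtain rfl : t = 0 := h3
      refine ⟨?_, le_rfl, fun h => h2 (congrArg Prod.fst h)⟩
      rw [nsq_flat]
      nlinarith [norm_nonneg y]
    · rw [mem_closedBall_iff_norm] at hy
      refine ⟨?_, fun h => ?_, rfl⟩
      · have := norm_add_le (y - z) z
        rw [sub_add_cancel] at this
        dsimp only
        linarith
      · rw [show y = 0 from h, zero_sub, norm_neg] at hy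
        linarith
  obtain ⟨x, d, hd, hdx, hux, hud, hdouble⟩ :=
    exists_doubling_point (f := fun x => U (x, 0)) (by positivity) he0 hK0 hcont hlt
  set u := U (x, 0) with hu
  have hxz : ‖x - z‖ ≤ ‖z‖ / 2 - d := by linarith
  have hx1 : ‖x‖ ≤ 1 / 8 := by
    have := norm_add_le (x - z) z
    rw [sub_add_cancel] at this
    linarith
  have hx2 : 2 * d ≤ ‖x‖ := by
    have := norm_sub_norm_le z x
    rw [norm_sub_rev z] at this
    linarith [norm_nonneg (x - z)]
  have hdr : d ≤ r := by linarith [norm_nonneg (x - z)]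
  have hnear : ∀ y : EuclideanSpace ℝ (Fin n), ‖y - x‖ ≤ d / 2 → d ≤ ‖y‖ ∧ ‖y‖ ≤ 1 / 2 :=
    fun y hy => by
      have h1 := norm_sub_norm_le x y
      rw [norm_sub_rev x] at h1
      have h2 := norm_add_le (y - x) x
      rw [sub_add_cancel] at h2
      constructor <;> linarith
  have hlowv : ∀ y : EuclideanSpace ℝ (Fin n), ‖y - x‖ ≤ d / 10 →
      (1 / 2) ^ e * u ≤ U (y, 0) := fun y hy => by
    have := hU.reflect_of_bound (x := x) (y := y) (t := 0) (d := d) (M := C * (2 ^ e * u)) hg hlow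
      le_rfl hd (by linarith) (by linarith) hx1 hy (by positivity) (fun Z h1 h2 h3 => by
        obtain ⟨h4, h5⟩ := hnear Z.1 h3
        have hZ0 : Z.1 ≠ 0 := norm_pos_iff.1 (by linarith)
        have h6 := hdouble Z.1 h3
        have h7 : U Z ≤ C * U (Z.1, 0) := by
          rcases h1.lt_or_eq with h | h
          · refine hbelow Z.1 hZ0 h5 Z.2 h ?_ 0 le_rfl h1
            have : s * (d / 2) ≤ s * (‖Z.1‖ / 2) := by gcongr
            have : d * d ≤ s * d := by gcongr; linarith
            have : Z.2 ≤ d * d / 10 := by rwa [sq] at h2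
            linarith [mul_pos hs0 hd]
          · have hZ : Z = (Z.1, 0) := Prod.ext rfl h.symm
            rw [← hZ]
            have : 0 ≤ U Z := hU.nonneg Z
              (nsq_lt_four (by linarith) h1 (by linarith)).le h1 fun h => hZ0 (by rw [h]; rfl)
            nlinarith
        have : C * U (Z.1, 0) ≤ C * (2 ^ e * u) := by gcongr
        linarith) (by positivity) (by
        exact rpow_sq_mul_le hd hud hK0 (by positivity) (by positivity) (hrg d hd hdr))
    rwa [mul_zero] at this
  set m := β * (u * K ^ (p - 1)) with hm
  have hm2 : m = 2 * u := by rw [hm, hKp]; field_simp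
  have hflux : m * b / (d / 10) ^ (2 * σ) = ((1 / 2) ^ e * u) ^ p / (2 * σ) := by
    rw [hm, ← rpow_mul_scale hux hd hud hep, hβ, Real.mul_rpow (by positivity) hux.le,
      ← Real.rpow_mul (by positivity), div_eq_mul_one_div d 10, Real.mul_rpow hd.le (by positivity)]
    field_simp
  have := hU.up_barrier (x₀ := x) (ρ := d / 10) (m := m) (t₀ := 0) (by linarith)
    (by rw [hm2]; positivity) le_rfl (by positivity)
    (fun Y h1 h2 h3 => by
      obtain ⟨h4, h5⟩ := hnear Y.1 (by linarith)
      exact ⟨nsq_lt_four (by linarith) h2 (by linarith), norm_pos_iff.1 (by linarith)⟩)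
    (fun y hy => Or.inr ⟨rfl, by
      rw [← hb, hflux, bdry, ← hp]
      have := hlowv y hy
      gcongr⟩) 0 le_rfl (by positivity)
  rw [zero_div, Real.zero_rpow (by positivity), mul_zero, sub_zero, mul_one] at this
  linarith

end Apriori

/-! ### The spherical Harnack inequality -/

section Harnack

variable {n : ℕ} {σ : ℝ} {U : Pt n → ℝ} {g : ℝ}

set_option maxHeartbeats 1000000 in
/-- Near the puncture, values near the flat boundary are controlled by values above them. -/
theorem Sol.le_above (hU : Sol n σ U) (hg : 0 < g)
    (hlow : ∀ X : Pt n, 0 ≤ X.2 → X ≠ 0 → nsq X ≤ 9 / 16 → 2 * g ≤ U X) :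
    ∃ θ r C, 0 < θ ∧ θ < 1 ∧ 0 < r ∧ 0 < C ∧ ∀ x : EuclideanSpace ℝ (Fin n), x ≠ 0 → ‖x‖ ≤ r →
      ∀ t, 0 ≤ t → 2 * t ≤ θ * (‖x‖ / 20) → U (x, t) ≤ C * U (x, θ * (‖x‖ / 20)) := by
  have hσ := hU.pos
  have hσ' := hU.lt_one
  have hq := hU.q_pos
  have hn : (2 : ℝ) ≤ n := by exact_mod_cast hU.two_le
  obtain ⟨C, hC, hbelow⟩ := hU.le_below
  obtain ⟨K, R, hK, hR, hapr⟩ := hU.apriori hg hlow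
  set s := (1 - σ) / n with hs
  have hs0 : 0 < s := div_pos (by linarith) (by positivity)
  set e := ((n : ℝ) - 2 * σ) / 2 with he
  have he0 : 0 < e := by positivity
  set b := 1 + (n : ℝ) / (2 - 2 * σ) with hb
  have hb1 : 1 < b := by
    have : 0 < (n : ℝ) / (2 - 2 * σ) := div_pos (by positivity) (by linarith)
    linarith
  set θ := (1 / (2 * b)) ^ (1 / (2 * σ)) with hθ
  have hθ0 : 0 < θ := by positivity
  have hθ1 : θ < 1 := Real.rpow_lt_one (by positivity)
    (by rw [div_lt_one (by positivity)]; linarith) (by positivity)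
  have hθb : b * θ ^ (2 * σ) = 1 / 2 := by
    rw [hθ, ← Real.rpow_mul (by positivity), one_div_mul_cancel (by positivity), Real.rpow_one]
    field_simp
  obtain ⟨r, hr, hr1, hrg⟩ := exists_small_scale (G := g / (K * C * 2 ^ e))
    (ρ := min (min (1 / 8) s) (R / 2)) he0 (by positivity) (by positivity)
  have hr8 : r ≤ 1 / 8 := hr1.trans ((min_le_left _ _).trans (min_le_left _ _))
  have hrs : r ≤ s := hr1.trans ((min_le_left _ _).trans (min_le_right _ _))
  have hrR : r ≤ R / 2 := hr1.trans (min_le_right _ _)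
  refine ⟨θ, r, 2 / (1 / 2) ^ e, hθ0, hθ1, hr, by positivity, fun x hx hxr t ht htx => ?_⟩
  have hxp : 0 < ‖x‖ := norm_pos_iff.2 hx
  set d := ‖x‖ / 2 with hd
  have hd0 : 0 < d := by positivity
  have hθd : θ * (‖x‖ / 20) < ‖x‖ / 20 := by nlinarith
  have hnear : ∀ y : EuclideanSpace ℝ (Fin n), ‖y - x‖ ≤ d / 2 → d ≤ ‖y‖ ∧ ‖y‖ ≤ 2 * ‖x‖ :=
    fun y hy => by
      have h1 := norm_sub_norm_le x y
      rw [norm_sub_rev x] at h1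
      have h2 := norm_add_le (y - x) x
      rw [sub_add_cancel] at h2
      constructor <;> linarith
  have hM : ∀ Z : Pt n, 0 ≤ Z.2 → Z.2 ≤ d ^ 2 / 10 → ‖Z.1 - x‖ ≤ d / 2 →
      U Z ≤ C * (2 ^ e * (K / d ^ e)) := fun Z h1 h2 h3 => by
    obtain ⟨h4, h5⟩ := hnear Z.1 h3
    have hZ0 : Z.1 ≠ 0 := norm_pos_iff.1 (by linarith)
    have h8 : d * d ≤ s * d := by gcongr; linarith
    rw [sq] at h2
    have hZd : Z.2 ≤ 1 := by nlinarith
    have h6 : U (Z.1, 0) ≤ 2 ^ e * (K / d ^ e) := by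
      have h7 := hapr Z.1 hZ0 (by linarith)
      have h9 : 0 ≤ U (Z.1, 0) := hU.nonneg _
        (nsq_lt_four (Y := (Z.1, 0)) (by linarith) le_rfl zero_le_one).le le_rfl
        fun h => hZ0 (congrArg Prod.fst h)
      have h10 : U (Z.1, 0) * (d / 2) ^ e ≤ U (Z.1, 0) * (‖Z.1‖ / 2) ^ e := by gcongr
      rw [Real.div_rpow hd0.le zero_le_two, mul_div_assoc', div_le_iff₀ (by positivity)] at h10
      rw [mul_div_assoc', le_div_iff₀ (by positivity)]
      have : (0 : ℝ) < 2 ^ e := by positivity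
      nlinarith
    have h7 : U Z ≤ C * U (Z.1, 0) := by
      rcases h1.lt_or_eq with h | h
      · refine hbelow Z.1 hZ0 (by linarith) Z.2 h ?_ 0 le_rfl h1
        have : s * (d / 2) ≤ s * (‖Z.1‖ / 2) := by gcongr
        linarith [mul_pos hs0 hd0]
      · have hZ : Z = (Z.1, 0) := Prod.ext rfl h.symm
        rw [← hZ]
        have : 0 ≤ U Z := hU.nonneg Z (nsq_lt_four (by linarith) h1 hZd).le h1
          fun h => hZ0 (by rw [h]; rfl)
        nlinarith
    have : C * U (Z.1, 0) ≤ C * (2 ^ e * (K / d ^ e)) := by gcongr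
    linarith
  have hUx : 0 ≤ U (x, t) := hU.nonneg _
    (nsq_lt_four (Y := (x, t)) (by linarith) ht (by dsimp only; linarith)).le ht
    fun h => hx (congrArg Prod.fst h)
  have := hU.up_barrier (x₀ := x) (ρ := d / 10) (m := (1 / 2) ^ e * U (x, t)) (t₀ := 2 * t)
    (by linarith) (by positivity) (by positivity) (by linarith)
    (fun Y h1 h2 h3 => by
      obtain ⟨h4, h5⟩ := hnear Y.1 (by linarith)
      exact ⟨nsq_lt_four (by linarith) h2 (by linarith), norm_pos_iff.1 (by linarith)⟩)
    (fun y hy => Or.inl <| hU.reflect_of_bound hg hlow ht hd0 (by linarith) (by linarith)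
      (by linarith) hy (by linarith) hM (by positivity)
      (rpow_sq_mul_le hd0 (by field_simp; rw [he]) hK (by positivity) (by positivity)
        (hrg d hd0 (by linarith))))
    (θ * (‖x‖ / 20)) htx (by linarith)
  have hdiv : θ * (‖x‖ / 20) / (d / 10) = θ := by rw [hd]; field_simp; norm_num
  rw [hdiv, ← hb, hθb] at this
  rw [div_mul_eq_mul_div, le_div_iff₀ (by positivity)]
  linarith

/-- Points of the annulus that are not high have large horizontal component. -/
theorem norm_fst_ge {X : Pt n} {r ε : ℝ} (hr : 0 < r) (h : (r / 2) ^ 2 ≤ nsq X) (ht : 0 ≤ X.2)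
    (htr : X.2 ≤ ε * r) (hε : ε ≤ 1 / 4) : r / 4 ≤ ‖X.1‖ := by
  simp only [nsq] at h
  have h1 : X.2 ≤ r / 4 := by nlinarith
  by_contra! h2
  nlinarith [norm_nonneg X.1]

set_option maxHeartbeats 1000000 in
theorem Sol.harnack_of_lower_bound (hU : Sol n σ U) (hg : 0 < g)
    (hlow : ∀ X : Pt n, 0 ≤ X.2 → X ≠ 0 → nsq X ≤ 9 / 16 → 2 * g ≤ U X) :
    ∃ C : ℝ, 0 < C ∧ ∀ r : ℝ, 0 < r → r < 1 / 4 → ∀ X Y : Pt n,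
      (r / 2) ^ 2 ≤ nsq X → nsq X ≤ (2 * r) ^ 2 → 0 ≤ X.2 →
      (r / 2) ^ 2 ≤ nsq Y → nsq Y ≤ (2 * r) ^ 2 → 0 ≤ Y.2 → U X ≤ C * U Y := by
  have hσ := hU.pos
  have hσ' := hU.lt_one
  have hn : (2 : ℝ) ≤ n := by exact_mod_cast hU.two_le
  obtain ⟨C₂, hC₂, hbelow⟩ := hU.le_below
  obtain ⟨θ, R, C₃, hθ, hθ1, hR, hC₃, habove⟩ := hU.le_above hg hlow
  set s := (1 - σ) / n with hs
  have hs0 : 0 < s := div_pos (by linarith) (by positivity)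
  have hs1 : s ≤ 1 := by rw [hs, div_le_one (by positivity)]; linarith
  set ε := min (θ / 160) (s / 8) with hε
  have hε0 : 0 < ε := by positivity
  have hεθ : ε ≤ θ / 160 := min_le_left _ _
  have hεs : ε ≤ s / 8 := min_le_right _ _
  obtain ⟨C₁, hC₁, hchain⟩ := hU.chain (3 / ε)
  have link : ∀ r, 0 < r → r < 1 / 4 → ∀ X Y : Pt n, ‖X.1‖ ≤ 2 * r → ‖Y.1‖ ≤ 2 * r →
      ε * r ≤ X.2 → X.2 ≤ 2 * r → ε * r ≤ Y.2 → Y.2 ≤ 2 * r → (X.1 = 0 ∨ Y.1 = 0) →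
      U X ≤ C₁ * U Y := by
    intro r hr hr1 X Y hX hY hX1 hX2 hY1 hY2 h0
    have hεr : 0 < ε * r := by positivity
    refine hchain (ε * r) hεr X Y (max_le (by linarith) ?_) (max_le (by linarith) ?_) hX1 hY1 ?_
    · rw [Real.norm_eq_abs, abs_of_nonneg (by linarith)]; linarith
    · rw [Real.norm_eq_abs, abs_of_nonneg (by linarith)]; linarith
    · rw [show 3 / ε * (ε * r) = 3 * r by field_simp]
      refine max_le ?_ ?_
      · rw [Prod.fst_sub]
        rcases h0 with h | h
        · rw [h, sub_zero]; linarith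
        · rw [h, zero_sub, norm_neg]; linarith
      · rw [Prod.snd_sub, Real.norm_eq_abs, abs_le]
        constructor <;> linarith
  have horiz : ∀ r, 0 < r → ∀ X : Pt n, nsq X ≤ (2 * r) ^ 2 → 0 ≤ X.2 →
      ‖X.1‖ ≤ 2 * r ∧ X.2 ≤ 2 * r := fun r hr X hX ht =>
    ⟨norm_fst_le_of_nsq_le (by positivity) hX,
      (le_abs_self _).trans (abs_snd_le_of_nsq_le (by positivity) hX)⟩
  have hne : ∀ r, 0 < r → ∀ X : Pt n, (r / 2) ^ 2 ≤ nsq X → X ≠ 0 := fun r hr X hX =>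
    nsq_pos.1 (lt_of_lt_of_le (by positivity) hX)
  have lower : ∀ r, 0 < r → r < 1 / 4 → ∀ Y : Pt n, (r / 2) ^ 2 ≤ nsq Y → nsq Y ≤ (2 * r) ^ 2 →
      0 ≤ Y.2 → U (0, r) ≤ C₁ * (C₂ * U Y) := by
    intro r hr hr1 Y h1 h2 h3
    obtain ⟨h4, h5⟩ := horiz r hr Y h2 h3
    have hεr : ε * r ≤ r := by nlinarith
    rcases le_total (ε * r) Y.2 with h | h
    · have h6 := link r hr hr1 (0, r) Y (by simp; positivity) h4 hεr
        (by dsimp only; linarith) h h5 (Or.inl rfl)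
      have h7 : 0 ≤ U Y := hU.nonneg Y (by nlinarith) h3 (hne r hr Y h1)
      have : C₁ * U Y ≤ C₁ * (C₂ * U Y) := mul_le_mul_of_nonneg_left (by nlinarith) (by linarith)
      linarith
    · have h6 := norm_fst_ge hr h1 h3 h (by linarith)
      have h7 : ε * r ≤ s * (‖Y.1‖ / 2) := by
        have h8 : ε * r ≤ s / 8 * r := by gcongr
        have h9 : s * (r / 8) ≤ s * (‖Y.1‖ / 2) :=
          mul_le_mul_of_nonneg_left (by linarith) hs0.le
        linarith
      have h8 : 0 < ε * r := by positivity
      have h9 : s * (‖Y.1‖ / 2) ≤ 1 * (‖Y.1‖ / 2) := by gcongr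
      have h10 := link r hr hr1 (0, r) (Y.1, s * (‖Y.1‖ / 2)) (by simp; positivity) h4 hεr
        (by dsimp only; linarith) h7 (by dsimp only; linarith) (Or.inl rfl)
      have h11 := hbelow Y.1 (norm_pos_iff.1 (by linarith)) (by linarith) (s * (‖Y.1‖ / 2))
        (by linarith) le_rfl Y.2 h3 (by linarith)
      have : C₁ * U (Y.1, s * (‖Y.1‖ / 2)) ≤ C₁ * (C₂ * U Y) := by gcongr
      linarith
  have upper : ∀ r, 0 < r → r < 1 / 4 → 2 * r ≤ R → ∀ X : Pt n, (r / 2) ^ 2 ≤ nsq X →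
      nsq X ≤ (2 * r) ^ 2 → 0 ≤ X.2 → U X ≤ max 1 C₃ * (C₁ * U (0, r)) := by
    intro r hr hr1 hrR X h1 h2 h3
    obtain ⟨h4, h5⟩ := horiz r hr X h2 h3
    have hεr : ε * r ≤ r := by nlinarith
    have hE : 0 ≤ U (0, r) := hU.nonneg _
      (nsq_lt_four (Y := (0, r)) (by simp) hr.le (by dsimp only; linarith)).le hr.le
      fun h => hr.ne' (congrArg Prod.snd h)
    have hCE : 0 ≤ C₁ * U (0, r) := by positivity
    rcases le_total (ε * r) X.2 with h | h
    · have h6 := link r hr hr1 X (0, r) h4 (by simp; positivity) h h5 hεr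
        (by dsimp only; linarith) (Or.inr rfl)
      have h7 : 1 * (C₁ * U (0, r)) ≤ max 1 C₃ * (C₁ * U (0, r)) := by
        gcongr
        exact le_max_left _ _
      linarith
    · have h6 := norm_fst_ge hr h1 h3 h (by linarith)
      have h7 : ε * r * 2 ≤ θ * (‖X.1‖ / 20) := by
        have h8 : ε * r ≤ θ / 160 * r := by gcongr
        have h9 : θ * (r / 4 / 20) ≤ θ * (‖X.1‖ / 20) := by gcongr
        linarith
      have h8 : 0 < ε * r := by positivity
      have h9 : θ * (‖X.1‖ / 20) ≤ 1 * (‖X.1‖ / 20) := by gcongr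
      have h10 := link r hr hr1 (X.1, θ * (‖X.1‖ / 20)) (0, r) h4 (by simp; positivity)
        (by dsimp only; linarith) (by dsimp only; linarith) hεr (by dsimp only; linarith)
        (Or.inr rfl)
      have h11 := habove X.1 (norm_pos_iff.1 (by linarith)) (by linarith) X.2 h3 (by linarith)
      have h12 : C₃ * U (X.1, θ * (‖X.1‖ / 20)) ≤ C₃ * (C₁ * U (0, r)) := by gcongr
      have h13 : C₃ * (C₁ * U (0, r)) ≤ max 1 C₃ * (C₁ * U (0, r)) := by
        gcongr
        exact le_max_right _ _
      exact h11.trans (h12.trans h13)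
  set A : Set (Pt n) := {X | 0 ≤ X.2 ∧ (R / 4) ^ 2 ≤ nsq X ∧ nsq X ≤ 1 / 4} with hA
  have hAc : IsCompact A := isCompact_nsq_le ((isClosed_le continuous_const continuous_snd).inter
    ((isClosed_le continuous_const continuous_nsq).inter
      (isClosed_le continuous_nsq continuous_const))) fun X hX => hX.2.2
  obtain ⟨M, hM⟩ := hAc.bddAbove_image (hU.continuousOn_of_subset fun X hX =>
    ⟨by linarith [hX.2.2], hX.1, nsq_pos.1 (lt_of_lt_of_le (by positivity) hX.2.1)⟩)
  refine ⟨max (max 1 C₃ * (C₁ * (C₁ * C₂))) (M / (2 * g)), by positivity, ?_⟩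
  intro r hr hr1 X Y x1 x2 x3 y1 y2 y3
  have hY9 : nsq Y ≤ 9 / 16 := by nlinarith
  have hYg := hlow Y y3 (hne r hr Y y1) hY9
  have hY0 : 0 ≤ U Y := by linarith
  rcases le_total (2 * r) R with h | h
  · have h1 := upper r hr hr1 h X x1 x2 x3
    have h2 := lower r hr hr1 Y y1 y2 y3
    calc U X ≤ max 1 C₃ * (C₁ * U (0, r)) := h1
      _ ≤ max 1 C₃ * (C₁ * (C₁ * (C₂ * U Y))) := by gcongr
      _ = max 1 C₃ * (C₁ * (C₁ * C₂)) * U Y := by ring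
      _ ≤ _ := by gcongr; exact le_max_left _ _
  · have h1 : U X ≤ M := hM ⟨X, ⟨x3, by nlinarith, by nlinarith⟩, rfl⟩
    have h2 := hlow X x3 (hne r hr X x1) (by nlinarith)
    calc U X ≤ M / (2 * g) * (2 * g) := by rw [div_mul_cancel₀ _ (by positivity)]; exact h1
      _ ≤ M / (2 * g) * U Y := by
        have : 0 ≤ M := by linarith
        gcongr
      _ ≤ _ := by gcongr; exact le_max_right _ _

/-- A solution that vanishes in the interior vanishes on the flat boundary. -/
theorem Sol.eq_zero (hU : Sol n σ U) (h : ∀ X : Pt n, ‖X‖ ≤ 1 → 0 < X.2 → U X = 0) {X : Pt n}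
    (hX : ‖X‖ ≤ 1 / 2) (ht : 0 ≤ X.2) (hX0 : X ≠ 0) : U X = 0 := by
  rcases ht.lt_or_eq with ht | ht
  · exact h X (by linarith) ht
  have hx : ‖X.1‖ ≤ 1 / 2 := (norm_fst_le X).trans hX
  obtain ⟨C, hC, hb⟩ := hU.le_below
  have hXx : X = (X.1, 0) := Prod.ext rfl ht.symm
  have hc := hU.continuousWithinAt (X := X) (by
    rw [hXx]
    exact nsq_lt_four (by dsimp only; linarith) le_rfl zero_le_one) ht.le hX0
  have hl : Tendsto (fun t : ℝ => ((X.1, t) : Pt n)) (𝓝[>] 0) (𝓝[{Y | 0 ≤ Y.2}] X) := by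
    refine tendsto_nhdsWithin_iff.2 ⟨?_, ?_⟩
    · have : Continuous fun t : ℝ => ((X.1, t) : Pt n) := by fun_prop
      have := this.tendsto 0
      rw [← hXx] at this
      exact this.mono_left nhdsWithin_le_nhds
    · filter_upwards [self_mem_nhdsWithin] with t ht using le_of_lt ht
  refine tendsto_nhds_unique (hc.tendsto.comp hl) (tendsto_const_nhds.congr' ?_)
  filter_upwards [self_mem_nhdsWithin, mem_nhdsWithin_of_mem_nhds (ge_mem_nhds one_pos)]
    with t (h1 : 0 < t) h2
  refine (h (X.1, t) (max_le (by linarith) ?_) h1).symm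
  rw [Real.norm_eq_abs, abs_of_pos h1]
  exact h2

theorem enorm'_sq (X : Pt n) : enorm' X ^ 2 = nsq X :=
  Real.sq_sqrt (nsq_nonneg X)

end Harnack

/-- Spherical Harnack inequality: there is `C > 0` (independent of `r`)
such that for every `0 < r < 1/4`,
`sup_{r/2 ≤ |X| ≤ 2r, t ≥ 0} U ≤ C · inf_{r/2 ≤ |X| ≤ 2r, t ≥ 0} U`. -/
theorem stmt_8 (n : ℕ) (hn : 2 ≤ n) (σ : ℝ) (hσ : σ ∈ Set.Ioo (0 : ℝ) 1)
    (U : Pt n → ℝ) (hU : ExtSol n σ 2 U) :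
    ∃ C : ℝ, 0 < C ∧
      ∀ r : ℝ, 0 < r → r < 1 / 4 →
        ∀ X Y : Pt n,
          r / 2 ≤ enorm' X → enorm' X ≤ 2 * r → 0 ≤ X.2 →
          r / 2 ≤ enorm' Y → enorm' Y ≤ 2 * r → 0 ≤ Y.2 →
          U X ≤ C * U Y := by
  have sol := hU.sol hn hσ
  have lo : ∀ (r : ℝ) (X : Pt n), 0 < r → r / 2 ≤ enorm' X → (r / 2) ^ 2 ≤ nsq X :=
    fun r X hr h => by rw [← enorm'_sq]; gcongr
  have hi : ∀ (r : ℝ) (X : Pt n), enorm' X ≤ 2 * r → nsq X ≤ (2 * r) ^ 2 :=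
    fun r X h => by rw [← enorm'_sq]; exact pow_le_pow_left₀ (Real.sqrt_nonneg _) h 2
  by_cases hpos : ∃ X : Pt n, ‖X‖ ≤ 1 ∧ 0 < X.2 ∧ U X ≠ 0
  · obtain ⟨m, hm, hlow⟩ := sol.exists_lower_bound hpos
    obtain ⟨C, hC, h⟩ := sol.harnack_of_lower_bound (g := m / 2) (by positivity)
      fun X h1 h2 h3 => by linarith [hlow X h1 h2 h3]
    exact ⟨C, hC, fun r hr hr1 X Y x1 x2 x3 y1 y2 y3 =>
      h r hr hr1 X Y (lo r X hr x1) (hi r X x2) x3 (lo r Y hr y1) (hi r Y y2) y3⟩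
  · push Not at hpos
    refine ⟨1, one_pos, fun r hr hr1 X Y x1 x2 x3 y1 y2 y3 => ?_⟩
    have key : ∀ Z : Pt n, r / 2 ≤ enorm' Z → enorm' Z ≤ 2 * r → 0 ≤ Z.2 → U Z = 0 :=
      fun Z z1 z2 z3 => sol.eq_zero hpos
        ((norm_le_of_nsq_le (by positivity) (hi r Z z2)).trans (by linarith)) z3
        (nsq_pos.1 (lt_of_lt_of_le (by positivity) (lo r Z hr z1)))
    rw [key X x1 x2 x3, key Y y1 y2 y3, mul_zero]
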